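/- Let G be the dihedral group of order 8 acting on ℝ[x,y] by the standard action, let S' = {2 − x² − y², (1 − x²)(1 − y²)} and let K = K_{S'} = [−1,1]². Then T_{S'} is G-saturated: every G-invariant polynomial f ∈ ℝ[x,y]^G that is nonnegative on K belongs to the preordering T_{S'} of ℝ[x,y] generated by S'; equivalently, Psd(K)^G = (T_{S'})^G. -/

import Mathlib

noncomputable section

/-- The preordering of a commutative ring `A` generated by a subset `S`:
the smallest subsemiring of `A` containing `S` together with all squares. -/
def preorderingGen {A : Type*} [CommRing A] (S : Set A) : Set A :=
  (Subsemiring.closure (S ∪ {a | ∃ b, a = b ^ 2}) : Set A)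


section Positivst
variable {A : Type*} [CommRing A]

lemma pre_smul_mem [Algebra ℝ A] (T : Subsemiring A) (hsq : ∀ a, a * a ∈ T) {r : ℝ} (hr : 0 ≤ r) :
    algebraMap ℝ A r ∈ T := by
  have := hsq (algebraMap ℝ A (Real.sqrt r))
  rwa [← map_mul, Real.mul_self_sqrt hr] at this

/-- adjoin an element to a preordering -/
def preAdj (T : Subsemiring A) (hsq : ∀ a, a * a ∈ T) (a : A) : Subsemiring A where
  carrier := {x | ∃ p ∈ T, ∃ q ∈ T, x = p + a * q}
  mul_mem' := by
    rintro x y ⟨p, hp, q, hq, rfl⟩ ⟨p', hp', q', hq', rfl⟩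
    exact ⟨p * p' + (a * a) * (q * q'), T.add_mem (T.mul_mem hp hp')
      (T.mul_mem (hsq a) (T.mul_mem hq hq')), p * q' + q * p',
      T.add_mem (T.mul_mem hp hq') (T.mul_mem hq hp'), by ring⟩
  one_mem' := ⟨1, T.one_mem, 0, T.zero_mem, by ring⟩
  add_mem' := by
    rintro x y ⟨p, hp, q, hq, rfl⟩ ⟨p', hp', q', hq', rfl⟩
    exact ⟨p + p', T.add_mem hp hp', q + q', T.add_mem hq hq', by ring⟩
  zero_mem' := ⟨0, T.zero_mem, 0, T.zero_mem, by ring⟩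

lemma le_preAdj (T : Subsemiring A) (hsq : ∀ a, a * a ∈ T) (a : A) : T ≤ preAdj T hsq a :=
  fun x hx => ⟨x, hx, 0, T.zero_mem, by ring⟩

lemma mem_preAdj (T : Subsemiring A) (hsq : ∀ a, a * a ∈ T) (a : A) : a ∈ preAdj T hsq a :=
  ⟨0, T.zero_mem, 1, T.one_mem, by ring⟩

lemma exists_max_pre (T : Subsemiring A) (hsq : ∀ a, a * a ∈ T) (h1 : (-1 : A) ∉ T) :
    ∃ P : Subsemiring A, T ≤ P ∧ (-1 : A) ∉ P ∧ ∀ a, a ∈ P ∨ -a ∈ P := by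
  obtain ⟨P, hTP, hP⟩ := zorn_le_nonempty₀ {P : Subsemiring A | (-1 : A) ∉ P ∧ T ≤ P} (by
    intro c hc hchain y hy
    refine ⟨sSup c, ⟨?_, ?_⟩, fun z hz => le_sSup hz⟩
    · intro hmem
      rw [Subsemiring.mem_sSup_of_directedOn ⟨y, hy⟩ hchain.directedOn] at hmem
      obtain ⟨s, hs, h⟩ := hmem
      exact (hc hs).1 h
    · exact le_trans (hc hy).2 (le_sSup hy)) T ⟨h1, le_rfl⟩
  have hPm := hP.prop
  have hsqP : ∀ a, a * a ∈ P := fun a => hTP (hsq a)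
  refine ⟨P, hTP, hPm.1, fun a => ?_⟩
  by_contra! hcon
  have key : ∀ b, b ∉ P → (-1 : A) ∈ preAdj P hsqP b := by
    intro b hb
    by_contra h
    have := hP.le_of_ge (y := preAdj P hsqP b) ⟨h, hTP.trans (le_preAdj _ _ _)⟩ (le_preAdj _ _ _)
    exact hb (this (mem_preAdj _ _ _))
  obtain ⟨p, hp, q, hq, e1⟩ := key a hcon.1
  obtain ⟨p', hp', q', hq', e2⟩ := key (-a) hcon.2
  apply hPm.1
  have : (-1 : A) = p + p' + p * p' + (a * a) * (q * q') := by
    have e3 : a * q = -1 - p := by rw [e1]; ring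
    have e4 : a * q' = 1 + p' := by linear_combination e2
    calc (-1 : A) = p + p' + p * p' + (-1 - p) * (1 + p') := by ring
      _ = _ := by rw [← e3, ← e4]; ring
  rw [this]
  exact P.add_mem (P.add_mem (P.add_mem hp hp') (P.mul_mem hp hp'))
    (P.mul_mem (hsqP a) (P.mul_mem hq hq'))

/-- a total archimedean preordering defines a hom to the reals -/
lemma exists_hom [Algebra ℝ A] (P : Subsemiring A) (hsq : ∀ a, a * a ∈ P) (h1 : (-1 : A) ∉ P)
    (htot : ∀ a, a ∈ P ∨ -a ∈ P) (harch : ∀ a : A, ∃ n : ℝ, algebraMap ℝ A n - a ∈ P) :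
    ∃ φ : A →ₐ[ℝ] ℝ, ∀ t ∈ P, 0 ≤ φ t := by
  set ι := algebraMap ℝ A with hι
  have hpos : ∀ r : ℝ, 0 ≤ r → ι r ∈ P := fun r hr => pre_smul_mem P hsq hr
  have hneg : ∀ r : ℝ, ι r ∈ P → 0 ≤ r := by
    intro r hr
    by_contra! h
    apply h1
    have : (-1 : A) = ι (-r)⁻¹ * ι r := by
      rw [← map_mul]
      have : (-r)⁻¹ * r = -1 := by rw [inv_neg, neg_mul, inv_mul_cancel₀ h.ne]
      rw [this, map_neg, map_one]
    rw [this]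
    exact P.mul_mem (hpos _ (by simp; linarith)) hr
  let Cl : A → ℝ → Prop := fun a c => ∀ ε : ℝ, 0 < ε → ι ε + (a - ι c) ∈ P ∧ ι ε - (a - ι c) ∈ P
  have uniq : ∀ a c d, Cl a c → Cl a d → c = d := by
    have : ∀ a c d, Cl a c → Cl a d → c ≤ d := by
      intro a c d hc hd
      by_contra! h
      have e := P.add_mem (hc ((c-d)/3) (by linarith)).2 (hd ((c-d)/3) (by linarith)).1
      have e0 : ι ((c-d)/3) - (a - ι c) + (ι ((c-d)/3) + (a - ι d)) = ι ((c-d)/3+(c-d)/3+c-d) := by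
        simp only [map_add, map_sub]; ring
      have e' := P.add_mem (hd ((c-d)/3) (by linarith)).2 (hc ((c-d)/3) (by linarith)).1
      have e0' : ι ((c-d)/3) - (a - ι d) + (ι ((c-d)/3) + (a - ι c)) = ι ((c-d)/3+(c-d)/3+d-c) := by
        simp only [map_add, map_sub]; ring
      rw [e0'] at e'
      have := hneg _ e'
      linarith
    exact fun a c d hc hd => le_antisymm (this a c d hc hd) (this a d c hd hc)
  have ex : ∀ a, ∃ c, Cl a c := by
    intro a
    set S := {r : ℝ | a - ι r ∈ P}
    obtain ⟨n, hn⟩ := harch a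
    obtain ⟨m, hm⟩ := harch (-a)
    have hne : S.Nonempty := ⟨-m, by simp only [S, Set.mem_ofPred_eq, map_neg]; convert hm using 1; ring⟩
    have hbd : BddAbove S := ⟨n, fun r hr => by
      have := P.add_mem hn hr
      have e : ι n - a + (a - ι r) = ι (n - r) := by rw [map_sub]; ring
      rw [e] at this
      linarith [hneg _ this]⟩
    refine ⟨sSup S, fun ε hε => ⟨?_, ?_⟩⟩
    · obtain ⟨r, hr, hlt⟩ := exists_lt_of_lt_csSup hne (show sSup S - ε < sSup S by linarith)
      have := P.add_mem hr (hpos (r - (sSup S - ε)) (by linarith))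
      convert this using 1
      simp only [map_sub]; ring
    · rcases htot (a - ι (sSup S + ε)) with h | h
      · have := le_csSup hbd (show sSup S + ε ∈ S from h)
        linarith
      · convert h using 1
        simp only [map_add]; ring
  choose φ hφ using ex
  have hz : ∀ x b, Cl x 0 → Cl (x * b) 0 := by
    intro x b hx ε hε
    obtain ⟨n, hn⟩ := harch b
    obtain ⟨m, hm⟩ := harch (-b)
    set N := max (max n m) 1
    have hN : 0 < N := lt_of_lt_of_le one_pos (le_max_right _ _)
    have h1 : ι N - b ∈ P := by
      have := P.add_mem hn (hpos (N - n) (by linarith [le_max_left n m, le_max_left (max n m) 1]))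
      convert this using 1; rw [map_sub]; ring
    have h2 : ι N + b ∈ P := by
      have := P.add_mem hm (hpos (N - m) (by linarith [le_max_right n m, le_max_left (max n m) 1]))
      convert this using 1; rw [map_sub]; ring
    obtain ⟨g1, g2⟩ := hx (ε / N) (by positivity)
    rw [map_zero, sub_zero] at *
    have eN : ι (ε / N) * ι N = ι ε := by rw [← map_mul]; congr 1; field_simp
    have half : ι (1/2) * 2 = 1 := by
      rw [show (2 : A) = ι 2 from (map_ofNat ι 2).symm, ← map_mul]; norm_num
    have hh := hpos (1/2) (by norm_num)
    constructor
    · have := P.mul_mem hh (P.add_mem (P.mul_mem g1 h2) (P.mul_mem g2 h1))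
      convert this using 1
      linear_combination (-ι ε - x * b) * half - 2 * ι (1/2) * eN
    · have := P.mul_mem hh (P.add_mem (P.mul_mem g1 h1) (P.mul_mem g2 h2))
      convert this using 1
      linear_combination (-ι ε + x * b) * half - 2 * ι (1/2) * eN
  have hz' : ∀ x c, Cl x c ↔ Cl (x - ι c) 0 := by
    intro x c; simp only [Cl, map_zero, sub_zero]
  have hadd0 : ∀ x y, Cl x 0 → Cl y 0 → Cl (x + y) 0 := by
    intro x y hx hy ε hε
    have e : ι ε = ι (ε/2) + ι (ε/2) := by rw [← map_add]; congr 1; ring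
    obtain ⟨a1, a2⟩ := hx (ε/2) (by linarith)
    obtain ⟨b1, b2⟩ := hy (ε/2) (by linarith)
    rw [map_zero, sub_zero] at *
    constructor
    · convert P.add_mem a1 b1 using 1; rw [e]; ring
    · convert P.add_mem a2 b2 using 1; rw [e]; ring
  have hadd : ∀ x y, φ (x + y) = φ x + φ y := by
    intro x y
    apply uniq _ _ _ (hφ _)
    rw [hz']
    convert hadd0 _ _ ((hz' _ _).1 (hφ x)) ((hz' _ _).1 (hφ y)) using 1
    rw [map_add]; ring
  have hmul : ∀ x y, φ (x * y) = φ x * φ y := by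
    intro x y
    apply uniq _ _ _ (hφ _)
    rw [hz']
    convert hadd0 _ _ (hz _ y ((hz' _ _).1 (hφ x))) (hz _ (ι (φ x)) ((hz' _ _).1 (hφ y))) using 1
    rw [map_mul]; ring
  have hconst : ∀ r, φ (ι r) = r := by
    intro r
    apply uniq _ _ _ (hφ _)
    intro ε hε
    simp only [sub_self, add_zero, sub_zero]
    exact ⟨hpos _ hε.le, hpos _ hε.le⟩
  refine ⟨{ toFun := φ, map_one' := by simpa using hconst 1, map_mul' := hmul,
            map_zero' := by simpa using hconst 0, map_add' := hadd,
            commutes' := hconst }, ?_⟩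
  intro t ht
  change 0 ≤ φ t
  by_contra! h
  have := P.add_mem (hφ t (-φ t / 2) (by linarith)).2 ht
  have e : ι (-φ t / 2) - (t - ι (φ t)) + t = ι (-φ t / 2 + φ t) := by rw [map_add]; ring
  rw [e] at this
  have := hneg _ this
  linarith

theorem positivst [Algebra ℝ A] (T : Subsemiring A) (hsq : ∀ a, a * a ∈ T)
    (harch : ∀ a : A, ∃ n : ℝ, algebraMap ℝ A n - a ∈ T) (f : A)
    (hf : ∀ φ : A →ₐ[ℝ] ℝ, (∀ t ∈ T, 0 ≤ φ t) → 0 < φ f) : f ∈ T := by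
  have h1 : (-1 : A) ∈ preAdj T hsq (-f) := by
    by_contra h
    have hle := le_preAdj T hsq (-f)
    obtain ⟨P, hP, hP1, hPt⟩ := exists_max_pre (preAdj T hsq (-f)) (fun a => hle (hsq a)) h
    obtain ⟨φ, hφ⟩ := exists_hom P (fun a => hP (hle (hsq a))) hP1 hPt
      (fun a => (harch a).imp fun n hn => hP (hle hn))
    have h2 := hφ _ (hP (mem_preAdj T hsq (-f)))
    have h3 := hf φ (fun t ht => hφ t (hP (hle ht)))
    rw [map_neg] at h2
    linarith
  obtain ⟨t', ht', t, ht, e⟩ := h1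
  obtain ⟨N0, hN0⟩ := harch t
  set ι := algebraMap ℝ A with hι
  have hpos : ∀ r : ℝ, 0 ≤ r → ι r ∈ T := fun r hr => pre_smul_mem T hsq hr
  set N := max N0 1
  have hN1 : 1 ≤ N := le_max_right _ _
  have hN : ι N - t ∈ T := by
    convert T.add_mem hN0 (hpos (N - N0) (by linarith [le_max_left N0 1])) using 1
    rw [map_sub]; ring
  have step : ∀ r : ℝ, 0 ≤ r → ι r + f ∈ T → ι (r - 1/N) + f ∈ T := by
    intro r hr hrf
    have h := T.mul_mem (hpos (1/N) (by positivity)) (T.add_mem (T.add_mem (T.mul_mem hN hrf) ht')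
      (T.mul_mem (hpos r hr) ht))
    convert h using 1
    have eN : ι (1/N) * ι N = 1 := by rw [← map_mul, one_div, inv_mul_cancel₀ (by positivity), map_one]
    rw [map_sub]
    linear_combination (-f - ι r) * eN + ι (1/N) * e
  obtain ⟨r0, hr0⟩ := harch (-f)
  have it : ∀ k : ℕ, ι (max 0 (r0 - k / N)) + f ∈ T := by
    intro k
    induction k with
    | zero =>
      convert T.add_mem hr0 (hpos (max 0 r0 - r0) (by linarith [le_max_right 0 r0])) using 1
      simp only [map_sub]; simp; ring
    | succ k ih =>
      have := step _ (le_max_left _ _) ih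
      convert T.add_mem this (hpos (max 0 (r0 - (k+1 : ℕ) / N) - (max 0 (r0 - k / N) - 1/N)) ?_) using 1
      · simp only [map_sub]; ring
      · push_cast
        have e : (k + 1 : ℝ) / N = k / N + 1 / N := by ring
        have : 0 < 1 / N := by positivity
        rw [e]
        rcases max_cases 0 (r0 - k / N) with h | h <;> rcases max_cases 0 (r0 - (k/N + 1/N)) with h' | h' <;> linarith
  obtain ⟨k, hk⟩ := exists_nat_gt (r0 * N)
  have := it k
  rw [max_eq_left (by
    have : r0 < k / N := by rw [lt_div_iff₀ (by positivity)]; exact hk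
    linarith), map_zero, zero_add] at this
  exact this

end Positivst


section Weier
variable {K : Type*} [Field K]

lemma ps_modEq_iff (n : ℕ) (x y : PowerSeries K) :
    x ≡ y [SMOD (IsLocalRing.maximalIdeal (PowerSeries K) ^ n • ⊤ : Submodule (PowerSeries K) (PowerSeries K))]
      ↔ ∀ m < n, x.coeff m = y.coeff m := by
  rw [SModEq.sub_mem, PowerSeries.maximalIdeal_eq_span_X, Ideal.span_singleton_pow]
  simp only [smul_eq_mul, Ideal.mul_top]
  rw [Ideal.mem_span_singleton, PowerSeries.X_pow_dvd_iff]
  simp only [map_sub, sub_eq_zero]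

instance ps_adic : IsAdicComplete (IsLocalRing.maximalIdeal (PowerSeries K)) (PowerSeries K) where
  haus' := by
    intro x hx
    ext n
    simpa using (ps_modEq_iff (n+1) x 0).1 (hx (n+1)) n (Nat.lt_succ_self n)
  prec' := by
    intro f hf
    refine ⟨PowerSeries.mk fun n => (f (n+1)).coeff n, fun n => ?_⟩
    rw [ps_modEq_iff]
    intro m hm
    rw [PowerSeries.coeff_mk]
    have := (ps_modEq_iff _ _ _).1 (hf (show m+1 ≤ n by omega)) m (by omega)
    exact this.symm

/-- residue (r = 0) of a polynomial over power series -/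
abbrev res (h : Polynomial (PowerSeries K)) : Polynomial K := h.map PowerSeries.constantCoeff

lemma ps_mem_max (a : PowerSeries K) :
    a ∈ IsLocalRing.maximalIdeal (PowerSeries K) ↔ PowerSeries.constantCoeff a = 0 := by
  rw [PowerSeries.maximalIdeal_eq_span_X, Ideal.mem_span_singleton, PowerSeries.X_dvd_iff]

theorem factor_lemma (h : Polynomial (PowerSeries K)) (n : ℕ) (q : Polynomial K)
    (hq : q.coeff 0 ≠ 0) (hh : res h = Polynomial.X ^ n * q) :
    ∃ P Q : Polynomial (PowerSeries K), h = P * Q ∧ P.Monic ∧ P.natDegree = n ∧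
      res P = Polynomial.X ^ n ∧ res Q = q := by
  have hne : PowerSeries.map (IsLocalRing.residue (PowerSeries K)) (h : PowerSeries (PowerSeries K)) ≠ 0 := by
    intro h0
    have := congrArg (PowerSeries.coeff n) h0
    rw [PowerSeries.coeff_map, Polynomial.coeff_coe, map_zero, IsLocalRing.residue_eq_zero_iff,
      ps_mem_max, ← Polynomial.coeff_map] at this
    change (res h).coeff n = 0 at this
    rw [hh] at this
    have e := Polynomial.coeff_X_pow_mul q n 0
    rw [zero_add] at e
    exact hq (e ▸ this)
  obtain ⟨P, U, hPU⟩ := PowerSeries.exists_isWeierstrassFactorization hne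
  have hmon := hPU.isDistinguishedAt.monic
  have hdiv := Polynomial.modByMonic_add_div h P
  have hdeg := Polynomial.degree_modByMonic_lt h hmon
  have hnt : IsLocalRing.maximalIdeal (PowerSeries K) ≠ ⊤ := IsLocalRing.maximalIdeal.isMaximal _ |>.ne_top
  have hW := hPU.isDistinguishedAt.isWeierstrassDivisorAt hnt
  have hresP : res P = Polynomial.X ^ P.natDegree := by
    ext i
    rw [Polynomial.coeff_map, Polynomial.coeff_X_pow]
    rcases lt_trichotomy i P.natDegree with hi | hi | hi
    · rw [if_neg hi.ne, ← ps_mem_max]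
      exact hPU.isDistinguishedAt.mem hi
    · rw [if_pos hi, hi, hmon.coeff_natDegree]; simp
    · rw [if_neg hi.ne', Polynomial.coeff_eq_zero_of_natDegree_lt hi]; simp
  have ho := hPU.isDistinguishedAt.coe_natDegree_eq_order_map P 1
    (by rwa [PowerSeries.constantCoeff_one, ← Ideal.ne_top_iff_one]) (by simp)
  have hdegP : P.degree = ((PowerSeries.map (Ideal.Quotient.mk (IsLocalRing.maximalIdeal (PowerSeries K))) (P : PowerSeries (PowerSeries K))).order.toNat : ℕ) := by
    rw [← ho, Polynomial.degree_eq_natDegree hmon.ne_zero]; simp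
  obtain ⟨key1, key2⟩ := hW.eq_of_mul_add_eq_mul_add (q := U) (q' := ((h /ₘ P : Polynomial (PowerSeries K)) : PowerSeries (PowerSeries K)))
    (r := 0) (r' := h %ₘ P) (by simp) (by rw [← hdegP]; exact hdeg) (by
      rw [← hPU.eq_mul]
      conv_lhs => rw [← hdiv]
      push_cast; ring)
  rw [← key2, zero_add] at hdiv
  have hU := hPU.isUnit
  rw [key1, PowerSeries.isUnit_iff_constantCoeff] at hU
  have hU2 : (res (h /ₘ P)).coeff 0 ≠ 0 := by
    rw [Polynomial.coeff_map]
    rw [← PowerSeries.coeff_zero_eq_constantCoeff_apply, Polynomial.coeff_coe, PowerSeries.isUnit_iff_constantCoeff] at hU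
    exact hU.ne_zero
  have e : Polynomial.X ^ P.natDegree * res (h /ₘ P) = Polynomial.X ^ n * q := by
    rw [← hh, ← hresP]; conv_rhs => rw [← hdiv]
    exact (Polynomial.map_mul _).symm
  have hn : P.natDegree = n := by
    have coe : ∀ (a b : ℕ) (p q : Polynomial K), p.coeff 0 ≠ 0 → a < b →
        Polynomial.X ^ a * p ≠ Polynomial.X ^ b * q := by
      intro a b p q hp hab h
      have := congrArg (fun p => Polynomial.coeff p a) h
      simp only [Polynomial.coeff_X_pow_mul'] at this
      simp [hab.not_ge, hp] at this
    rcases lt_trichotomy P.natDegree n with hl | hl | hl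
    · exact absurd e (coe _ _ _ _ hU2 hl)
    · exact hl
    · exact absurd e.symm (coe _ _ _ _ hq hl)
  refine ⟨P, h /ₘ P, hdiv.symm, hmon, hn, hn ▸ hresP, ?_⟩
  rw [hn] at e
  exact mul_left_cancel₀ (pow_ne_zero _ Polynomial.X_ne_zero) e
end Weier


section Puiseux
open Polynomial

/-- substitution `r = c * π ^ e` in a power series -/
def arcHom {R : Type*} [CommRing R] (c : R) (e : ℕ) (he : e ≠ 0) : PowerSeries R →+* PowerSeries R :=
  ((PowerSeries.expand e he : PowerSeries R →ₐ[R] PowerSeries R) : PowerSeries R →+* PowerSeries R).comp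
    (PowerSeries.rescale c)

lemma arcHom_apply {R : Type*} [CommRing R] (c : R) (e : ℕ) (he : e ≠ 0) (f : PowerSeries R) :
  arcHom c e he f = PowerSeries.expand e he (PowerSeries.rescale c f) := rfl

lemma coeff_arcHom {R : Type*} [CommRing R] (c : R) (e : ℕ) (he : e ≠ 0) (f : PowerSeries R) (n : ℕ) :
    (arcHom c e he f).coeff n = if e ∣ n then c ^ (n / e) * f.coeff (n / e) else 0 := by
  rw [arcHom_apply, PowerSeries.coeff_expand]
  split_ifs <;> simp [PowerSeries.coeff_rescale]

lemma arcHom_X {R : Type*} [CommRing R] (c : R) (e : ℕ) (he : e ≠ 0) :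
    arcHom c e he PowerSeries.X = PowerSeries.C c * PowerSeries.X ^ e := by
  rw [arcHom_apply, PowerSeries.rescale_X, map_mul, PowerSeries.expand_C, PowerSeries.expand_X]

lemma arcHom_C {R : Type*} [CommRing R] (c : R) (e : ℕ) (he : e ≠ 0) (a : R) :
    arcHom c e he (PowerSeries.C a) = PowerSeries.C a := by
  ext n
  rw [coeff_arcHom, PowerSeries.coeff_C, PowerSeries.coeff_C]
  rcases Nat.eq_zero_or_pos n with rfl | hn
  · simp
  · rw [if_neg hn.ne']
    split_ifs with h1 h2
    · rw [Nat.div_eq_zero_iff] at h2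
      have := Nat.le_of_dvd hn h1
      omega
    · simp
    · rfl

lemma constantCoeff_arcHom {R : Type*} [CommRing R] (c : R) (e : ℕ) (he : e ≠ 0) (f : PowerSeries R) :
    PowerSeries.constantCoeff (arcHom c e he f) = PowerSeries.constantCoeff f := by
  rw [← PowerSeries.coeff_zero_eq_constantCoeff_apply, coeff_arcHom]; simp

lemma arcHom_arcHom {R : Type*} [CommRing R] (c c' : R) (e e' : ℕ) (he : e ≠ 0) (he' : e' ≠ 0)
    (f : PowerSeries R) :
    arcHom c' e' he' (arcHom c e he f) = arcHom (c * c' ^ e) (e * e') (mul_ne_zero he he') f := by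
  ext n
  simp only [coeff_arcHom]
  by_cases h : e' ∣ n
  · obtain ⟨k, rfl⟩ := h
    rw [if_pos (dvd_mul_right _ _), Nat.mul_div_cancel_left _ (Nat.pos_of_ne_zero he')]
    by_cases h2 : e ∣ k
    · obtain ⟨l, rfl⟩ := h2
      have : e' * (e * l) / (e * e') = l := by
        rw [show e' * (e * l) = (e * e') * l by ring]
        exact Nat.mul_div_cancel_left _ (Nat.pos_of_ne_zero (mul_ne_zero he he'))
      rw [if_pos (dvd_mul_right _ _), Nat.mul_div_cancel_left _ (Nat.pos_of_ne_zero he), if_pos ⟨l, by ring⟩, this]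
      ring
    · rw [if_neg h2, if_neg, mul_zero]
      rintro ⟨l, hl⟩
      apply h2
      refine ⟨l, ?_⟩
      apply mul_left_cancel₀ he'
      rw [hl]; ring
  · rw [if_neg h, if_neg]
    rintro ⟨l, hl⟩
    exact h ⟨e * l, by rw [hl]; ring⟩

lemma eval₂_taylor' {R S : Type*} [CommRing R] [CommRing S] (φ : R →+* S) (x : S) (r : R) (f : R[X]) :
    eval₂ φ x (taylor r f) = eval₂ φ (x + φ r) f := by
  rw [taylor_apply, eval₂_comp]; simp

lemma monic_taylor' {R : Type*} [CommRing R] (r : R) {f : R[X]} (hf : f.Monic) : (taylor r f).Monic := by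
  rw [Monic, leadingCoeff_taylor]; exact hf

lemma taylor_next {R : Type*} [CommRing R] (r : R) {f : R[X]} (hf : f.Monic) {n : ℕ}
    (hn : f.natDegree = n + 1) : (taylor r f).coeff n = f.coeff n + (n + 1 : ℕ) * r := by
  rw [taylor_coeff, eval_eq_sum_range' (n := 2)]
  · simp only [Finset.sum_range_succ, Finset.sum_range_zero, hasseDeriv_coeff]
    have h1 : f.coeff (1 + n) = 1 := by rw [add_comm, ← hn]; exact hf
    rw [h1]
    simp [add_comm 1 n]
  · have := natDegree_hasseDeriv_le f n
    omega

/-- the key induction step data: scale a polynomial to get a non-degenerate residue -/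
lemma exists_scale {K : Type*} [Field K] (h : (PowerSeries K)[X]) (hm : h.Monic) {n : ℕ}
    (hn : h.natDegree = n + 1) (h0 : h.coeff n = 0) (hX : h ≠ X ^ (n + 1)) :
    ∃ (N : ℕ) (hN : N ≠ 0) (S : ℕ) (h1 : (PowerSeries K)[X]), h1.Monic ∧ h1.natDegree = n + 1 ∧
      (res h1).coeff n = 0 ∧ res h1 ≠ X ^ (n + 1) ∧
      h.map (arcHom 1 N hN) = scaleRoots h1 (PowerSeries.X ^ S) := by
  classical
  set N := (n + 1).factorial with hNdef
  have hN : N ≠ 0 := Nat.factorial_ne_zero _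
  set J := (Finset.range (n+1)).filter (fun j => h.coeff j ≠ 0) with hJ
  have hJne : J.Nonempty := by
    by_contra hcon
    rw [Finset.not_nonempty_iff_eq_empty] at hcon
    apply hX
    ext1 j
    rw [coeff_X_pow]
    rcases lt_trichotomy j (n+1) with hj | hj | hj
    · rw [if_neg hj.ne]
      by_contra hne
      have : j ∈ J := by simp [hJ, hj, hne]
      simp [hcon] at this
    · rw [if_pos hj, hj, ← hn]; exact hm
    · rw [if_neg hj.ne', coeff_eq_zero_of_natDegree_lt (by omega)]
  set w : ℕ → ℕ := fun j => (h.coeff j).order.toNat * (N / (n + 1 - j)) with hw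
  obtain ⟨j0, hj0, hmin⟩ := Finset.exists_min_image J w hJne
  have hj0' : j0 < n + 1 ∧ h.coeff j0 ≠ 0 := by simpa [hJ] using hj0
  set S := w j0 with hS
  have hdvdN : ∀ j < n + 1, N / (n+1-j) * (n+1-j) = N := fun j hj =>
    Nat.div_mul_cancel (Nat.dvd_factorial (by omega) (by omega))
  have hdvd : ∀ j, ∃ b : PowerSeries K, arcHom 1 N hN (h.coeff j) = PowerSeries.X ^ (S * (n + 1 - j)) * b := by
    intro j
    change PowerSeries.X ^ (S * (n + 1 - j)) ∣ arcHom 1 N hN (h.coeff j)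
    by_cases hj : j < n + 1
    · by_cases hc : h.coeff j = 0
      · rw [hc, map_zero]; exact dvd_zero _
      · have h2 := hmin j (by simp [hJ, hj, hc])
        obtain ⟨a, ha⟩ := PowerSeries.X_pow_order_dvd (φ := h.coeff j)
        rw [ha, map_mul, map_pow, arcHom_X]
        apply Dvd.dvd.mul_right
        rw [map_one, one_mul, ← pow_mul]
        apply pow_dvd_pow
        calc S * (n+1-j) ≤ w j * (n+1-j) := Nat.mul_le_mul_right _ h2
          _ = N * (h.coeff j).order.toNat := by
            rw [hw]; simp only; rw [mul_assoc, hdvdN j hj, mul_comm]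
    · rw [show n + 1 - j = 0 by omega]; simp
  choose b hb using hdvd
  have hb1 : b (n+1) = 1 := by
    have := hb (n+1)
    rw [← hn, hm.coeff_natDegree, hn] at this
    simpa using this.symm
  set h1 : (PowerSeries K)[X] := ∑ j ∈ Finset.range (n+2), monomial j (b j) with hh1
  have hco : ∀ j, h1.coeff j = if j < n + 2 then b j else 0 := by
    intro j
    rw [hh1, finsetSum_coeff]
    simp [coeff_monomial]
  have hdeg : h1.natDegree ≤ n + 1 := by
    rw [natDegree_le_iff_coeff_eq_zero]
    intro k hk
    rw [hco, if_neg (by omega)]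
  have hmon : h1.Monic := monic_of_natDegree_le_of_coeff_eq_one (n+1) hdeg (by rw [hco, if_pos (by omega), hb1])
  have hdeg' : h1.natDegree = n + 1 := by
    apply le_antisymm hdeg
    apply le_natDegree_of_ne_zero
    rw [hco, if_pos (by omega), hb1]; exact one_ne_zero
  refine ⟨N, hN, S, h1, hmon, hdeg', ?_, ?_, ?_⟩
  · rw [coeff_map, hco, if_pos (by omega)]
    have := hb n
    rw [h0, map_zero] at this
    rcases mul_eq_zero.1 this.symm with h | h
    · exact absurd h (pow_ne_zero _ PowerSeries.X_ne_zero)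
    · rw [h, map_zero]
  · intro hcon
    have := congrArg (fun p => coeff p j0) hcon
    simp only [coeff_map, hco, if_pos (show j0 < n + 2 by omega), coeff_X_pow, if_neg hj0'.1.ne] at this
    have h3 := hb j0
    rw [← PowerSeries.X_dvd_iff] at this
    obtain ⟨b', hb'⟩ := this
    have h4 := congrArg (PowerSeries.coeff (N * (h.coeff j0).order.toNat)) h3
    have e : S * (n + 1 - j0) = N * (h.coeff j0).order.toNat := by
      rw [hS, hw]; simp only; rw [mul_assoc, hdvdN j0 hj0'.1, mul_comm]
    rw [coeff_arcHom, if_pos (dvd_mul_right _ _), Nat.mul_div_cancel_left _ (Nat.pos_of_ne_zero hN), e, hb',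
      PowerSeries.coeff_X_pow_mul', if_pos le_rfl] at h4
    simp only [one_pow, one_mul, Nat.sub_self, PowerSeries.coeff_zero_eq_constantCoeff, map_mul,
      PowerSeries.constantCoeff_X, zero_mul] at h4
    exact PowerSeries.coeff_order hj0'.2 h4
  · ext1 j
    rw [coeff_map, coeff_scaleRoots, hdeg', hco]
    split_ifs with hj
    · rw [hb j, ← pow_mul, mul_comm]
    · rw [coeff_eq_zero_of_natDegree_lt (by omega)]; simp

theorem puiseux {K : Type*} [Field K] [IsAlgClosed K] [CharZero K] : ∀ (n : ℕ) (h : (PowerSeries K)[X]),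
    h.Monic → h.natDegree = n → n ≠ 0 →
    ∃ (e : ℕ) (he : e ≠ 0) (θ : PowerSeries K), eval₂ (arcHom 1 e he) θ h = 0 := by
  intro n
  induction n using Nat.strong_induction_on with
  | _ n ih =>
  intro h hm hn hn0
  obtain ⟨n, rfl⟩ := Nat.exists_eq_succ_of_ne_zero hn0
  -- Tschirnhaus
  set r : PowerSeries K := - PowerSeries.C ((n + 1 : K)⁻¹) * h.coeff n with hr
  have hn1 : (n + 1 : K) ≠ 0 := by exact_mod_cast Nat.succ_ne_zero n
  set g := taylor r h with hg
  have hgm : g.Monic := monic_taylor' r hm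
  have hgn : g.natDegree = n + 1 := by rw [hg, natDegree_taylor, hn]
  have hg0 : g.coeff n = 0 := by
    rw [hg, taylor_next r hm hn, hr]
    have : ((n + 1 : ℕ) : PowerSeries K) * PowerSeries.C ((n + 1 : K)⁻¹) = 1 := by
      rw [show ((n + 1 : ℕ) : PowerSeries K) = PowerSeries.C (n + 1 : K) by simp, ← map_mul, mul_inv_cancel₀ hn1, map_one]
    linear_combination (-h.coeff n) * this
  suffices hs : ∃ (e : ℕ) (he : e ≠ 0) (θ : PowerSeries K), eval₂ (arcHom 1 e he) θ g = 0 by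
    obtain ⟨e, he, θ, hθ⟩ := hs
    rw [hg, eval₂_taylor'] at hθ
    exact ⟨e, he, _, hθ⟩
  by_cases hX : g = X ^ (n + 1)
  · exact ⟨1, one_ne_zero, 0, by rw [hX]; simp⟩
  obtain ⟨N, hN, S, h1, h1m, h1n, h10, h1X, hsc⟩ := exists_scale g hgm hgn hg0 hX
  have hresm : (res h1).Monic := h1m.map _
  have hresn : (res h1).natDegree = n + 1 := by rw [h1m.natDegree_map, h1n]
  obtain ⟨c, hc⟩ := IsAlgClosed.exists_root (res h1) (by
    rw [degree_eq_natDegree hresm.ne_zero, hresn]; exact_mod_cast Nat.succ_ne_zero n)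
  obtain ⟨q, hq, hqn⟩ := exists_eq_pow_rootMultiplicity_mul_and_not_dvd (res h1) hresm.ne_zero c
  set m := rootMultiplicity c (res h1) with hmdef
  have hm0 : m ≠ 0 := ((rootMultiplicity_pos hresm.ne_zero).2 hc).ne'
  have hq0 : q ≠ 0 := by rintro rfl; simp at hqn
  have hdegsum : n + 1 = m + q.natDegree := by
    rw [← hresn, hq, natDegree_mul (pow_ne_zero _ (X_sub_C_ne_zero c)) hq0, natDegree_pow, natDegree_X_sub_C, mul_one]
  have hmlt : m < n + 1 := by
    rcases Nat.eq_zero_or_pos q.natDegree with h0 | h0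
    · exfalso
      have hmn : m = n + 1 := by omega
      have hqm : q.Monic := by
        have : ((X - C c) ^ m).Monic := (monic_X_sub_C c).pow m
        rw [hq] at hresm
        exact this.of_mul_monic_left hresm
      have hq1 : q = 1 := hqm.natDegree_eq_zero.1 h0
      rw [hq1, mul_one, hmn] at hq
      have hco : (taylor c (res h1)).coeff n = 0 := by
        rw [hq, taylor_pow]; simp [taylor_apply, coeff_X_pow]
      rw [taylor_next c hresm hresn, h10, zero_add] at hco
      have hc0 : c = 0 := by
        rcases mul_eq_zero.1 hco with h | h
        · exact absurd h (by exact_mod_cast Nat.succ_ne_zero n)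
        · exact h
      apply h1X
      rw [hq, hc0]; simp
    · omega
  have hres2 : res (taylor (PowerSeries.C c) h1) = X ^ m * taylor c q := by
    rw [res, map_taylor, PowerSeries.constantCoeff_C]
    change taylor c (res h1) = _
    rw [hq, taylor_mul, taylor_pow]; simp [taylor_apply]
  obtain ⟨P, Q, hPQ, hPm, hPn, -, -⟩ := factor_lemma (taylor (PowerSeries.C c) h1) m (taylor c q) (by
    rw [taylor_coeff_zero]
    intro h
    exact hqn (dvd_iff_isRoot.2 h)) hres2
  obtain ⟨e, he, θ, hθ⟩ := ih m hmlt P hPm hPn hm0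
  have h5 : eval₂ (arcHom 1 e he) θ (taylor (PowerSeries.C c) h1) = 0 := by
    rw [hPQ, eval₂_mul, hθ, zero_mul]
  rw [eval₂_taylor'] at h5
  have h6 := scaleRoots_eval₂_eq_zero (s := PowerSeries.X ^ S) _ h5
  rw [← hsc, eval₂_map] at h6
  have e7 : (arcHom (1 : K) e he).comp (arcHom 1 N hN) = arcHom 1 (N * e) (mul_ne_zero hN he) := by
    ext1 f
    rw [RingHom.comp_apply, arcHom_arcHom]; simp
  rw [e7] at h6
  exact ⟨N * e, mul_ne_zero hN he, _, h6⟩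
end Puiseux


section PPosSec
open Polynomial

/-- formal positivity of a real power series -/
def PPos (f : PowerSeries ℝ) : Prop :=
  ∃ (n : ℕ) (g : PowerSeries ℝ), f = PowerSeries.X ^ n * g ∧ 0 < PowerSeries.constantCoeff g

lemma PPos.mul {f g : PowerSeries ℝ} (hf : PPos f) (hg : PPos g) : PPos (f * g) := by
  obtain ⟨n, f', rfl, hf⟩ := hf
  obtain ⟨m, g', rfl, hg⟩ := hg
  exact ⟨n + m, f' * g', by ring, by rw [map_mul]; positivity⟩

lemma PPos.add {f g : PowerSeries ℝ} (hf : PPos f) (hg : PPos g) : PPos (f + g) := by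
  obtain ⟨n, f', rfl, hf⟩ := hf
  obtain ⟨m, g', rfl, hg⟩ := hg
  wlog h : n ≤ m generalizing n m f' g'
  · rw [add_comm]; exact this m g' hg n f' hf (by omega)
  obtain ⟨k, rfl⟩ := Nat.exists_eq_add_of_le h
  refine ⟨n, f' + PowerSeries.X ^ k * g', by ring, ?_⟩
  rcases Nat.eq_zero_or_pos k with rfl | hk
  · simp; linarith
  · simp [hk.ne']; linarith

lemma not_PPos_zero : ¬ PPos 0 := by
  rintro ⟨n, g, h, hg⟩
  have : g = 0 := by
    rcases mul_eq_zero.1 h.symm with h | h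
    · exact absurd h (pow_ne_zero _ PowerSeries.X_ne_zero)
    · exact h
  simp [this] at hg

lemma PPos.ne_zero {f : PowerSeries ℝ} (hf : PPos f) : f ≠ 0 := by
  rintro rfl; exact not_PPos_zero hf

lemma PPos.not_neg {f : PowerSeries ℝ} (hf : PPos f) : ¬ PPos (-f) := by
  intro h
  have := hf.add h
  rw [add_neg_cancel] at this
  exact not_PPos_zero this

lemma PPos_or {f : PowerSeries ℝ} (hf : f ≠ 0) : PPos f ∨ PPos (-f) := by
  obtain ⟨g, hg⟩ := PowerSeries.X_pow_order_dvd (φ := f)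
  have hg0 : PowerSeries.constantCoeff g ≠ 0 := by
    have h1 := PowerSeries.coeff_order hf
    intro h0
    apply h1
    have h2 := congrArg (PowerSeries.coeff f.order.toNat) hg
    rw [PowerSeries.coeff_X_pow_mul', if_pos le_rfl, Nat.sub_self] at h2
    rw [h2]
    simpa using h0
  rcases lt_or_gt_of_ne hg0 with h | h
  · exact Or.inr ⟨_, -g, by rw [mul_neg, ← hg], by rw [map_neg]; linarith⟩
  · exact Or.inl ⟨_, g, hg, h⟩

lemma PPos_sq {f : PowerSeries ℝ} (hf : f ≠ 0) : PPos (f * f) := by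
  rcases PPos_or hf with h | h
  · exact h.mul h
  · have := h.mul h; rwa [neg_mul_neg] at this

lemma PPos_const {f : PowerSeries ℝ} (hf : 0 < PowerSeries.constantCoeff f) : PPos f :=
  ⟨0, f, by simp, hf⟩

lemma PPos_X_pow (n : ℕ) : PPos (PowerSeries.X ^ n) := ⟨n, 1, by simp, by simp⟩

lemma sq_add_sq_nn (f g : PowerSeries ℝ) : ¬ PPos (-(f * f + g * g)) := by
  by_cases hf : f = 0
  · by_cases hg : g = 0
    · subst hf; subst hg; simpa using not_PPos_zero
    · subst hf; simpa using (PPos_sq hg).not_neg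
  · by_cases hg : g = 0
    · subst hg; simpa using (PPos_sq hf).not_neg
    · exact ((PPos_sq hf).add (PPos_sq hg)).not_neg

/-- nonneg times -/
lemma neg_of_mul {s f : PowerSeries ℝ} (hs : ¬ PPos (-s)) (hs0 : s ≠ 0) (hf : PPos (-f)) : PPos (-(s * f)) := by
  have := ((PPos_or hs0).resolve_right hs).mul hf
  rwa [mul_neg] at this

/-- hypothesis of theorem L : formally psd up to finitely many exceptions on each arc type -/
def HL (h : (PowerSeries ℝ)[X]) : Prop := ∀ (e : ℕ) (he : e ≠ 0) (σ : ℝ), (σ = 1 ∨ σ = -1) →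
  {θ : PowerSeries ℝ | PPos (-(eval₂ (arcHom σ e he) θ h))}.Finite

lemma finite_roots (φ : PowerSeries ℝ →+* PowerSeries ℝ) {s : (PowerSeries ℝ)[X]} (hs : s.Monic) :
    {θ : PowerSeries ℝ | eval₂ φ θ s = 0}.Finite := by
  classical
  have h0 : s.map φ ≠ 0 := (hs.map φ).ne_zero
  apply (s.map φ).roots.toFinset.finite_toSet.subset
  intro θ hθ
  simp only [Finset.mem_coe, Multiset.mem_toFinset]
  rw [mem_roots h0, IsRoot, eval_map]
  exact hθ

lemma HL.of_mul {s h : (PowerSeries ℝ)[X]} (hs : s.Monic)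
    (hnn : ∀ (φ : PowerSeries ℝ →+* PowerSeries ℝ) (θ : PowerSeries ℝ), ¬ PPos (-(eval₂ φ θ s)))
    (H : HL (s * h)) : HL h := by
  intro e he σ hσ
  apply ((H e he σ hσ).union (finite_roots (arcHom σ e he) hs)).subset
  intro θ hθ
  by_cases h0 : eval₂ (arcHom σ e he) θ s = 0
  · exact Or.inr h0
  · left
    have h1 := neg_of_mul (hnn (arcHom σ e he) θ) h0 hθ
    change PPos (-(eval₂ (arcHom σ e he) θ (s * h)))
    rwa [eval₂_mul]

/-- simple real root gives a sign change -/
lemma sign_change (H : (PowerSeries ℝ)[X]) (h0 : H.coeff 0 = 0) (h1 : H.coeff 1 ≠ 0) :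
    ¬ {θ : PowerSeries ℝ | PPos (-(eval θ H))}.Finite := by
  intro hfin
  obtain ⟨H1, hH1⟩ : X ∣ H := X_dvd_iff.2 h0
  have hc : H1.coeff 0 = H.coeff 1 := by rw [hH1, coeff_X_mul]
  obtain ⟨D, d, hd, hd0⟩ : ∃ (D : ℕ) (d : PowerSeries ℝ), H.coeff 1 = PowerSeries.X ^ D * d ∧
      PowerSeries.constantCoeff d ≠ 0 := by
    rcases PPos_or h1 with ⟨D, d, e, h⟩ | ⟨D, d, e, h⟩
    · exact ⟨D, d, e, h.ne'⟩
    · exact ⟨D, -d, by rw [mul_neg, ← e, neg_neg], by rw [map_neg]; linarith⟩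
  obtain ⟨H2, hH2⟩ : X ∣ H1 - C (H.coeff 1) := by
    rw [X_dvd_iff]; simp [hc]
  have hval : ∀ t, eval t H = t * (H.coeff 1 + t * eval t H2) := by
    intro t
    have : H1 = C (H.coeff 1) + X * H2 := by rw [← hH2]; ring
    conv_lhs => rw [hH1, this]
    simp
  set s : PowerSeries ℝ := if 0 < PowerSeries.constantCoeff d then -1 else 1 with hs
  have hpos : ∀ M : ℕ, PPos (-(eval (s * PowerSeries.X ^ (D + 1 + M)) H)) := by
    intro M
    rw [hval, hd]
    have e : -(s * PowerSeries.X ^ (D + 1 + M) * (PowerSeries.X ^ D * d + s * PowerSeries.X ^ (D + 1 + M) * eval (s * PowerSeries.X ^ (D + 1 + M)) H2))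
      = PowerSeries.X ^ (D + D + 1 + M) * (-s * (d + PowerSeries.X * (s * PowerSeries.X ^ M * eval (s * PowerSeries.X ^ (D + 1 + M)) H2))) := by
      ring
    refine ⟨_, _, e, ?_⟩
    rw [map_mul, map_add, map_mul, PowerSeries.constantCoeff_X, zero_mul, add_zero, hs]
    split_ifs with h
    · simpa using h
    · have := lt_of_le_of_ne (not_lt.1 h) hd0
      simp; exact this
  have hinj : Function.Injective (fun M : ℕ => s * PowerSeries.X ^ (D + 1 + M)) := by
    intro a b hab
    simp only at hab
    have hs0 : s ≠ 0 := by rw [hs]; split_ifs <;> simp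
    have := mul_left_cancel₀ hs0 hab
    have h3 := congrArg PowerSeries.order this
    rw [PowerSeries.order_X_pow, PowerSeries.order_X_pow] at h3
    have h4 : D + 1 + a = D + 1 + b := by exact_mod_cast h3
    omega
  exact (Set.infinite_range_of_injective hinj) (hfin.subset (by
    rintro _ ⟨M, rfl⟩; exact hpos M))

/-- at a root of an irreducible monic polynomial, a non-multiple does not vanish -/
lemma eval_ne_of_not_dvd {R S : Type*} [CommRing R] [IsDomain R] [IsIntegrallyClosed R] [CommRing S] [IsDomain S]
    (φ : R →+* S) (hφ : Function.Injective φ) {g f : R[X]} (hg : g.Monic) (hgi : Irreducible g)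
    (hnd : ¬ g ∣ f) {θ : S} (hθ : eval₂ φ θ g = 0) : eval₂ φ θ f ≠ 0 := by
  intro hf
  let K := FractionRing R
  let L := FractionRing S
  have hirr : Irreducible (g.map (algebraMap R K)) := (hg.irreducible_iff_irreducible_map_fraction_map).1 hgi
  have hnd' : ¬ g.map (algebraMap R K) ∣ f.map (algebraMap R K) := by
    intro h
    exact hnd ((map_dvd_map _ (IsFractionRing.injective R K) hg).1 h)
  have hcop : IsCoprime (g.map (algebraMap R K)) (f.map (algebraMap R K)) :=
    (hirr.coprime_iff_not_dvd).2 hnd'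
  obtain ⟨a, b, hab⟩ := hcop
  have hinj : Function.Injective ((algebraMap S L).comp φ) := (IsFractionRing.injective S L).comp hφ
  let ψ : K →+* L := IsFractionRing.lift hinj
  have hcomp : ψ.comp (algebraMap R K) = (algebraMap S L).comp φ := by
    ext x; simp [ψ]
  have h1 := congrArg (eval₂ ψ (algebraMap S L θ)) hab
  rw [eval₂_add, eval₂_mul, eval₂_mul, eval₂_map, eval₂_map, hcomp, ← hom_eval₂, ← hom_eval₂, hθ, hf] at h1
  simp at h1

end PPosSec


section ThmL
open Polynomial

/-- complexification of power series -/
def cx : PowerSeries ℝ →+* PowerSeries ℂ := PowerSeries.map Complex.ofRealHom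
/-- coefficientwise conjugation -/
def cj : PowerSeries ℂ →+* PowerSeries ℂ := PowerSeries.map (starRingEnd ℂ)

lemma cx_inj : Function.Injective cx :=
  PowerSeries.map_injective _ Complex.ofRealHom.injective

lemma cj_cx (f : PowerSeries ℝ) : cj (cx f) = cx f := by
  ext n; simp [cx, cj]

lemma cj_cj (f : PowerSeries ℂ) : cj (cj f) = f := by
  ext n; simp [cj]

lemma cx_arc (σ : ℝ) (e : ℕ) (he : e ≠ 0) (f : PowerSeries ℝ) :
    cx (arcHom σ e he f) = arcHom (σ : ℂ) e he (cx f) := by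
  ext n
  simp only [cx, PowerSeries.coeff_map, coeff_arcHom]
  split_ifs <;> simp

lemma exists_real {f : PowerSeries ℂ} (h : cj f = f) : ∃ f0, cx f0 = f := by
  refine ⟨PowerSeries.mk fun n => (f.coeff n).re, ?_⟩
  ext n
  have := congrArg (PowerSeries.coeff n) h
  simp only [cj, PowerSeries.coeff_map] at this
  simp only [cx, PowerSeries.coeff_map, PowerSeries.coeff_mk]
  exact Complex.conj_eq_iff_re.1 this

lemma exists_reim (f : PowerSeries ℂ) : ∃ a b, f = cx a + PowerSeries.C Complex.I * cx b := by
  refine ⟨PowerSeries.mk fun n => (f.coeff n).re, PowerSeries.mk fun n => (f.coeff n).im, ?_⟩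
  ext n
  simp only [map_add, PowerSeries.coeff_C_mul, cx, PowerSeries.coeff_map, PowerSeries.coeff_mk]
  rw [mul_comm]
  exact (Complex.re_add_im _).symm

lemma exists_real_poly {G : (PowerSeries ℂ)[X]} (h : G.map cj = G) : ∃ G0 : (PowerSeries ℝ)[X], G0.map cx = G := by
  have : G ∈ lifts cx := by
    rw [lifts_iff_coeff_lifts]
    intro n
    have := congrArg (fun p => p.coeff n) h
    simp only [coeff_map] at this
    obtain ⟨f0, hf⟩ := exists_real this
    exact ⟨f0, hf⟩
  rw [mem_lifts] at this
  exact this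

lemma exists_reim_poly (G : (PowerSeries ℂ)[X]) : ∃ a b : (PowerSeries ℝ)[X],
    G = a.map cx + C (PowerSeries.C Complex.I) * b.map cx ∧ a.natDegree ≤ G.natDegree ∧
      b.natDegree ≤ G.natDegree := by
  choose a b hab using exists_reim
  refine ⟨∑ i ∈ Finset.range (G.natDegree + 1), C (a (G.coeff i)) * X ^ i,
    ∑ i ∈ Finset.range (G.natDegree + 1), C (b (G.coeff i)) * X ^ i, ?_, ?_, ?_⟩
  · conv_lhs => rw [G.as_sum_range_C_mul_X_pow]
    rw [Polynomial.map_sum, Polynomial.map_sum, Finset.mul_sum, ← Finset.sum_add_distrib]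
    refine Finset.sum_congr rfl fun i _ => ?_
    conv_lhs => rw [hab (G.coeff i)]
    simp only [Polynomial.map_mul, Polynomial.map_pow, map_C, map_X, C_add, C_mul]
    ring
  · refine natDegree_sum_le_of_forall_le _ _ fun i hi => ?_
    exact (natDegree_C_mul_X_pow_le _ _).trans (by simpa [Nat.lt_succ_iff] using hi)
  · refine natDegree_sum_le_of_forall_le _ _ fun i hi => ?_
    exact (natDegree_C_mul_X_pow_le _ _).trans (by simpa [Nat.lt_succ_iff] using hi)

lemma map_cj_cx (a : (PowerSeries ℝ)[X]) : (a.map cx).map cj = a.map cx := by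
  rw [map_map]; congr 1; ext1 f; exact cj_cx f

lemma norm_eq (a b : (PowerSeries ℝ)[X]) :
    (a.map cx + C (PowerSeries.C Complex.I) * b.map cx) * (a.map cx + C (PowerSeries.C Complex.I) * b.map cx).map cj
     = (a * a + b * b).map cx := by
  have h1 : (a.map cx + C (PowerSeries.C Complex.I) * b.map cx).map cj =
     a.map cx - C (PowerSeries.C Complex.I) * b.map cx := by
    rw [Polynomial.map_add, Polynomial.map_mul, map_cj_cx, map_cj_cx, map_C]
    have : cj (PowerSeries.C Complex.I) = - PowerSeries.C Complex.I := by
      rw [cj, PowerSeries.map_C, Complex.conj_I, map_neg]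
    rw [this, C_neg]; ring
  rw [h1]
  have h2 : (C (PowerSeries.C Complex.I) * C (PowerSeries.C Complex.I) : (PowerSeries ℂ)[X]) = -1 := by
    rw [← C_mul, ← map_mul, Complex.I_mul_I]; simp
  rw [Polynomial.map_add, Polynomial.map_mul, Polynomial.map_mul]
  linear_combination (- (b.map cx) * (b.map cx)) * h2

lemma rescale_eq_arc {R : Type*} [CommRing R] (c : R) (f : PowerSeries R) :
    arcHom c 1 one_ne_zero f = PowerSeries.rescale c f := by
  ext n; rw [coeff_arcHom]; simp [PowerSeries.coeff_rescale]

lemma real_arc {g : (PowerSeries ℂ)[X]} (hg : g.Monic) (hgi : Irreducible g) (hgc : g.map cj = g) :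
    ∃ (e : ℕ) (he : e ≠ 0) (σ : ℝ) (θ : PowerSeries ℝ), (σ = 1 ∨ σ = -1) ∧
      eval₂ (arcHom (σ : ℂ) e he) (cx θ) g = 0 := by
  have hdeg : g.natDegree ≠ 0 := by
    intro h
    rw [hg.natDegree_eq_zero] at h
    exact hgi.not_isUnit (h ▸ isUnit_one)
  obtain ⟨e, he, θ, hθ⟩ := puiseux g.natDegree g hg rfl hdeg
  have heC : (e : ℂ) ≠ 0 := by exact_mod_cast he
  set ζ : ℂ := Complex.exp (2 * Real.pi * Complex.I / e) with hζ
  have hprim : IsPrimitiveRoot ζ e := Complex.isPrimitiveRoot_exp e he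
  set F : ℕ → (PowerSeries ℂ)[X] := fun i => X - C (PowerSeries.rescale (ζ ^ i) θ) with hF
  set N : (PowerSeries ℂ)[X] := ∏ i ∈ Finset.range e, F i with hN
  have hNm : N.Monic := monic_prod_of_monic _ _ fun i _ => monic_X_sub_C _
  have hNinv : N.map (PowerSeries.rescale ζ) = N := by
    have h1 : ∀ i, (F i).map (PowerSeries.rescale ζ) = F (i + 1) := by
      intro i
      simp only [hF, Polynomial.map_sub, map_X, map_C]
      rw [PowerSeries.rescale_rescale, pow_succ]
    have h2 : F e = F 0 := by simp only [hF]; rw [hprim.pow_eq_one, pow_zero]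
    rw [hN, Polynomial.map_prod]
    simp only [h1]
    have h3 := Finset.prod_range_succ F e
    rw [Finset.prod_range_succ' F e, h2] at h3
    exact mul_right_cancel₀ (monic_X_sub_C _).ne_zero h3
  have hinj : Function.Injective (arcHom (1 : ℂ) e he) := by
    intro a b hab
    ext n
    have := congrArg (PowerSeries.coeff (e * n)) hab
    simpa [coeff_arcHom, Nat.mul_div_cancel_left _ (Nat.pos_of_ne_zero he)] using this
  have hlift : N ∈ lifts (arcHom (1 : ℂ) e he) := by
    rw [lifts_iff_coeff_lifts]
    intro n
    have h1 := congrArg (fun p => p.coeff n) hNinv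
    simp only [coeff_map] at h1
    refine ⟨PowerSeries.mk fun k => (N.coeff n).coeff (e * k), ?_⟩
    ext k
    rw [coeff_arcHom]
    split_ifs with h
    · obtain ⟨l, rfl⟩ := h
      rw [Nat.mul_div_cancel_left _ (Nat.pos_of_ne_zero he), one_pow, one_mul, PowerSeries.coeff_mk]
    · have h2 := congrArg (PowerSeries.coeff k) h1
      rw [PowerSeries.coeff_rescale] at h2
      by_contra h3
      have h4 : ζ ^ k = 1 := by
        have h5 : (ζ ^ k - 1) * (PowerSeries.coeff k) (N.coeff n) = 0 := by linear_combination h2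
        rcases mul_eq_zero.1 h5 with h6 | h6
        · linear_combination h6
        · exact absurd h6.symm h3
      exact h (hprim.dvd_of_pow_eq_one k h4)
  obtain ⟨N0, hN0, -, hN0m⟩ := lifts_and_natDegree_eq_and_monic hlift hNm
  have hN0θ : eval₂ (arcHom (1 : ℂ) e he) θ N0 = 0 := by
    rw [← eval_map, hN0, hN, eval_prod]
    apply Finset.prod_eq_zero (Finset.mem_range.2 (Nat.pos_of_ne_zero he))
    simp [hF]
  have hdvd : g ∣ N0 := by
    by_contra h
    exact eval_ne_of_not_dvd _ hinj hg hgi h hθ hN0θ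
  have hconj : eval₂ (arcHom (1 : ℂ) e he) (cj θ) g = 0 := by
    have h1 := congrArg cj hθ
    rw [hom_eval₂, map_zero] at h1
    have h2 : cj.comp (arcHom (1 : ℂ) e he) = (arcHom (1 : ℂ) e he).comp cj := by
      ext f n
      simp only [RingHom.comp_apply, cj, PowerSeries.coeff_map, coeff_arcHom]
      split_ifs <;> simp
    rw [h2, ← eval₂_map, hgc] at h1
    exact h1
  have hN0c : eval₂ (arcHom (1 : ℂ) e he) (cj θ) N0 = 0 := by
    obtain ⟨k, rfl⟩ := hdvd
    rw [eval₂_mul, hconj, zero_mul]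
  rw [← eval_map, hN0, hN, eval_prod, Finset.prod_eq_zero_iff] at hN0c
  obtain ⟨i, -, hi⟩ := hN0c
  have hi' : cj θ = PowerSeries.rescale (ζ ^ i) θ := by
    simp only [hF, eval_sub, eval_X, eval_C] at hi
    exact sub_eq_zero.1 hi
  set ω : ℂ := Complex.exp ((Real.pi * i / e : ℝ) * Complex.I) with hω
  have hω2 : ω * ω = ζ ^ i := by
    rw [hω, hζ, ← Complex.exp_add, ← Complex.exp_nat_mul]
    congr 1
    push_cast
    field_simp
    ring
  have hωn : (starRingEnd ℂ) ω * ω = 1 := by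
    rw [mul_comm, Complex.mul_conj, Complex.normSq_eq_norm_sq, hω, Complex.norm_exp_ofReal_mul_I]
    simp
  have hωe : ω ^ e = (((-1 : ℝ) ^ i : ℝ) : ℂ) := by
    rw [hω, ← Complex.exp_nat_mul]
    have : (e : ℂ) * (((Real.pi * i / e : ℝ) : ℂ) * Complex.I) = (i : ℂ) * (Real.pi * Complex.I) := by
      push_cast; field_simp
    rw [this, Complex.exp_nat_mul, Complex.exp_pi_mul_I]
    push_cast; rfl
  have hreal : cj (PowerSeries.rescale ω θ) = PowerSeries.rescale ω θ := by
    ext n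
    have h1 := congrArg (PowerSeries.coeff n) hi'
    simp only [cj, PowerSeries.coeff_map, PowerSeries.coeff_rescale] at h1 ⊢
    rw [map_mul, h1, map_pow, ← hω2, ← mul_assoc, ← mul_pow]
    congr 2
    rw [← mul_assoc, hωn, one_mul]
  obtain ⟨θ', hθ'⟩ := exists_real hreal
  refine ⟨e, he, (-1) ^ i, θ', neg_one_pow_eq_or ℝ i, ?_⟩
  rw [← hωe, hθ']
  have h1 := congrArg (arcHom ω 1 one_ne_zero) hθ
  rw [hom_eval₂, map_zero, rescale_eq_arc] at h1
  have h2 : (arcHom ω 1 one_ne_zero).comp (arcHom (1 : ℂ) e he) = arcHom (ω ^ e) e he := by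
    ext1 f
    rw [RingHom.comp_apply, arcHom_arcHom]
    ext n
    simp only [coeff_arcHom, mul_one, one_mul]
  rw [h2] at h1
  exact h1

lemma arcHom_inj {σ : ℂ} (hσ : σ ≠ 0) (e : ℕ) (he : e ≠ 0) : Function.Injective (arcHom σ e he) := by
  intro a b hab
  ext n
  have := congrArg (PowerSeries.coeff (e * n)) hab
  simpa [coeff_arcHom, Nat.mul_div_cancel_left _ (Nat.pos_of_ne_zero he), hσ] using this

lemma monic_factor {R : Type*} [CommRing R] [IsDomain R] [UniqueFactorizationMonoid R] {h : R[X]} (hm : h.Monic)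
    (hd : h.natDegree ≠ 0) : ∃ g : R[X], g.Monic ∧ Irreducible g ∧ g ∣ h := by
  have hu : ¬ IsUnit h := by
    intro hu
    rw [hm.isUnit_iff] at hu
    rw [hu] at hd; simp at hd
  obtain ⟨g, hg, k, hk⟩ := WfDvdMonoid.exists_irreducible_factor hu hm.ne_zero
  have h1 : g.leadingCoeff * k.leadingCoeff = 1 := by
    rw [← leadingCoeff_mul, ← hk]; exact hm
  have hunit : IsUnit (C k.leadingCoeff : R[X]) := by
    rw [isUnit_C]; exact IsUnit.of_mul_eq_one g.leadingCoeff (by rw [mul_comm]; exact h1)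
  refine ⟨C k.leadingCoeff * g, ?_, ?_, ?_⟩
  · rw [Monic, leadingCoeff_mul, leadingCoeff_C, mul_comm]; exact h1
  · exact (irreducible_isUnit_mul hunit).2 hg
  · exact (hunit.mul_left_dvd).2 ⟨k, hk⟩

lemma sos_combine {h a b : (PowerSeries ℝ)[X]} (k : (PowerSeries ℝ)[X]) {n m : ℕ} (hk : h = (a * a + b * b) * k)
    (ha : a.natDegree ≤ m) (hb : b.natDegree ≤ m) (hn : 2 * m + k.natDegree = n)
    (hs : ∃ c d : (PowerSeries ℝ)[X], k = c * c + d * d ∧ 2 * c.natDegree ≤ k.natDegree ∧ 2 * d.natDegree ≤ k.natDegree) :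
    ∃ c d : (PowerSeries ℝ)[X], h = c * c + d * d ∧ 2 * c.natDegree ≤ n ∧ 2 * d.natDegree ≤ n := by
  obtain ⟨c, d, hcd, hc, hd⟩ := hs
  refine ⟨a * c - b * d, a * d + b * c, by rw [hk, hcd]; ring, ?_, ?_⟩
  · have h1 := natDegree_sub_le (a * c) (b * d)
    have h2 := natDegree_mul_le (p := a) (q := c)
    have h3 := natDegree_mul_le (p := b) (q := d)
    rcases le_max_iff.1 h1 with h | h <;> omega
  · have h1 := natDegree_add_le (a * d) (b * c)
    have h2 := natDegree_mul_le (p := a) (q := d)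
    have h3 := natDegree_mul_le (p := b) (q := c)
    rcases le_max_iff.1 h1 with h | h <;> omega

theorem thmL : ∀ (n : ℕ) (h : (PowerSeries ℝ)[X]), h.Monic → h.natDegree = n → HL h →
    ∃ a b : (PowerSeries ℝ)[X], h = a * a + b * b ∧ 2 * a.natDegree ≤ n ∧ 2 * b.natDegree ≤ n := by
  intro n
  induction n using Nat.strong_induction_on with
  | _ n ih =>
  intro h hm hn hL
  rcases Nat.eq_zero_or_pos n with rfl | hpos
  · rw [hm.natDegree_eq_zero] at hn
    exact ⟨1, 0, by rw [hn]; ring, by simp, by simp⟩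
  have hCm : (h.map cx).Monic := hm.map _
  have hCd : (h.map cx).natDegree = n := by rw [hm.natDegree_map, hn]
  obtain ⟨g, hg, hgi, hgd⟩ := monic_factor hCm (by omega)
  have hg1 : g.natDegree ≠ 0 := by
    intro h
    rw [hg.natDegree_eq_zero] at h
    exact hgi.not_isUnit (h ▸ isUnit_one)
  have finish : ∀ (s k : (PowerSeries ℝ)[X]), h = s * k → s.Monic → ∀ (a b : (PowerSeries ℝ)[X]), s = a * a + b * b →
      a.natDegree ≤ g.natDegree → b.natDegree ≤ g.natDegree → s.natDegree = 2 * g.natDegree →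
      ∃ a b : (PowerSeries ℝ)[X], h = a * a + b * b ∧ 2 * a.natDegree ≤ n ∧ 2 * b.natDegree ≤ n := by
    intro s k hsk hs a b hab ha hb hsd
    have hk : k.Monic := hs.of_mul_monic_left (hsk ▸ hm)
    have hd : s.natDegree + k.natDegree = n := by rw [← hs.natDegree_mul hk, ← hsk, hn]
    have hkL : HL k := by
      apply HL.of_mul hs _ (hsk ▸ hL)
      intro φ θ
      rw [hab, eval₂_add, eval₂_mul, eval₂_mul]
      exact sq_add_sq_nn _ _
    exact sos_combine k (by rw [hsk, hab]) ha hb (by omega) (ih k.natDegree (by omega) k hk rfl hkL)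
  by_cases hgc : g.map cj = g
  · obtain ⟨g0, hg0⟩ := exists_real_poly hgc
    have hg0m : g0.Monic := by
      have : (g0.map cx).Monic := hg0 ▸ hg
      exact (Function.Injective.monic_map_iff cx_inj).2 this
    have hg0d : g0.natDegree = g.natDegree := by rw [← hg0, hg0m.natDegree_map]
    obtain ⟨k0, hk0⟩ : g0 ∣ h := by
      rw [← map_dvd_map cx cx_inj hg0m, hg0]; exact hgd
    by_cases hdk : g0 ∣ k0
    · obtain ⟨k1, rfl⟩ := hdk
      exact finish (g0 * g0) k1 (by rw [hk0]; ring) (hg0m.mul hg0m) g0 0 (by ring) hg0d.le (by simp)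
        (by rw [hg0m.natDegree_mul hg0m]; omega)
    · exfalso
      obtain ⟨e, he, σ, θ, hσ, hθ⟩ := real_arc hg hgi hgc
      have hσ0 : (σ : ℂ) ≠ 0 := by rcases hσ with rfl | rfl <;> norm_num
      have hcomp : cx.comp (arcHom σ e he) = (arcHom (σ : ℂ) e he).comp cx := by
        ext1 f; exact cx_arc σ e he f
      have hev : ∀ f : (PowerSeries ℝ)[X], cx (eval₂ (arcHom σ e he) θ f) = eval₂ (arcHom (σ : ℂ) e he) (cx θ) (f.map cx) := by
        intro f; rw [hom_eval₂, hcomp, eval₂_map]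
      have hne : ∀ f : (PowerSeries ℝ)[X], ¬ g0 ∣ f → eval₂ (arcHom σ e he) θ f ≠ 0 := by
        intro f hf h0
        have h1 : ¬ g ∣ f.map cx := by rw [← hg0, map_dvd_map cx cx_inj hg0m]; exact hf
        apply eval_ne_of_not_dvd _ (arcHom_inj hσ0 e he) hg hgi h1 hθ
        rw [← hev, h0, map_zero]
      have hg00 : eval₂ (arcHom σ e he) θ g0 = 0 := by
        apply cx_inj; rw [hev, hg0, hθ, map_zero]
      have hder : ¬ g0 ∣ derivative g0 := by
        intro hd
        have h0 : derivative g0 ≠ 0 := by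
          intro h0
          have h1 := congrArg (fun p => PowerSeries.constantCoeff (p.coeff (g0.natDegree - 1))) h0
          simp only [coeff_derivative, coeff_zero, map_zero, map_mul] at h1
          rw [Nat.sub_add_cancel (by omega), hg0m.coeff_natDegree, map_one, one_mul] at h1
          simp only [map_add, map_natCast, map_one] at h1
          have h2 : (0:ℝ) < ((g0.natDegree - 1 : ℕ) : ℝ) + 1 := by positivity
          exact h2.ne' h1
        have h1 := natDegree_le_of_dvd hd h0
        have h2 := natDegree_derivative_lt (p := g0) (by omega)
        omega
      refine sign_change (taylor θ (h.map (arcHom σ e he))) ?_ ?_ ?_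
      · rw [taylor_coeff_zero, eval_map, hk0, eval₂_mul, hg00, zero_mul]
      · rw [taylor_coeff_one, derivative_map, eval_map, hk0, derivative_mul, eval₂_add, eval₂_mul, eval₂_mul, hg00,
          zero_mul, add_zero]
        exact mul_ne_zero (hne _ hder) (hne _ hdk)
      · have := (hL e he σ hσ).preimage (f := fun t => t + θ) (add_left_injective θ).injOn
        refine this.subset ?_
        intro t ht
        simp only [Set.mem_preimage, Set.mem_ofPred_eq, taylor_eval, eval_map] at ht ⊢
        exact ht
  · set gb := g.map cj with hgb
    have hgbm : gb.Monic := hg.map _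
    have hgbb : gb.map cj = g := by
      rw [hgb, map_map]
      have : cj.comp cj = RingHom.id _ := by ext1 f; exact cj_cj f
      rw [this, map_id]
    have hgbd : gb ∣ h.map cx := by
      have := Polynomial.map_dvd cj hgd
      rwa [map_cj_cx] at this
    have hgbi : Irreducible gb := by
      let E : (PowerSeries ℂ)[X] ≃+* (PowerSeries ℂ)[X] := RingEquiv.ofRingHom (mapRingHom cj) (mapRingHom cj)
        (by rw [mapRingHom_comp]
            have : cj.comp cj = RingHom.id _ := by ext1 f; exact cj_cj f
            rw [this, mapRingHom_id])
        (by rw [mapRingHom_comp]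
            have : cj.comp cj = RingHom.id _ := by ext1 f; exact cj_cj f
            rw [this, mapRingHom_id])
      exact (MulEquiv.irreducible_iff E (x := g)).2 hgi
    obtain ⟨k, hk⟩ := hgd
    have hnd : ¬ gb ∣ g := by
      intro hd
      have := (hgbi.dvd_irreducible_iff_associated hgi).1 hd
      exact hgc (eq_of_monic_of_associated hgbm hg this)
    obtain ⟨k1, rfl⟩ : gb ∣ k := (hgbi.prime.dvd_or_dvd (hk ▸ hgbd)).resolve_left hnd
    obtain ⟨a, b, hab, ha, hb⟩ := exists_reim_poly g
    have hs : g * gb = (a * a + b * b).map cx := by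
      rw [hgb, ← norm_eq, ← hab]
    have hsm : (a * a + b * b).Monic := by
      have : ((a * a + b * b).map cx).Monic := hs ▸ hg.mul hgbm
      exact (Function.Injective.monic_map_iff cx_inj).2 this
    obtain ⟨k2, hk2⟩ : (a * a + b * b) ∣ h := by
      rw [← map_dvd_map cx cx_inj hsm, ← hs, hk]
      exact ⟨k1, by ring⟩
    refine finish _ k2 hk2 hsm a b rfl ha hb ?_
    rw [← hsm.natDegree_map cx, ← hs, hg.natDegree_mul hgbm, hgb, hg.natDegree_map]; ring

end ThmL


section Loc1
open Polynomial

/-- the first invariant -/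
def bu : ℝ[X][X] := C X
/-- the second invariant -/
def bv : ℝ[X][X] := X
/-- the preordering of the orbit space -/
def T0 : Subsemiring ℝ[X][X] :=
  Subsemiring.closure ({bu, 2 - bu, bv, 1 - bu + bv, bu * bu - 4 * bv} ∪ {a | ∃ b, a = b * b})

lemma T0_sq (a : ℝ[X][X]) : a * a ∈ T0 := Subsemiring.subset_closure (Or.inr ⟨a, rfl⟩)
lemma T0_u : bu ∈ T0 := Subsemiring.subset_closure (Or.inl (by simp))
lemma T0_w : 2 - bu ∈ T0 := Subsemiring.subset_closure (Or.inl (by simp))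
lemma T0_v : bv ∈ T0 := Subsemiring.subset_closure (Or.inl (by simp))
lemma T0_q : 1 - bu + bv ∈ T0 := Subsemiring.subset_closure (Or.inl (by simp))
lemma T0_D : bu * bu - 4 * bv ∈ T0 := Subsemiring.subset_closure (Or.inl (by simp))

/-- local coordinate `u` at `u0` -/
def UU (u0 : ℝ) : PowerSeries ℝ := PowerSeries.C u0 + PowerSeries.X

lemma UU_ne (u0 : ℝ) : UU u0 ≠ 0 := by
  intro h
  have := congrArg (PowerSeries.coeff 1) h
  simp [UU] at this

/-- expansion of a polynomial at `u0` -/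
def jj (u0 : ℝ) : ℝ[X] →+* PowerSeries ℝ := eval₂RingHom PowerSeries.C (UU u0)

/-- completion map -/
def io (u0 : ℝ) : ℝ[X][X] →+* (PowerSeries ℝ)[X] := mapRingHom (jj u0)

/-- `v = u^2 z` -/
def PH (u0 : ℝ) : (PowerSeries ℝ)[X] →+* (PowerSeries ℝ)[X] := compRingHom (C (UU u0 ^ 2) * X)

lemma io_u (u0 : ℝ) : io u0 bu = C (UU u0) := by simp [io, bu, jj]
lemma io_v (u0 : ℝ) : io u0 bv = X := by simp [io, bv]

lemma PH_coeff (u0 : ℝ) (g : (PowerSeries ℝ)[X]) (j : ℕ) : (PH u0 g).coeff j = UU u0 ^ (2 * j) * g.coeff j := by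
  change (g.comp _).coeff j = _
  rw [comp_C_mul_X_coeff, ← pow_mul, mul_comm]

lemma PH_C (u0 : ℝ) (c : PowerSeries ℝ) : PH u0 (C c) = C c := by
  change (C c).comp _ = _; simp
lemma PH_X (u0 : ℝ) : PH u0 X = C (UU u0 ^ 2) * X := by
  change (X : (PowerSeries ℝ)[X]).comp _ = _; simp

lemma PH_inj (u0 : ℝ) : Function.Injective (PH u0) := by
  intro a b hab
  ext1 j
  have := congrArg (fun p => p.coeff j) hab
  simp only [PH_coeff] at this
  exact mul_left_cancel₀ (pow_ne_zero _ (UU_ne u0)) this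

lemma ps_trunc (N : ℕ) (c : PowerSeries ℝ) : ∃ k, c = ((PowerSeries.trunc N c : ℝ[X]) : PowerSeries ℝ) + PowerSeries.X ^ N * k := by
  obtain ⟨k, hk⟩ : PowerSeries.X ^ N ∣ c - ((PowerSeries.trunc N c : ℝ[X]) : PowerSeries ℝ) := by
    rw [PowerSeries.X_pow_dvd_iff]
    intro m hm
    simp [PowerSeries.coeff_trunc, hm]
  exact ⟨k, by rw [← hk]; ring⟩

lemma jj_trunc (u0 : ℝ) (N : ℕ) (c : PowerSeries ℝ) : ∃ p k, c = jj u0 p + PowerSeries.X ^ N * k := by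
  obtain ⟨k, hk⟩ := ps_trunc N c
  refine ⟨(PowerSeries.trunc N c).comp (X - C u0), k, ?_⟩
  conv_lhs => rw [hk]
  congr 1
  simp only [jj, coe_eval₂RingHom, eval₂_comp]
  simp only [eval₂_sub, eval₂_X, eval₂_C, UU, add_sub_cancel_left]
  exact Polynomial.eval₂_C_X_eq_coe.symm

lemma io_trunc (u0 : ℝ) (N : ℕ) (a : (PowerSeries ℝ)[X]) : ∃ b k, a = io u0 b + C (PowerSeries.X ^ N) * k := by
  induction a using Polynomial.induction_on' with
  | add p q hp hq =>
    obtain ⟨b, k, rfl⟩ := hp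
    obtain ⟨b', k', rfl⟩ := hq
    exact ⟨b + b', k + k', by rw [map_add]; ring⟩
  | monomial n c =>
    obtain ⟨p, k, hk⟩ := jj_trunc u0 N c
    refine ⟨C p * X ^ n, C k * X ^ n, ?_⟩
    rw [← C_mul_X_pow_eq_monomial, hk]
    simp [io]; ring

/-- completed preordering -/
def TH (u0 : ℝ) : Subsemiring (PowerSeries ℝ)[X] where
  carrier := {g | ∀ N : ℕ, ∃ t ∈ T0, ∃ k, g = io u0 t + C (PowerSeries.X ^ N) * k}
  zero_mem' := fun N => ⟨0, T0.zero_mem, 0, by simp⟩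
  one_mem' := fun N => ⟨1, T0.one_mem, 0, by simp⟩
  add_mem' := by
    intro a b ha hb N
    obtain ⟨t, ht, k, rfl⟩ := ha N
    obtain ⟨t', ht', k', rfl⟩ := hb N
    exact ⟨t + t', T0.add_mem ht ht', k + k', by rw [map_add]; ring⟩
  mul_mem' := by
    intro a b ha hb N
    obtain ⟨t, ht, k, rfl⟩ := ha N
    obtain ⟨t', ht', k', rfl⟩ := hb N
    exact ⟨t * t', T0.mul_mem ht ht', io u0 t * k' + k * io u0 t' + C (PowerSeries.X ^ N) * k * k', by rw [map_mul]; ring⟩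

lemma TH_io (u0 : ℝ) {t : ℝ[X][X]} (ht : t ∈ T0) : io u0 t ∈ TH u0 := fun N => ⟨t, ht, 0, by simp⟩

lemma TH_sq (u0 : ℝ) (a : (PowerSeries ℝ)[X]) : a * a ∈ TH u0 := by
  intro N
  obtain ⟨b, k, rfl⟩ := io_trunc u0 N a
  exact ⟨b * b, T0_sq b, 2 * io u0 b * k + C (PowerSeries.X ^ N) * k * k, by rw [map_mul]; ring⟩

lemma ps_sqrt {c : PowerSeries ℝ} (hc : 0 < PowerSeries.constantCoeff c) : ∃ d, c = d * d := by
  set s := Real.sqrt (PowerSeries.constantCoeff c) with hs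
  have hs0 : 0 < s := Real.sqrt_pos.2 hc
  have hss : s * s = PowerSeries.constantCoeff c := Real.mul_self_sqrt hc.le
  obtain ⟨P, Q, hPQ, hPm, hPn, -, -⟩ := factor_lemma (K := ℝ) (taylor (PowerSeries.C s) (X ^ 2 - C c)) 1 (X + C (2 * s))
    (by simp [hs0.ne']) (by
      simp only [res, taylor_apply, Polynomial.map_comp, Polynomial.map_sub, Polynomial.map_pow, map_X, map_C,
        Polynomial.map_add, PowerSeries.constantCoeff_C, ← hss]
      simp only [sub_comp, pow_comp, X_comp, mul_comp, C_comp, C_mul]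
      ring_nf
      simp only [C_ofNat]
      try ring)
  have hP : P = X + C (P.coeff 0) := by
    rw [hPm.as_sum, hPn]; simp
  set r := PowerSeries.C s - P.coeff 0 with hr
  have h1 : eval (- P.coeff 0) (taylor (PowerSeries.C s) (X ^ 2 - C c)) = 0 := by
    rw [hPQ, eval_mul]
    have : eval (-P.coeff 0) P = 0 := by
      conv_lhs => rw [hP]
      simp
    rw [this, zero_mul]
  rw [taylor_eval] at h1
  simp only [eval_sub, eval_pow, eval_X, eval_C] at h1
  exact ⟨r, by rw [hr]; linear_combination -h1⟩

lemma TH_pos (u0 : ℝ) {c : PowerSeries ℝ} (hc : 0 < PowerSeries.constantCoeff c) : C c ∈ TH u0 := by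
  obtain ⟨d, rfl⟩ := ps_sqrt hc
  rw [C_mul]; exact TH_sq u0 _

/-- weighted membership -/
def Tm (u0 : ℝ) (m : ℕ) (h : (PowerSeries ℝ)[X]) : Prop := ∃ g ∈ TH u0, PH u0 g = C (UU u0 ^ m) * h

variable {u0 : ℝ}

lemma Tm.add {m : ℕ} {h h' : (PowerSeries ℝ)[X]} (a : Tm u0 m h) (b : Tm u0 m h') : Tm u0 m (h + h') := by
  obtain ⟨g, hg, e⟩ := a
  obtain ⟨g', hg', e'⟩ := b
  exact ⟨g + g', add_mem hg hg', by rw [map_add, e, e']; ring⟩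

lemma Tm.mul {m m' : ℕ} {h h' : (PowerSeries ℝ)[X]} (a : Tm u0 m h) (b : Tm u0 m' h') : Tm u0 (m + m') (h * h') := by
  obtain ⟨g, hg, e⟩ := a
  obtain ⟨g', hg', e'⟩ := b
  exact ⟨g * g', mul_mem hg hg', by rw [map_mul, e, e', pow_add, C_mul]; ring⟩

lemma Tm.mono {m m' : ℕ} {h : (PowerSeries ℝ)[X]} (a : Tm u0 m h) (hm : m ≤ m') : Tm u0 m' h := by
  obtain ⟨k, rfl⟩ := Nat.exists_eq_add_of_le hm
  obtain ⟨g, hg, e⟩ := a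
  refine ⟨io u0 bu ^ k * g, mul_mem (pow_mem (TH_io u0 T0_u) k) hg, ?_⟩
  rw [map_mul, map_pow, io_u, PH_C, e, pow_add, C_mul, C_pow, C_pow]; ring

lemma Tm_zero (m : ℕ) : Tm u0 m 0 := ⟨0, zero_mem _, by simp⟩

lemma Tm_sum {ι : Type*} {m : ℕ} (s : Finset ι) (f : ι → (PowerSeries ℝ)[X]) (h : ∀ i ∈ s, Tm u0 m (f i)) :
    Tm u0 m (∑ i ∈ s, f i) := by
  classical
  induction s using Finset.induction_on with
  | empty => simpa using Tm_zero m
  | insert a s ha ih =>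
    rw [Finset.sum_insert ha]
    exact (h a (by simp)).add (ih fun i hi => h i (by simp [hi]))

lemma Tm_pos {c : PowerSeries ℝ} (hc : 0 < PowerSeries.constantCoeff c) : Tm u0 0 (C c) :=
  ⟨C c, TH_pos u0 hc, by rw [PH_C]; simp⟩

lemma Tm_nn {c : ℝ} (hc : 0 ≤ c) : Tm u0 0 (C (PowerSeries.C c)) := by
  rcases hc.eq_or_lt with rfl | h
  · simpa using Tm_zero 0
  · exact Tm_pos (by simpa using h)

lemma Tm_X : Tm u0 2 X := ⟨X, by rw [← io_v u0]; exact TH_io u0 T0_v, PH_X u0⟩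

lemma Tm_up : Tm u0 2 (C (PowerSeries.C (1/4)) - X) := by
  refine ⟨C (PowerSeries.C (1/4)) * io u0 (bu * bu - 4 * bv), mul_mem (TH_pos u0 (by simp)) (TH_io u0 T0_D), ?_⟩
  rw [map_mul, PH_C, map_sub, map_mul, map_mul, io_u, io_v, map_sub, map_mul, map_mul, PH_C, PH_X, map_ofNat, map_ofNat]
  have h4 : (C (PowerSeries.C (1/4)) : (PowerSeries ℝ)[X]) * 4 = 1 := by
    have : (4 : (PowerSeries ℝ)[X]) = C (PowerSeries.C 4) := by rw [map_ofNat PowerSeries.C, C_ofNat]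
    rw [this, ← C_mul, ← map_mul]; norm_num
  rw [C_pow]
  linear_combination (-(C (UU u0)^2 * X)) * h4

/-- polynomials of small degree are in the image after multiplication -/
lemma lift_deg {k : ℕ} {a : (PowerSeries ℝ)[X]} (ha : 2 * a.natDegree ≤ k) : ∃ a', PH u0 a' = C (UU u0 ^ k) * a := by
  refine ⟨∑ i ∈ Finset.range (a.natDegree + 1), C (a.coeff i * UU u0 ^ (k - 2 * i)) * X ^ i, ?_⟩
  conv_rhs => rw [a.as_sum_range_C_mul_X_pow]
  rw [map_sum, Finset.mul_sum]
  refine Finset.sum_congr rfl fun i hi => ?_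
  have hi' : 2 * i ≤ k := by have := Finset.mem_range.1 hi; omega
  rw [map_mul, PH_C, map_pow, PH_X]
  obtain ⟨l, rfl⟩ := Nat.exists_eq_add_of_le hi'
  rw [Nat.add_sub_cancel_left]
  simp only [C_mul, C_pow]
  ring

lemma Tm_sq {k : ℕ} {a a' : (PowerSeries ℝ)[X]} (h : PH u0 a' = C (UU u0 ^ k) * a) : Tm u0 (2 * k) (a * a) :=
  ⟨a' * a', TH_sq u0 _, by rw [map_mul, h, two_mul, pow_add, C_mul]; ring⟩

lemma Tm_sq_deg {d : ℕ} {a : (PowerSeries ℝ)[X]} (ha : a.natDegree ≤ d) : Tm u0 (4 * d) (a * a) := by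
  obtain ⟨a', h⟩ := lift_deg (u0 := u0) (k := 2 * d) (a := a) (by omega)
  exact (Tm_sq h).mono (by omega)

lemma UU_inv (h0 : 0 < u0) : ∃ c, UU u0 * c = 1 ∧ 0 < PowerSeries.constantCoeff c := by
  have h1 : PowerSeries.constantCoeff (UU u0) = u0 := by simp [UU]
  refine ⟨(UU u0)⁻¹, PowerSeries.mul_inv_cancel _ (by rw [h1]; exact h0.ne'), ?_⟩
  rw [PowerSeries.constantCoeff_inv, h1]; positivity

lemma Tm_lower (h0 : 0 < u0) {m m' : ℕ} {h : (PowerSeries ℝ)[X]} (a : Tm u0 m h) : Tm u0 m' h := by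
  suffices Tm u0 0 h from this.mono (Nat.zero_le _)
  obtain ⟨g, hg, e⟩ := a
  obtain ⟨c, hc, hc0⟩ := UU_inv h0
  refine ⟨C c ^ m * g, mul_mem (pow_mem (TH_pos u0 hc0) m) hg, ?_⟩
  have : (C (UU u0) * C c : (PowerSeries ℝ)[X]) ^ m = 1 := by rw [← C_mul, hc]; simp
  rw [map_mul, e, map_pow, PH_C, C_pow]
  rw [mul_pow] at this
  simp only [pow_zero, C_1, one_mul]
  linear_combination h * this

end Loc1


section Loc2
open Polynomial

variable {u0 : ℝ}

lemma Tm_congr {m : ℕ} {h h' : (PowerSeries ℝ)[X]} (a : Tm u0 m h) (e : h' = h) : Tm u0 m h' := e ▸ a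

lemma poly_pos : ∀ (d : ℕ) (p : ℝ[X]), p.natDegree ≤ d → (∀ x : ℝ, 0 ≤ x → x ≤ 1/4 → 0 < p.eval x) →
    Tm u0 (2 * d) (p.map PowerSeries.C) := by
  intro d
  induction d using Nat.strong_induction_on with
  | _ d ih =>
  intro p hd hp
  by_cases h0 : p.natDegree = 0
  · rw [natDegree_eq_zero] at h0
    obtain ⟨c, rfl⟩ := h0
    have := hp 0 le_rfl (by norm_num)
    rw [eval_C] at this
    rw [map_C]
    exact (Tm_nn this.le).mono (by omega)
  have hp0 : p ≠ 0 := by rintro rfl; simp at h0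
  obtain ⟨z, hz⟩ := IsAlgClosed.exists_aeval_eq_zero ℂ p (by
    intro h; exact h0 (natDegree_eq_of_degree_eq_some h))
  by_cases him : z.im = 0
  · have hroot : p.IsRoot z.re := by
      have e : z = ((z.re : ℝ) : ℂ) := by apply Complex.ext <;> simp [him]
      rw [e] at hz
      have h2 : aeval ((z.re : ℝ) : ℂ) p = ((p.eval z.re : ℝ) : ℂ) := by
        have := aeval_algebraMap_apply ℂ z.re p
        simpa using this
      rw [h2] at hz
      exact_mod_cast hz
    set c := z.re
    obtain ⟨p1, hp1⟩ := dvd_iff_isRoot.2 hroot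
    have hp10 : p1 ≠ 0 := by rintro rfl; simp at hp1; exact hp0 hp1
    have hdeg : p.natDegree = 1 + p1.natDegree := by
      rw [hp1, natDegree_mul (X_sub_C_ne_zero c) hp10, natDegree_X_sub_C]
    have hev : ∀ x, p.eval x = (x - c) * p1.eval x := by intro x; rw [hp1]; simp
    rcases lt_or_ge c 0 with hc | hc
    · have h1 := ih (d - 1) (by omega) p1 (by omega) (by
        intro x hx hx'
        have := hp x hx hx'
        rw [hev] at this
        exact pos_of_mul_pos_right this (by linarith))
      have h2 : Tm u0 2 (X + C (PowerSeries.C (-c))) := Tm_X.add ((Tm_nn (by linarith)).mono (by omega))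
      refine Tm_congr ((h2.mul h1).mono (by omega)) ?_
      rw [hp1]; simp; left; ring
    · have hc4 : 1/4 < c := by
        by_contra h
        have := hp c hc (by linarith)
        rw [hroot] at this; exact lt_irrefl _ this
      have h1 := ih (d - 1) (by omega) (-p1) (by rw [natDegree_neg]; omega) (by
        intro x hx hx'
        have := hp x hx hx'
        rw [hev] at this
        rw [eval_neg]
        have h3 : 0 < (c - x) * (- p1.eval x) := by linarith
        exact pos_of_mul_pos_right h3 (by linarith))
      have h2 : Tm u0 2 ((C (PowerSeries.C (1/4)) - X) + C (PowerSeries.C (c - 1/4))) := Tm_up.add ((Tm_nn (by linarith)).mono (by omega))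
      refine Tm_congr ((h2.mul h1).mono (by omega)) ?_
      rw [hp1]
      simp only [Polynomial.map_mul, Polynomial.map_sub, map_X, map_C, Polynomial.map_neg, map_sub]
      ring
  · obtain ⟨p1, hp1⟩ := quadratic_dvd_of_aeval_eq_zero_im_ne_zero p hz him
    set c := z.re
    set s : ℝ[X] := X ^ 2 - C (2 * c) * X + C (‖z‖ ^ 2) with hs
    have hnorm : ‖z‖ ^ 2 = c * c + z.im * z.im := by
      rw [← Complex.normSq_eq_norm_sq, Complex.normSq_apply]
    have hsd : s.natDegree = 2 := by rw [hs]; compute_degree!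
    have hs0 : s ≠ 0 := by intro h; rw [h] at hsd; simp at hsd
    have hp10 : p1 ≠ 0 := by rintro rfl; simp at hp1; exact hp0 hp1
    have hdeg : p.natDegree = 2 + p1.natDegree := by
      rw [hp1, natDegree_mul hs0 hp10, hsd]
    have hev : ∀ x, p.eval x = ((x - c) * (x - c) + z.im * z.im) * p1.eval x := by
      intro x; rw [hp1, eval_mul, hs]; simp [hnorm]; left; ring
    have h1 := ih (d - 2) (by omega) p1 (by omega) (by
        intro x hx hx'
        have := hp x hx hx'
        rw [hev] at this
        have h4 := mul_self_nonneg (x - c)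
        have h5 := mul_self_nonneg z.im
        exact pos_of_mul_pos_right this (by linarith))
    have h2 : Tm u0 4 ((X - C (PowerSeries.C c)) * (X - C (PowerSeries.C c)) + C (PowerSeries.C (z.im * z.im))) :=
      (Tm_sq_deg (d := 1) (by rw [natDegree_X_sub_C])).add ((Tm_nn (mul_self_nonneg _)).mono (by omega))
    refine Tm_congr ((h2.mul h1).mono (by omega)) ?_
    rw [hp1, hs, hnorm]
    simp only [Polynomial.map_mul, Polynomial.map_sub, Polynomial.map_add, Polynomial.map_pow, map_X, map_C, map_add, map_mul]
    rw [map_ofNat PowerSeries.C, C_ofNat]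
    ring

lemma Tm_quarter (j : ℕ) : Tm u0 (2 * j) (C (PowerSeries.C ((1/4) ^ j)) - X ^ j) := by
  induction j with
  | zero => simpa using Tm_zero 0
  | succ j ih =>
    have hX : Tm u0 (2 * j) (X ^ j) := by
      clear ih
      induction j with
      | zero => simpa using Tm_nn (u0 := u0) (c := 1) (by norm_num)
      | succ j ih => rw [pow_succ]; exact ih.mul Tm_X
    have h1 : Tm u0 0 (C (PowerSeries.C (1/4))) := Tm_nn (by norm_num)
    refine Tm_congr (((h1.mul ih).mono (by omega)).add ((hX.mul Tm_up).mono (by omega))) ?_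
    rw [pow_succ (1/4 : ℝ), pow_succ X, map_mul, C_mul]
    ring

lemma Tm_X_pow (j : ℕ) : Tm u0 (2 * j) (X ^ j) := by
  induction j with
  | zero => simpa using Tm_nn (u0 := u0) (c := 1) (by norm_num)
  | succ j ih => rw [pow_succ]; exact ih.mul Tm_X

lemma base_lemma (hu0 : 0 ≤ u0) {m : ℕ} (Q : (PowerSeries ℝ)[X]) (hg : ∃ g, PH u0 g = C (UU u0 ^ m) * Q)
    (hm : 2 * (res Q).natDegree ≤ m) (hpos : ∀ x : ℝ, 0 ≤ x → x ≤ 1/4 → 0 < (res Q).eval x) : Tm u0 m Q := by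
  obtain ⟨g, hg⟩ := hg
  obtain ⟨x0, hx0, hmin⟩ := (isCompact_Icc (a := (0:ℝ)) (b := 1/4)).exists_isMinOn ⟨0, by norm_num⟩
    (res Q).continuous.continuousOn
  set δ := (res Q).eval x0 / 2 with hδ
  have hδ0 : 0 < δ := by rw [hδ]; exact half_pos (hpos x0 hx0.1 hx0.2)
  have h1 : Tm u0 m ((res Q - C δ).map PowerSeries.C) := by
    refine (poly_pos (res Q).natDegree _ ?_ ?_).mono hm
    · exact (natDegree_sub_le _ _).trans (by simp)
    · intro x hx hx'
      have := hmin (show x ∈ Set.Icc (0:ℝ) (1/4) from ⟨hx, hx'⟩)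
      simp only [Set.mem_ofPred_eq] at this
      rw [eval_sub, eval_C]; linarith
  set R := Q - (res Q).map PowerSeries.C with hR
  have hR0 : ∀ j, PowerSeries.constantCoeff (R.coeff j) = 0 := by
    intro j; simp [hR, res]
  have key : ∀ j, ∀ ε : ℝ, 0 < ε → ∃ s : PowerSeries ℝ, Tm u0 m (C s + C (R.coeff j) * X ^ j) ∧
      PowerSeries.constantCoeff s ≤ ε := by
    intro j ε hε
    by_cases hc : 2 * j ≤ m ∨ 0 < u0
    · refine ⟨PowerSeries.C (ε * (1/4) ^ j), ?_, ?_⟩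
      · have h2 : Tm u0 (2 * j) (C (PowerSeries.C (ε * (1/4) ^ j)) + C (R.coeff j) * X ^ j) := by
          have h3 : Tm u0 0 (C (PowerSeries.C ε + R.coeff j)) := Tm_pos (by rw [map_add, hR0]; simpa using hε)
          have h4 : Tm u0 0 (C (PowerSeries.C ε)) := Tm_nn hε.le
          refine Tm_congr (((h3.mul (Tm_X_pow j)).mono (by omega)).add ((h4.mul (Tm_quarter j)).mono (by omega))) ?_
          rw [map_mul, C_mul, C_add]; ring
        rcases hc with hc | hc
        · exact h2.mono hc
        · exact Tm_lower hc h2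
      · rw [PowerSeries.constantCoeff_C]
        have : ((1:ℝ)/4) ^ j ≤ 1 := pow_le_one₀ (by norm_num) (by norm_num)
        nlinarith
    · push Not at hc
      obtain ⟨hj, hu⟩ := hc
      have hu : u0 = 0 := le_antisymm hu hu0
      obtain ⟨l, hl⟩ := Nat.exists_eq_add_of_lt hj
      have hQ : R.coeff j = UU u0 ^ (l + 1) * g.coeff j := by
        have e1 := congrArg (fun p => p.coeff j) hg
        simp only [PH_coeff, coeff_C_mul] at e1
        rw [hl, show m + l + 1 = m + (l + 1) by ring, pow_add, mul_assoc] at e1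
        have e2 := mul_left_cancel₀ (pow_ne_zero _ (UU_ne u0)) e1
        rw [e2, hR, coeff_sub, coeff_map, coeff_eq_zero_of_natDegree_lt (p := res Q) (by omega)]
        simp
      set κ := |PowerSeries.constantCoeff (g.coeff j)| + 1 with hκ
      have hκ0 : 0 < κ := by positivity
      refine ⟨PowerSeries.C (κ * (1/4) ^ j) * UU u0 ^ (l + 1), ?_, ?_⟩
      · have h3 : Tm u0 0 (C (PowerSeries.C κ + g.coeff j)) := Tm_pos (by
          rw [map_add, hκ, PowerSeries.constantCoeff_C]
          have := neg_abs_le (PowerSeries.constantCoeff (g.coeff j)); linarith)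
        have h4 : Tm u0 0 (C (PowerSeries.C κ)) := Tm_nn hκ0.le
        have h5 := ((h3.mul (Tm_X_pow j)).mono (m' := 2 * j) (by omega)).add ((h4.mul (Tm_quarter j)).mono (by omega))
        obtain ⟨g', hg', e⟩ := h5
        refine ⟨g', hg', ?_⟩
        rw [e, hQ, hl, show m + l + 1 = m + (l + 1) by ring, pow_add]
        simp only [map_mul, C_add]
        ring
      · rw [map_mul, map_pow]
        simp [UU, hu]
        exact hε.le
  set n := Q.natDegree + (res Q).natDegree + 1 with hn
  choose s hs hs' using fun j => key j (δ / (2 * n)) (by rw [hn]; positivity)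
  have h6 : Tm u0 m (∑ j ∈ Finset.range n, (C (s j) + C (R.coeff j) * X ^ j)) := Tm_sum _ _ fun i _ => hs i
  have h7 : Tm u0 m (C (PowerSeries.C δ - ∑ j ∈ Finset.range n, s j)) := by
    refine (Tm_pos ?_).mono (Nat.zero_le _)
    rw [map_sub, map_sum, PowerSeries.constantCoeff_C]
    have : ∑ j ∈ Finset.range n, PowerSeries.constantCoeff (s j) ≤ ∑ j ∈ Finset.range n, δ / (2 * n) :=
      Finset.sum_le_sum fun i _ => hs' i
    have e : ∑ j ∈ Finset.range n, δ / (2 * n) = δ / 2 := by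
      rw [Finset.sum_const, Finset.card_range, nsmul_eq_mul]
      have : (n : ℝ) ≠ 0 := by rw [hn]; positivity
      field_simp
    linarith
  refine Tm_congr ((h1.add h6).add h7) ?_
  have hRs : R = ∑ j ∈ Finset.range n, C (R.coeff j) * X ^ j := by
    apply R.as_sum_range_C_mul_X_pow'
    have := natDegree_sub_le Q ((res Q).map PowerSeries.C)
    rw [← hR] at this
    have h8 := natDegree_map_le (f := (PowerSeries.C : ℝ →+* PowerSeries ℝ)) (p := res Q)
    rcases le_max_iff.1 this with h | h <;> omega
  rw [Finset.sum_add_distrib, ← hRs, hR, C_sub, map_sum, Polynomial.map_sub, map_C]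
  ring

end Loc2


section Loc3
open Polynomial

variable {u0 : ℝ}

lemma PX_one_ne : (2 : ℕ) ≠ 0 := by norm_num

/-- even-odd decomposition of a power series -/
lemma ps_even_odd (f : PowerSeries ℝ) : ∃ a b, f = arcHom 1 2 PX_one_ne a + PowerSeries.X * arcHom 1 2 PX_one_ne b := by
  refine ⟨PowerSeries.mk fun n => f.coeff (2 * n), PowerSeries.mk fun n => f.coeff (2 * n + 1), ?_⟩
  ext n
  rw [map_add, coeff_arcHom]
  rcases Nat.even_or_odd' n with ⟨k, rfl | rfl⟩
  · rw [if_pos (dvd_mul_right _ _)]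
    rcases k with _ | k
    · simp
    · rw [show 2 * (k + 1) = (2 * k + 1) + 1 by ring, PowerSeries.coeff_succ_X_mul, coeff_arcHom, if_neg (by omega)]
      rw [show (2 * k + 1 + 1) / 2 = k + 1 by omega]
      simp [mul_add]
  · rw [if_neg (by omega), PowerSeries.coeff_succ_X_mul, coeff_arcHom, if_pos (dvd_mul_right _ _)]
    simp

lemma ps_even_zero {f g : PowerSeries ℝ} (h : arcHom 1 2 PX_one_ne f = PowerSeries.X * arcHom 1 2 PX_one_ne g) : f = 0 := by
  ext n
  have := congrArg (PowerSeries.coeff (2 * n)) h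
  rw [coeff_arcHom, if_pos (dvd_mul_right _ _)] at this
  rcases n with _ | k
  · simpa using this
  · rw [show 2 * (k + 1) = (2 * k + 1) + 1 by ring, PowerSeries.coeff_succ_X_mul, coeff_arcHom, if_neg (by omega)] at this
    rw [show (2 * k + 1 + 1) / 2 = k + 1 by omega] at this
    simpa using this

lemma poly_even_odd (f : (PowerSeries ℝ)[X]) : ∃ a b : (PowerSeries ℝ)[X],
    f = a.map (arcHom 1 2 PX_one_ne) + C PowerSeries.X * b.map (arcHom 1 2 PX_one_ne) ∧
    a.natDegree ≤ f.natDegree ∧ b.natDegree ≤ f.natDegree := by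
  choose a b hab using ps_even_odd
  refine ⟨∑ i ∈ Finset.range (f.natDegree + 1), C (a (f.coeff i)) * X ^ i,
    ∑ i ∈ Finset.range (f.natDegree + 1), C (b (f.coeff i)) * X ^ i, ?_, ?_, ?_⟩
  · conv_lhs => rw [f.as_sum_range_C_mul_X_pow]
    rw [Polynomial.map_sum, Polynomial.map_sum, Finset.mul_sum, ← Finset.sum_add_distrib]
    refine Finset.sum_congr rfl fun i _ => ?_
    conv_lhs => rw [hab (f.coeff i)]
    simp only [Polynomial.map_mul, Polynomial.map_pow, map_C, map_X, C_add, C_mul]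
    ring
  · refine natDegree_sum_le_of_forall_le _ _ fun i hi => ?_
    exact (natDegree_C_mul_X_pow_le _ _).trans (by simpa [Nat.lt_succ_iff] using hi)
  · refine natDegree_sum_le_of_forall_le _ _ fun i hi => ?_
    exact (natDegree_C_mul_X_pow_le _ _).trans (by simpa [Nat.lt_succ_iff] using hi)

lemma poly_even_zero {f g : (PowerSeries ℝ)[X]}
    (h : f.map (arcHom 1 2 PX_one_ne) = C PowerSeries.X * g.map (arcHom 1 2 PX_one_ne)) : f = 0 := by
  ext1 n
  have := congrArg (fun p => p.coeff n) h
  simp only [coeff_map, coeff_C_mul] at this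
  exact ps_even_zero this

/-- finitely many exceptions on admissible arcs -/
def HLs (u0 : ℝ) (h : (PowerSeries ℝ)[X]) : Prop := ∀ (e : ℕ) (he : e ≠ 0) (σ : ℝ), (σ = 1 ∨ (σ = -1 ∧ u0 ≠ 0)) →
  {θ : PowerSeries ℝ | PPos (-(eval₂ (arcHom σ e he) θ h))}.Finite

lemma Sform {P : (PowerSeries ℝ)[X]} {n : ℕ} (hm : P.Monic) (hn : P.natDegree = n) (h : HLs u0 P) :
    ∃ s, Tm u0 0 (C s) ∧ ∃ a b c d : (PowerSeries ℝ)[X], P = a * a + b * b + C s * (c * c + d * d) ∧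
      2 * a.natDegree ≤ n ∧ 2 * b.natDegree ≤ n ∧ 2 * c.natDegree ≤ n ∧ 2 * d.natDegree ≤ n := by
  by_cases hu : u0 = 0
  · refine ⟨PowerSeries.X, ⟨C PowerSeries.X, ?_, by rw [PH_C]; simp⟩, ?_⟩
    · have : io u0 bu = C PowerSeries.X := by rw [io_u, hu]; simp [UU]
      rw [← this]; exact TH_io u0 T0_u
    have hL : HL (P.map (arcHom 1 2 PX_one_ne)) := by
      intro e he σ hσ
      have h1 := h (2 * e) (mul_ne_zero two_ne_zero he) 1 (Or.inl rfl)
      refine h1.subset ?_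
      intro θ hθ
      simp only [Set.mem_ofPred_eq, eval₂_map] at hθ ⊢
      have : (arcHom σ e he).comp (arcHom 1 2 PX_one_ne) = arcHom 1 (2 * e) (mul_ne_zero two_ne_zero he) := by
        ext1 f
        rw [RingHom.comp_apply, arcHom_arcHom]
        have : (1 : ℝ) * σ ^ 2 = 1 := by rcases hσ with rfl | rfl <;> norm_num
        simp only [this]
      rwa [this] at hθ
    obtain ⟨a, b, hab, ha, hb⟩ := thmL n _ (hm.map _) (by rw [hm.natDegree_map, hn]) hL
    obtain ⟨a0, a1, ha', ha0, ha1⟩ := poly_even_odd a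
    obtain ⟨b0, b1, hb', hb0, hb1⟩ := poly_even_odd b
    refine ⟨a0, b0, a1, b1, ?_, by omega, by omega, by omega, by omega⟩
    rw [← sub_eq_zero]
    apply poly_even_zero (g := 2 * (a0 * a1 + b0 * b1))
    have hX : (arcHom 1 2 PX_one_ne) (PowerSeries.X : PowerSeries ℝ) = PowerSeries.X ^ 2 := by rw [arcHom_X]; simp
    simp only [Polynomial.map_sub, Polynomial.map_add, Polynomial.map_mul, map_C, hX, hab, C_pow, Polynomial.map_ofNat]
    rw [ha', hb']
    ring
  · refine ⟨0, by simpa using Tm_zero 0, ?_⟩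
    obtain ⟨a, b, hab, ha, hb⟩ := thmL n P hm hn (fun e he σ hσ => h e he σ (by tauto))
    exact ⟨a, b, 0, 0, by rw [hab]; simp, ha, hb, by simp, by simp⟩

lemma Tm_comp_sq {l a : (PowerSeries ℝ)[X]} (hl : l.natDegree ≤ 1) {d : ℕ} (ha : a.natDegree ≤ d) :
    Tm u0 (4 * d) (a.comp l * a.comp l) := by
  apply Tm_sq_deg
  have := natDegree_comp_le (p := a) (q := l)
  nlinarith

lemma P_int {l P : (PowerSeries ℝ)[X]} (hl : l.natDegree ≤ 1) {d : ℕ} (hm : P.Monic) (hn : P.natDegree = 2 * d)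
    (h : HLs u0 P) : Tm u0 (4 * d) (P.comp l) := by
  obtain ⟨s, hs, a, b, c, e, hP, ha, hb, hc, he⟩ := Sform hm hn h
  have := ((Tm_comp_sq (u0 := u0) hl (show a.natDegree ≤ d by omega)).add (Tm_comp_sq hl (show b.natDegree ≤ d by omega))).add
    ((hs.mul ((Tm_comp_sq hl (show c.natDegree ≤ d by omega)).add (Tm_comp_sq hl (show e.natDegree ≤ d by omega)))).mono (by omega))
  refine Tm_congr this ?_
  rw [hP]; simp

lemma Y_even_odd (f : (PowerSeries ℝ)[X]) : ∃ a b : (PowerSeries ℝ)[X],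
    f = expand _ 2 a + X * expand _ 2 b ∧ 2 * a.natDegree ≤ f.natDegree ∧ (1 ≤ f.natDegree → 2 * b.natDegree + 1 ≤ f.natDegree)
     ∧ (f.natDegree = 0 → b = 0) := by
  refine ⟨∑ i ∈ Finset.range (f.natDegree / 2 + 1), C (f.coeff (2 * i)) * X ^ i,
    ∑ i ∈ Finset.range ((f.natDegree + 1) / 2), C (f.coeff (2 * i + 1)) * X ^ i, ?_, ?_, ?_, ?_⟩
  · ext1 n
    simp only [map_sum, map_mul, expand_C, map_pow, expand_X, coeff_add, finsetSum_coeff, Finset.mul_sum]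
    simp only [← pow_mul, coeff_C_mul, coeff_X_pow, mul_left_comm X, ← pow_succ']
    rcases Nat.even_or_odd' n with ⟨k, rfl | rfl⟩
    · rw [Finset.sum_eq_zero (s := Finset.range ((f.natDegree + 1) / 2))]
      · by_cases hk : k ∈ Finset.range (f.natDegree / 2 + 1)
        · rw [Finset.sum_eq_single_of_mem k hk]
          · simp
          · intro b _ hb; rw [if_neg (by omega), mul_zero]
        · rw [Finset.sum_eq_zero, coeff_eq_zero_of_natDegree_lt]
          · simp
          · simp at hk; omega
          · intro b hb; rw [if_neg, mul_zero]
            rintro h; apply hk; have : k = b := by omega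
            rwa [this]
      · intro b _; rw [if_neg (by omega), mul_zero]
    · rw [Finset.sum_eq_zero (s := Finset.range (f.natDegree / 2 + 1))]
      · by_cases hk : k ∈ Finset.range ((f.natDegree + 1) / 2)
        · rw [Finset.sum_eq_single_of_mem k hk]
          · simp
          · intro b _ hb; rw [if_neg (by omega), mul_zero]
        · rw [Finset.sum_eq_zero, coeff_eq_zero_of_natDegree_lt]
          · simp
          · simp at hk; omega
          · intro b hb; rw [if_neg, mul_zero]
            rintro h; apply hk; have : k = b := by omega
            rwa [this]
      · intro b _; rw [if_neg (by omega), mul_zero]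
  · have : (∑ i ∈ Finset.range (f.natDegree / 2 + 1), C (f.coeff (2 * i)) * X ^ i).natDegree ≤ f.natDegree / 2 := by
      refine natDegree_sum_le_of_forall_le _ _ fun i hi => ?_
      exact (natDegree_C_mul_X_pow_le _ _).trans (by simpa [Nat.lt_succ_iff] using hi)
    omega
  · intro h1
    have : (∑ i ∈ Finset.range ((f.natDegree + 1) / 2), C (f.coeff (2 * i + 1)) * X ^ i).natDegree ≤ (f.natDegree - 1) / 2 := by
      refine natDegree_sum_le_of_forall_le _ _ fun i hi => ?_
      refine (natDegree_C_mul_X_pow_le _ _).trans ?_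
      simp at hi; omega
    omega
  · intro h1; rw [h1]; simp

lemma expand_even_zero {f g : (PowerSeries ℝ)[X]} (h : expand _ 2 f = X * expand _ 2 g) : f = 0 := by
  ext1 n
  have := congrArg (fun p => p.coeff (n * 2)) h
  simp only [coeff_expand_mul (show 0 < 2 by norm_num)] at this
  rw [this, coeff_zero]
  rcases n with _ | k
  · simp
  · rw [show (k + 1) * 2 = (2 * k + 1) + 1 by ring, coeff_X_mul, coeff_expand (by norm_num), if_neg (by omega)]

lemma P_end {l P : (PowerSeries ℝ)[X]} (hl : l.natDegree ≤ 1) (hl2 : Tm u0 2 l) {n : ℕ} (hm : P.Monic)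
    (hn : P.natDegree = n) (h1 : 1 ≤ n) (h : HLs u0 (expand _ 2 P)) : Tm u0 (2 * n) (P.comp l) := by
  obtain ⟨s, hs, a, b, c, e, hP, ha, hb, hc, he⟩ := Sform (n := n * 2) (hm.expand (by norm_num)) (by rw [natDegree_expand, hn]) h
  obtain ⟨a0, a1, ha', ha0, ha1, ha2⟩ := Y_even_odd a
  obtain ⟨b0, b1, hb', hb0, hb1, hb2⟩ := Y_even_odd b
  obtain ⟨c0, c1, hc', hc0, hc1, hc2⟩ := Y_even_odd c
  obtain ⟨e0, e1, he', he0, he1, he2⟩ := Y_even_odd e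
  have key : P = (a0 * a0 + b0 * b0 + C s * (c0 * c0 + e0 * e0)) + X * (a1 * a1 + b1 * b1 + C s * (c1 * c1 + e1 * e1)) := by
    rw [← sub_eq_zero]
    apply expand_even_zero (g := 2 * (a0 * a1 + b0 * b1 + C s * (c0 * c1 + e0 * e1)))
    simp only [map_sub, map_add, map_mul, expand_C, expand_X, hP, map_ofNat]
    rw [ha', hb', hc', he']
    ring
  have A0 : ∀ a a0 : (PowerSeries ℝ)[X], 2 * a.natDegree ≤ n * 2 → 2 * a0.natDegree ≤ a.natDegree → Tm u0 (2 * n) (a0.comp l * a0.comp l) := by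
    intro a a0 h1 h2
    exact (Tm_comp_sq hl (le_refl a0.natDegree)).mono (by omega)
  have A1 : ∀ a a1 : (PowerSeries ℝ)[X], 2 * a.natDegree ≤ n * 2 → (1 ≤ a.natDegree → 2 * a1.natDegree + 1 ≤ a.natDegree) →
      (a.natDegree = 0 → a1 = 0) → Tm u0 (2 * n - 2) (a1.comp l * a1.comp l) := by
    intro a a1 h1 h2 h3
    by_cases h0 : a.natDegree = 0
    · rw [h3 h0]; simpa using Tm_zero _
    · have := h2 (by omega)
      exact (Tm_comp_sq hl (le_refl a1.natDegree)).mono (by omega)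
  have B0 := ((A0 a a0 ha ha0).add (A0 b b0 hb hb0)).add (((hs.mul ((A0 c c0 hc hc0).add (A0 e e0 he he0)))).mono (m' := 2 * n) (by omega))
  have B1 := ((A1 a a1 ha ha1 ha2).add (A1 b b1 hb hb1 hb2)).add (((hs.mul ((A1 c c1 hc hc1 hc2).add (A1 e e1 he he1 he2)))).mono (m' := 2 * n - 2) (by omega))
  refine Tm_congr (B0.add ((hl2.mul B1).mono (by omega))) ?_
  conv_lhs => rw [key]
  simp

end Loc3


section Loc4
open Polynomial

lemma cc_eval (σ : ℝ) (e : ℕ) (he : e ≠ 0) (θ : PowerSeries ℝ) (h : (PowerSeries ℝ)[X]) :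
    PowerSeries.constantCoeff (eval₂ (arcHom σ e he) θ h) = (res h).eval (PowerSeries.constantCoeff θ) := by
  rw [hom_eval₂, res, eval_map]
  congr 1
  ext1 f
  rw [RingHom.comp_apply, constantCoeff_arcHom]

/-- homogenization -/
def hz {R S : Type*} [CommRing R] [CommRing S] (φ : R →+* S) (P : R[X]) (n : ℕ) (a b : S) : S :=
  ∑ j ∈ Finset.range (n + 1), φ (P.coeff j) * a ^ j * b ^ (n - j)

lemma hz_eq {R S : Type*} [CommRing R] [CommRing S] (φ : R →+* S) (P : R[X]) (n : ℕ) (hn : P.natDegree = n)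
    (y b : S) : hz φ P n (b * y) b = b ^ n * eval₂ φ y P := by
  rw [eval₂_eq_sum_range, hn, hz, Finset.mul_sum]
  refine Finset.sum_congr rfl fun j hj => ?_
  have : j ≤ n := by simpa [Nat.lt_succ_iff] using hj
  calc _ = (b ^ j * b ^ (n - j)) * (φ (P.coeff j) * y ^ j) := by rw [mul_pow]; ring
    _ = _ := by rw [← pow_add, Nat.add_sub_cancel' this]

lemma hz_map {R S S' : Type*} [CommRing R] [CommRing S] [CommRing S'] (φ : R →+* S) (ψ : S →+* S') (P : R[X]) (n : ℕ)
    (a b : S) : ψ (hz φ P n a b) = hz (ψ.comp φ) P n (ψ a) (ψ b) := by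
  simp [hz, map_sum]

/-- the curve `q = 0` -/
def rho : PowerSeries ℝ := PowerSeries.X * (UU 1)⁻¹ ^ 2

lemma U1_inv : UU 1 * (UU 1)⁻¹ = 1 := PowerSeries.mul_inv_cancel _ (by simp [UU])

lemma rho_ne : rho ≠ 0 := by
  unfold rho
  refine mul_ne_zero PowerSeries.X_ne_zero (pow_ne_zero _ ?_)
  intro h; have := U1_inv; rw [h, mul_zero] at this; exact zero_ne_one this

lemma Tm_q : Tm 1 2 (X - C rho) := by
  refine ⟨X - C PowerSeries.X, ?_, ?_⟩
  · have : io 1 (1 - bu + bv) = X - C PowerSeries.X := by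
      rw [map_add, map_sub, io_u, io_v, map_one, UU]; simp; ring
    rw [← this]; exact TH_io 1 T0_q
  · rw [map_sub, PH_X, PH_C, mul_sub, ← C_mul, rho]
    congr 2
    linear_combination (-PowerSeries.X * ((UU 1) * (UU 1)⁻¹ + 1)) * U1_inv

/-- twisted square form -/
def qf (a b c d : (PowerSeries ℝ)[X]) : (PowerSeries ℝ)[X] :=
  a * a + X * (b * b) + (X - C rho) * (c * c) + X * (X - C rho) * (d * d)

lemma Tm_qf (m : ℕ) (a b c d : (PowerSeries ℝ)[X]) : Tm 1 m (qf a b c d) := by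
  have h : ∀ a, Tm 1 0 (a * a) := fun a => Tm_lower one_pos (Tm_sq_deg (le_refl (natDegree a)))
  have h1 := (((Tm_lower (m' := 4) one_pos (h a)).add (Tm_lower one_pos (Tm_X.mul (h b)))).add (Tm_lower one_pos (Tm_q.mul (h c)))).add
    (Tm_lower one_pos ((Tm_X.mul Tm_q).mul (h d)))
  exact Tm_lower one_pos h1

lemma dvd_of_res {a : (PowerSeries ℝ)[X]} (h : res a = 0) : ∃ a', a = C PowerSeries.X * a' := by
  have : C PowerSeries.X ∣ a := by
    rw [C_dvd_iff_dvd_coeff]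
    intro i
    rw [PowerSeries.X_dvd_iff]
    have := congrArg (fun p => p.coeff i) h
    simpa [res] using this
  exact this

lemma form_zero {a b c d a' b' c' d' : ℝ[X]} (h : a * a + X * (b * b) + X * (c * c) + X * X * (d * d)
   + (a' * a' + X * (b' * b') + X * (c' * c') + X * X * (d' * d')) = 0) :
    (a = 0 ∧ b = 0 ∧ c = 0 ∧ d = 0) ∧ (a' = 0 ∧ b' = 0 ∧ c' = 0 ∧ d' = 0) := by
  have key : ∀ x : ℝ, 0 < x → (eval x a = 0 ∧ eval x b = 0 ∧ eval x c = 0 ∧ eval x d = 0) ∧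
     (eval x a' = 0 ∧ eval x b' = 0 ∧ eval x c' = 0 ∧ eval x d' = 0) := by
    intro x hx
    have := congrArg (eval x) h
    simp only [eval_add, eval_mul, eval_X, eval_zero] at this
    have hp : ∀ r y : ℝ, 0 < y → 0 ≤ y * (r * r) := fun r y hy => mul_nonneg hy.le (mul_self_nonneg r)
    have hq : ∀ r y : ℝ, 0 < y → y * (r * r) ≤ 0 → r = 0 := by
      intro r y hy hr
      have : y * (r * r) = 0 := le_antisymm hr (hp r y hy)
      simpa [hy.ne'] using this
    have hxx : 0 < x * x := by positivity
    have a1 := mul_self_nonneg (eval x a)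
    have a2 := hp (eval x b) x hx
    have a3 := hp (eval x c) x hx
    have a4 := hp (eval x d) _ hxx
    have b1 := mul_self_nonneg (eval x a')
    have b2 := hp (eval x b') x hx
    have b3 := hp (eval x c') x hx
    have b4 := hp (eval x d') _ hxx
    refine ⟨⟨hq _ 1 one_pos ?_, hq _ x hx ?_, hq _ x hx ?_, hq _ _ hxx ?_⟩, hq _ 1 one_pos ?_, hq _ x hx ?_, hq _ x hx ?_, hq _ _ hxx ?_⟩ <;> linarith
  have inf : (Set.Ioi (0:ℝ)).Infinite := Set.Ioi_infinite 0
  have z : ∀ p : ℝ[X], (∀ x : ℝ, 0 < x → eval x p = 0) → p = 0 := fun p hp =>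
    Polynomial.eq_zero_of_infinite_isRoot p (inf.mono fun x hx => hp x hx)
  refine ⟨⟨?_, ?_, ?_, ?_⟩, ?_, ?_, ?_, ?_⟩ <;> refine z _ fun x hx => ?_
  · exact (key x hx).1.1
  · exact (key x hx).1.2.1
  · exact (key x hx).1.2.2.1
  · exact (key x hx).1.2.2.2
  · exact (key x hx).2.1
  · exact (key x hx).2.2.1
  · exact (key x hx).2.2.2.1
  · exact (key x hx).2.2.2.2

lemma res_rho : PowerSeries.constantCoeff rho = 0 := by simp [rho]

lemma form_div (k : ℕ) : ∀ (P a b c d a' b' c' d' : (PowerSeries ℝ)[X]),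
    C (PowerSeries.X ^ (2 * k)) * P = qf a b c d + qf a' b' c' d' →
    ∃ a b c d a' b' c' d', P = qf a b c d + qf a' b' c' d' := by
  induction k with
  | zero => intro P a b c d a' b' c' d' h; exact ⟨a, b, c, d, a', b', c', d', by simpa using h⟩
  | succ k ih =>
    intro P a b c d a' b' c' d' h
    have h1 := congrArg res h
    have : res (C (PowerSeries.X ^ (2 * (k+1))) * P) = 0 := by
      simp [res, mul_add]
    rw [this] at h1
    simp only [res, qf, Polynomial.map_add, Polynomial.map_mul, Polynomial.map_sub, map_X, map_C, res_rho, C_0, sub_zero] at h1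
    obtain ⟨⟨ha, hb, hc, hd⟩, ha', hb', hc', hd'⟩ := form_zero h1.symm
    obtain ⟨a, rfl⟩ := dvd_of_res ha
    obtain ⟨b, rfl⟩ := dvd_of_res hb
    obtain ⟨c, rfl⟩ := dvd_of_res hc
    obtain ⟨d, rfl⟩ := dvd_of_res hd
    obtain ⟨a', rfl⟩ := dvd_of_res ha'
    obtain ⟨b', rfl⟩ := dvd_of_res hb'
    obtain ⟨c', rfl⟩ := dvd_of_res hc'
    obtain ⟨d', rfl⟩ := dvd_of_res hd'
    refine ih P a b c d a' b' c' d' ?_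
    have h0 : (C PowerSeries.X : (PowerSeries ℝ)[X]) ^ 2 ≠ 0 := pow_ne_zero _ (C_ne_zero.2 PowerSeries.X_ne_zero)
    apply mul_left_cancel₀ h0
    rw [show 2 * (k + 1) = 2 + 2 * k by ring, pow_add, C_mul, C_pow, mul_assoc] at h
    rw [h]
    simp only [qf]; ring

/-- adjoining square roots of `y` and `y - rho` -/
abbrev QE1 := QuadraticAlgebra (PowerSeries ℝ)[X] X 0
abbrev QE := QuadraticAlgebra QE1 (algebraMap _ QE1 (X - C rho)) 0

/-- embedding -/
def qe : (PowerSeries ℝ)[X] →+* QE := (algebraMap QE1 QE).comp (algebraMap _ QE1)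

lemma qe_re (p : (PowerSeries ℝ)[X]) : (qe p).re.re = p := by
  simp [qe, QuadraticAlgebra.algebraMap_eq]

lemma sq_re (z : QE) : (z * z).re.re = qf z.re.re z.re.im z.im.re z.im.im := by
  simp [qf, QuadraticAlgebra.algebraMap_eq]; ring

/-- roots -/
def qal : QE := ⟨⟨0, 1⟩, 0⟩
def qbe : QE := ⟨0, 1⟩

lemma qal_re : qal.re = ⟨0, 1⟩ := rfl
lemma qal_im : qal.im = 0 := rfl
lemma qbe_re : qbe.re = 0 := rfl
lemma qbe_im : qbe.im = 1 := rfl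

lemma qal_sq : qal * qal = qe X := by
  refine QuadraticAlgebra.ext (QuadraticAlgebra.ext ?_ ?_) (QuadraticAlgebra.ext ?_ ?_) <;>
  simp [qal_re, qal_im, qe, QuadraticAlgebra.algebraMap_eq]
lemma qbe_sq : qbe * qbe = qe (X - C rho) := by
  refine QuadraticAlgebra.ext (QuadraticAlgebra.ext ?_ ?_) (QuadraticAlgebra.ext ?_ ?_) <;>
  simp [qbe_re, qbe_im, qe, QuadraticAlgebra.algebraMap_eq]

/-- auxiliary polynomial -/
def HH (P : (PowerSeries ℝ)[X]) (n : ℕ) : (PowerSeries ℝ)[X] := hz C P n ((X ^ 2 + C rho) ^ 2) (4 * X ^ 2)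

lemma HH_monic {P : (PowerSeries ℝ)[X]} {n : ℕ} (hm : P.Monic) (hn : P.natDegree = n) (h1 : 1 ≤ n) :
    (HH P n).Monic ∧ (HH P n).natDegree = 4 * n := by
  have hd : ((X ^ 2 + C rho) ^ 2 : (PowerSeries ℝ)[X]).Monic := (monic_X_pow_add_C rho two_ne_zero).pow 2
  have hdn : ((X ^ 2 + C rho) ^ 2 : (PowerSeries ℝ)[X]).natDegree = 4 := by
    rw [(monic_X_pow_add_C rho two_ne_zero).natDegree_pow, natDegree_X_pow_add_C]
  have h0 : HH P n = ∑ j ∈ Finset.range n, C (P.coeff j) * ((X ^ 2 + C rho) ^ 2) ^ j * (4 * X ^ 2) ^ (n - j)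
     + ((X ^ 2 + C rho) ^ 2) ^ n := by
    have : P.coeff n = 1 := by rw [← hn]; exact hm
    rw [HH, hz, Finset.sum_range_succ, this]; simp
  have hlow : (∑ j ∈ Finset.range n, C (P.coeff j) * ((X ^ 2 + C rho) ^ 2) ^ j * (4 * X ^ 2) ^ (n - j)).natDegree ≤ 4 * n - 1 := by
    refine natDegree_sum_le_of_forall_le _ _ fun j hj => ?_
    have hj' : j < n := by simpa using hj
    have a1 : (C (P.coeff j) * ((X ^ 2 + C rho) ^ 2) ^ j : (PowerSeries ℝ)[X]).natDegree ≤ 4 * j := by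
      refine (natDegree_C_mul_le _ _).trans ?_
      rw [hd.natDegree_pow, hdn, mul_comm]
    have a2 : ((4 * X ^ 2) ^ (n - j) : (PowerSeries ℝ)[X]).natDegree ≤ (n - j) * 2 := by
      refine natDegree_pow_le.trans (Nat.mul_le_mul le_rfl ?_)
      rw [← C_ofNat]
      exact natDegree_C_mul_X_pow_le _ _
    refine natDegree_mul_le.trans ((add_le_add a1 a2).trans ?_)
    omega
  have hmn : (((X ^ 2 + C rho) ^ 2) ^ n : (PowerSeries ℝ)[X]).natDegree = 4 * n := by rw [hd.natDegree_pow, hdn, mul_comm]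
  have hlt : (∑ j ∈ Finset.range n, C (P.coeff j) * ((X ^ 2 + C rho) ^ 2) ^ j * (4 * X ^ 2) ^ (n - j)).natDegree <
    (((X ^ 2 + C rho) ^ 2) ^ n : (PowerSeries ℝ)[X]).natDegree := by omega
  rw [h0]
  refine ⟨(hd.pow n).add_of_right (degree_lt_degree hlt), ?_⟩
  rw [natDegree_add_eq_right_of_natDegree_lt hlt, hmn]

lemma HH_eval {S : Type*} [CommRing S] (φ : PowerSeries ℝ →+* S) (θ : S) (P : (PowerSeries ℝ)[X]) (n : ℕ) :
    eval₂ φ θ (HH P n) = hz φ P n ((θ ^ 2 + φ rho) ^ 2) (4 * θ ^ 2) := by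
  have := hz_map C (eval₂RingHom φ θ) P n ((X ^ 2 + C rho) ^ 2) (4 * X ^ 2)
  rw [coe_eval₂RingHom] at this
  rw [HH, this]
  have e1 : (eval₂RingHom φ θ).comp C = φ := by ext1 x; simp
  have e2 : eval₂ φ θ ((X ^ 2 + C rho) ^ 2) = (θ ^ 2 + φ rho) ^ 2 := by
    rw [eval₂_pow, eval₂_add, eval₂_pow, eval₂_X, eval₂_C]
  have e3 : eval₂ φ θ (4 * X ^ 2) = 4 * θ ^ 2 := by
    rw [eval₂_mul, eval₂_pow, eval₂_X, eval₂_ofNat]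
  rw [e1, e2, e3]

lemma HH_qe' {S : Type*} [CommRing S] (q : (PowerSeries ℝ)[X] →+* S) (al be : S) (hal : al * al = q X)
    (hbe : be * be = q (X - C rho)) {P : (PowerSeries ℝ)[X]} {n : ℕ} (hn : P.natDegree = n) :
    eval₂ (q.comp C) (al + be) (HH P n) * ((al - be) ^ n * (al - be) ^ n) = q (C (4 ^ n * rho ^ (2 * n)) * P) := by
  have hab : al * al - be * be = q (C rho) := by rw [hal, hbe, map_sub]; ring
  have h2 : ((al + be) ^ 2 + q (C rho)) ^ 2 = (4 * (al + be) ^ 2) * q X := by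
    rw [← hab, ← hal]; ring
  have h3 : eval₂ (q.comp C) (q X) P = q P := by
    rw [← hom_eval₂, eval₂_C_X]
  rw [HH_eval, RingHom.comp_apply, h2, hz_eq _ _ _ hn, h3, map_mul]
  have : q (C (4 ^ n * rho ^ (2 * n))) = (4 * q (C rho) ^ 2) ^ n := by
    rw [C_mul, map_mul, C_pow, C_pow, map_pow, map_pow]
    rw [mul_pow, ← pow_mul, C_ofNat, map_ofNat]
  rw [this, ← hab]
  rw [show (4 * (al * al - be * be) ^ 2) = (4 * (al + be) ^ 2) * ((al - be) * (al - be)) by ring, mul_pow _ ((al - be) * (al - be)), mul_pow (al - be)]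
  ring

lemma HH_qe {P : (PowerSeries ℝ)[X]} {n : ℕ} (hn : P.natDegree = n) :
    eval₂ (qe.comp C) (qal + qbe) (HH P n) * ((qal - qbe) ^ n * (qal - qbe) ^ n) = qe (C (4 ^ n * rho ^ (2 * n)) * P) :=
  HH_qe' qe qal qbe qal_sq qbe_sq hn

lemma HH_HL {P : (PowerSeries ℝ)[X]} {n : ℕ} (hm : P.Monic) (hn : P.natDegree = n) (hres : res P = X ^ n)
    (h : ∀ (e : ℕ) (he : e ≠ 0) (σ : ℝ), (σ = 1 ∨ σ = -1) → ∀ θ : PowerSeries ℝ, PowerSeries.constantCoeff θ = 0 → PPos θ →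
      PPos (θ - arcHom σ e he rho) → ¬ PPos (-(eval₂ (arcHom σ e he) θ P))) : HL (HH P n) := by
  intro e he σ hσ
  set φ := arcHom σ e he with hφ
  set r := φ rho with hr
  have hσ0 : σ ≠ 0 := by rcases hσ with rfl | rfl <;> norm_num
  have hr0 : r ≠ 0 := by
    intro h0
    apply rho_ne
    ext k
    have := congrArg (PowerSeries.coeff (e * k)) h0
    rw [hr, hφ, coeff_arcHom, if_pos (dvd_mul_right _ _), Nat.mul_div_cancel_left _ (Nat.pos_of_ne_zero he)] at this
    simpa [hσ0] using this
  have hev : ∀ θ, eval₂ φ θ (HH P n) = hz φ P n ((θ ^ 2 + r) ^ 2) (4 * θ ^ 2) := fun θ => HH_eval φ θ P n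
  refine ((finite_roots (RingHom.id _) (monic_X_pow_add_C r two_ne_zero)).union
    (finite_roots (RingHom.id _) (monic_X_pow_sub_C r two_ne_zero))).subset ?_
  intro θ hθ
  by_contra hnot
  simp only [Set.mem_union, Set.mem_ofPred_eq, not_or, eval₂_add, eval₂_sub, eval₂_pow, eval₂_X, eval₂_C, RingHom.id_apply] at hnot hθ
  rw [hev] at hθ
  revert hθ
  have caseA : ∀ k, r = θ * k → ¬ PPos (-(hz φ P n ((θ ^ 2 + r) ^ 2) (4 * θ ^ 2))) := by
    intro k hk
    have hθ0 : θ ≠ 0 := by rintro rfl; simp at hk; exact hr0 hk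
    set t : PowerSeries ℝ := PowerSeries.C (1/2) with ht
    have ht2 : 2 * t = 1 := by
      rw [ht, ← map_ofNat PowerSeries.C 2, ← map_mul]; norm_num
    have e1 : (θ ^ 2 + r) ^ 2 = (4 * θ ^ 2) * ((t * (θ + k)) * (t * (θ + k))) := by
      rw [hk]; linear_combination (-(θ*(θ+k))^2*(2*t+1)) * ht2
    rw [e1, hz_eq _ _ _ hn]
    have hα : t * (θ + k) ≠ 0 := by
      intro h0; apply hnot.1
      rw [hk]; linear_combination (2*θ)*h0 - θ*(θ+k)*ht2
    have hβ : t * (θ - k) ≠ 0 := by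
      intro h0; apply hnot.2
      rw [hk]; linear_combination (2*θ)*h0 - θ*(θ-k)*ht2
    have hs : PPos ((4 * θ ^ 2) ^ n) := by
      have : 4 * θ ^ 2 = (2 * θ) * (2 * θ) := by ring
      rw [this, mul_pow]
      apply PPos_sq
      apply pow_ne_zero
      intro h0
      apply hθ0
      linear_combination t * h0 - θ * ht2
    have hp : ¬ PPos (-(eval₂ φ (t * (θ + k) * (t * (θ + k))) P)) := by
      by_cases h0 : PowerSeries.constantCoeff (t * (θ + k)) = 0
      · refine h e he σ hσ _ (by rw [map_mul, h0, mul_zero]) (PPos_sq hα) ?_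
        have : t * (θ + k) * (t * (θ + k)) - r = t * (θ - k) * (t * (θ - k)) := by
          rw [hk]; linear_combination (θ * k * (2*t+1)) * ht2
        rw [← hφ, ← hr, this]
        exact PPos_sq hβ
      · apply PPos.not_neg
        apply PPos_const
        rw [hφ, cc_eval, hres, eval_pow, eval_X, map_mul]
        exact pow_pos (mul_self_pos.2 h0) n
    intro hc
    rcases eq_or_ne (eval₂ φ (t * (θ + k) * (t * (θ + k))) P) 0 with h0 | h0
    · rw [h0, mul_zero, neg_zero] at hc; exact not_PPos_zero hc
    · rcases PPos_or h0 with h1 | h1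
      · exact (hs.mul h1).not_neg hc
      · exact hp h1
  rcases ValuationRing.dvd_total θ r with ⟨k, hk⟩ | ⟨k, hk⟩
  · exact caseA k hk
  · by_cases hk0 : PowerSeries.constantCoeff k = 0
    · have e1 : hz φ P n ((θ ^ 2 + r) ^ 2) (4 * θ ^ 2) = (r ^ n * r ^ n) * hz φ P n ((1 + r * k ^ 2) ^ 2) (4 * k ^ 2) := by
        rw [hz, hz, Finset.mul_sum]
        refine Finset.sum_congr rfl fun j hj => ?_
        have : j ≤ n := by simpa [Nat.lt_succ_iff] using hj
        have : r ^ n * r ^ n = (r ^ 2) ^ j * (r ^ 2) ^ (n - j) := by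
          rw [← pow_add (r ^ 2), Nat.add_sub_cancel' this]; ring
        rw [this, hk, show ((r * k) ^ 2 + r) ^ 2 = r ^ 2 * (1 + r * k ^ 2) ^ 2 by ring,
          show 4 * (r * k) ^ 2 = r ^ 2 * (4 * k ^ 2) by ring, mul_pow (r ^ 2), mul_pow (r ^ 2)]
        ring
      rw [e1]
      apply PPos.not_neg
      refine (PPos_sq (pow_ne_zero _ hr0)).mul (PPos_const ?_)
      rw [hz_map]
      rw [hz, Finset.sum_range_succ, Finset.sum_eq_zero]
      · have : P.coeff n = 1 := by rw [← hn]; exact hm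
        rw [this]
        simp [hk0]
      · intro j hj
        have : n - j ≠ 0 := by simp at hj; omega
        simp [hk0, this]
    · have hu : IsUnit k := PowerSeries.isUnit_iff_constantCoeff.2 (isUnit_iff_ne_zero.2 hk0)
      obtain ⟨k', hk'⟩ := hu.exists_right_inv
      exact caseA k' (by rw [hk, mul_assoc, hk', mul_one])

theorem corner {P : (PowerSeries ℝ)[X]} {n : ℕ} (hm : P.Monic) (hn : P.natDegree = n) (h1 : 1 ≤ n) (hres : res P = X ^ n)
    (h : ∀ (e : ℕ) (he : e ≠ 0) (σ : ℝ), (σ = 1 ∨ σ = -1) → ∀ θ : PowerSeries ℝ, PowerSeries.constantCoeff θ = 0 → PPos θ →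
      PPos (θ - arcHom σ e he rho) → ¬ PPos (-(eval₂ (arcHom σ e he) θ P))) (m : ℕ) : Tm 1 m P := by
  obtain ⟨hHm, hHn⟩ := HH_monic hm hn h1
  obtain ⟨A, B, hAB, -, -⟩ := thmL _ _ hHm hHn (HH_HL hm hn hres h)
  have key := HH_qe hn
  rw [hAB, eval₂_add, eval₂_mul, eval₂_mul] at key
  set a := eval₂ (qe.comp C) (qal + qbe) A * (qal - qbe) ^ n with ha
  set b := eval₂ (qe.comp C) (qal + qbe) B * (qal - qbe) ^ n with hb
  have key2 : qe (C (4 ^ n * rho ^ (2 * n)) * P) = a * a + b * b := by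
    rw [← key, ha, hb]; ring
  have key3 := congrArg (fun z : QE => z.re.re) key2
  simp only [qe_re, QuadraticAlgebra.re_add, sq_re] at key3
  set c : PowerSeries ℝ := 4 ^ n * ((UU 1)⁻¹ ^ 2) ^ (2 * n) with hc
  have e1 : C (4 ^ n * rho ^ (2 * n)) * P = C (PowerSeries.X ^ (2 * n)) * (C c * P) := by
    rw [← mul_assoc, ← C_mul, rho, hc, mul_pow]; congr 2; ring
  rw [e1] at key3
  obtain ⟨a, b, c', d, a', b', c'', d', hP⟩ := form_div n _ _ _ _ _ _ _ _ _ key3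
  have hTm : Tm 1 m (C c * P) := hP ▸ (Tm_qf m _ _ _ _).add (Tm_qf m _ _ _ _)
  set ci : PowerSeries ℝ := PowerSeries.C ((1/4)^n) * ((UU 1) ^ 2) ^ (2 * n) with hci
  have hcc : ci * c = 1 := by
    rw [hci, hc]
    have e2 : (PowerSeries.C ((1/4 : ℝ)^n)) * (4 : PowerSeries ℝ) ^ n = 1 := by
      rw [← map_ofNat PowerSeries.C 4, ← map_pow, ← map_mul, ← mul_pow]; norm_num
    have e3 : ((UU 1) ^ 2) ^ (2 * n) * ((UU 1)⁻¹ ^ 2) ^ (2 * n) = 1 := by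
      rw [← mul_pow, ← mul_pow, U1_inv]; simp
    calc _ = (PowerSeries.C ((1/4 : ℝ)^n)) * (4 : PowerSeries ℝ) ^ n * (((UU 1) ^ 2) ^ (2 * n) * ((UU 1)⁻¹ ^ 2) ^ (2 * n)) := by ring
      _ = 1 := by rw [e2, e3, one_mul]
  have hci0 : 0 < PowerSeries.constantCoeff ci := by
    rw [hci]; simp [UU]
  have := (Tm_pos (u0 := 1) hci0).mul hTm
  rw [zero_add, ← mul_assoc, ← C_mul, hcc, C_1, one_mul] at this
  exact this

end Loc4


section Loc5
open Polynomial

variable {u0 : ℝ}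

/-- admissible arcs -/
def Adm (u0 : ℝ) (e : ℕ) (he : e ≠ 0) (σ : ℝ) (θ : PowerSeries ℝ) : Prop :=
  PPos θ ∧ PPos (PowerSeries.C (1/4) - θ) ∧ (u0 = 1 → PPos (θ - arcHom σ e he rho))

/-- nonnegativity on admissible arcs -/
def Apsd (u0 : ℝ) (h : (PowerSeries ℝ)[X]) : Prop := ∀ (e : ℕ) (he : e ≠ 0) (σ : ℝ), (σ = 1 ∨ (σ = -1 ∧ u0 ≠ 0)) →
  ∀ θ, Adm u0 e he σ θ → ¬ PPos (-(eval₂ (arcHom σ e he) θ h))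

lemma PPos.cc {f : PowerSeries ℝ} (hf : PPos f) : 0 ≤ PowerSeries.constantCoeff f := by
  obtain ⟨n, g, rfl, hg⟩ := hf
  rcases n with _ | n
  · simpa using hg.le
  · simp

lemma Adm_int {e : ℕ} {he : e ≠ 0} {σ : ℝ} {θ : PowerSeries ℝ} (h1 : 0 < PowerSeries.constantCoeff θ)
    (h2 : PowerSeries.constantCoeff θ < 1/4) : Adm u0 e he σ θ := by
  refine ⟨PPos_const h1, PPos_const ?_, fun _ => PPos_const ?_⟩
  · rw [map_sub, PowerSeries.constantCoeff_C]; linarith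
  · rw [map_sub, constantCoeff_arcHom, res_rho]; linarith

lemma lift_div {P Q : (PowerSeries ℝ)[X]} {n m : ℕ} (hm : P.Monic) (hn : P.natDegree = n) (hmn : 2 * n ≤ m)
    (hg : ∃ g, PH u0 g = C (UU u0 ^ m) * (P * Q)) : ∃ g', PH u0 g' = C (UU u0 ^ (m - 2 * n)) * Q := by
  obtain ⟨g, hg⟩ := hg
  obtain ⟨M, hM⟩ := lift_deg (u0 := u0) (k := 2 * n) (a := P) (by omega)
  have hMj : ∀ j, UU u0 ^ (2 * j) * M.coeff j = UU u0 ^ (2 * n) * P.coeff j := by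
    intro j
    have := congrArg (fun p => p.coeff j) hM
    simpa only [PH_coeff, coeff_C_mul] using this
  have hMn : M.coeff n = 1 := by
    have := hMj n
    have h1 : P.coeff n = 1 := by rw [← hn]; exact hm
    rw [h1] at this
    exact mul_left_cancel₀ (pow_ne_zero _ (UU_ne u0)) this
  have hMd : M.natDegree ≤ n := by
    rw [natDegree_le_iff_coeff_eq_zero]
    intro j hj
    have := hMj j
    rw [coeff_eq_zero_of_natDegree_lt (p := P) (by omega), mul_zero] at this
    exact (mul_eq_zero.1 this).resolve_left (pow_ne_zero _ (UU_ne u0))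
  have hMm : M.Monic := monic_of_natDegree_le_of_coeff_eq_one n hMd hMn
  have hdiv := modByMonic_add_div g M
  have e1 := congrArg (PH u0) hdiv
  rw [map_add, map_mul, hM, hg] at e1
  have e2 : P * (C (UU u0 ^ m) * Q - C (UU u0 ^ (2 * n)) * PH u0 (g /ₘ M)) = PH u0 (g %ₘ M) := by
    linear_combination -e1
  have hnd : M.natDegree = n := natDegree_eq_of_le_of_coeff_ne_zero hMd (by rw [hMn]; exact one_ne_zero)
  have e3 : C (UU u0 ^ m) * Q - C (UU u0 ^ (2 * n)) * PH u0 (g /ₘ M) = 0 := by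
    by_contra hne
    have hd : (PH u0 (g %ₘ M)).degree < n := by
      rw [degree_lt_iff_coeff_zero]
      intro j hj
      rw [PH_coeff, coeff_eq_zero_of_degree_lt, mul_zero]
      refine (degree_modByMonic_lt g hMm).trans_le ?_
      rw [degree_eq_natDegree hMm.ne_zero, hnd]; exact_mod_cast hj
    rw [← e2, degree_mul, degree_eq_natDegree hm.ne_zero, hn, degree_eq_natDegree hne] at hd
    norm_cast at hd
    omega
  refine ⟨g /ₘ M, ?_⟩
  have h0 : (C (UU u0 ^ (2 * n)) : (PowerSeries ℝ)[X]) ≠ 0 := C_ne_zero.2 (pow_ne_zero _ (UU_ne u0))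
  apply mul_left_cancel₀ h0
  rw [← mul_assoc, ← C_mul, ← pow_add, Nat.add_sub_cancel' hmn]
  linear_combination -e3

/-- the local coordinate polynomial -/
def kk (c s : ℝ) : (PowerSeries ℝ)[X] := C (PowerSeries.C s) * (X - C (PowerSeries.C c))

lemma kk_eval (σ : ℝ) (e : ℕ) (he : e ≠ 0) (c s : ℝ) (θ : PowerSeries ℝ) (P : (PowerSeries ℝ)[X]) :
    eval₂ (arcHom σ e he) θ (P.comp (kk c s)) = eval₂ (arcHom σ e he) (PowerSeries.C s * (θ - PowerSeries.C c)) P := by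
  rw [eval₂_comp]
  congr 1
  simp [kk, eval₂_mul, eval₂_sub, arcHom_C]

lemma kk_deg (c : ℝ) {s : ℝ} (hs : s * s = 1) : (kk c s).natDegree = 1 := by
  have : s ≠ 0 := by rintro rfl; norm_num at hs
  rw [kk, natDegree_C_mul (by simpa using this), natDegree_X_sub_C]

lemma split {h : (PowerSeries ℝ)[X]} (h0 : res h ≠ 0) {c s : ℝ} (hs : s * s = 1) (hroot : (res h).eval c = 0) :
    ∃ (n : ℕ) (P Q : (PowerSeries ℝ)[X]), 1 ≤ n ∧ P.Monic ∧ P.natDegree = n ∧ res P = X ^ n ∧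
      h = P.comp (kk c s) * Q.comp (kk c s) ∧ (res Q).eval 0 ≠ 0 ∧
      (res h).natDegree = n + (res (Q.comp (kk c s))).natDegree ∧ res (Q.comp (kk c s)) ≠ 0 ∧
      (∀ y, (res h).eval (c + s * y) = y ^ n * (res Q).eval y) := by
  have hs0 : s ≠ 0 := by rintro rfl; norm_num at hs
  set l : (PowerSeries ℝ)[X] := C (PowerSeries.C c) + C (PowerSeries.C s) * X with hl
  have hlk : l.comp (kk c s) = X := by
    simp only [hl, kk, add_comp, mul_comp, C_comp, X_comp]
    rw [← mul_assoc, ← C_mul, ← map_mul PowerSeries.C, hs]; simp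
  have hresl : res l = C c + C s * X := by simp [res, hl]
  have hresk : res (kk c s) = C s * (X - C c) := by simp [res, kk]
  have hkd : (res (kk c s)).natDegree = 1 := by rw [hresk, natDegree_C_mul hs0, natDegree_X_sub_C]
  have hres1 : res (h.comp l) = (res h).comp (C c + C s * X) := by
    rw [res, Polynomial.map_comp]; congr 1
  have hback : ∀ p : ℝ[X], (p.comp (C c + C s * X)).comp (C s * (X - C c)) = p := by
    intro p
    rw [comp_assoc]
    simp only [add_comp, mul_comp, C_comp, X_comp]
    rw [← mul_assoc, ← C_mul, hs]; simp
  have hne : res (h.comp l) ≠ 0 := by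
    intro hz
    apply h0
    rw [← hback (res h), ← hres1, hz, zero_comp]
  obtain ⟨q, hq, hnd⟩ := exists_eq_pow_rootMultiplicity_mul_and_not_dvd (res (h.comp l)) hne 0
  set n := rootMultiplicity 0 (res (h.comp l)) with hn
  rw [C_0, sub_zero] at hq hnd
  have hn1 : 1 ≤ n := by
    rw [hn, Nat.one_le_iff_ne_zero, ← Nat.pos_iff_ne_zero, rootMultiplicity_pos hne, IsRoot, hres1, eval_comp]
    simpa using hroot
  have hq0 : q.coeff 0 ≠ 0 := fun h => hnd (X_dvd_iff.2 h)
  obtain ⟨P, Q, hPQ, hPm, hPn, hPr, hQr⟩ := factor_lemma (h.comp l) n q hq0 hq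
  have hh : h = P.comp (kk c s) * Q.comp (kk c s) := by
    rw [← mul_comp, ← hPQ, comp_assoc, hlk, comp_X]
  have hrc : ∀ A : (PowerSeries ℝ)[X], res (A.comp (kk c s)) = (res A).comp (res (kk c s)) := fun A => Polynomial.map_comp _ _ _
  have hprod : res h = res (P.comp (kk c s)) * res (Q.comp (kk c s)) := by
    conv_lhs => rw [hh]
    exact Polynomial.map_mul _
  have hQ0 : res (Q.comp (kk c s)) ≠ 0 := by
    intro hz; rw [hz, mul_zero] at hprod; exact h0 hprod
  have hP0 : res (P.comp (kk c s)) ≠ 0 := by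
    intro hz; rw [hz, zero_mul] at hprod; exact h0 hprod
  refine ⟨n, P, Q, hn1, hPm, hPn, hPr, hh, ?_, ?_, hQ0, ?_⟩
  · rw [hQr, ← coeff_zero_eq_eval_zero]; exact hq0
  · rw [hprod, natDegree_mul hP0 hQ0, hrc P, natDegree_comp, hPr, hkd, natDegree_X_pow, mul_one]
  · intro y
    have : (res (h.comp l)).eval y = (res h).eval (c + s * y) := by
      rw [hres1, eval_comp]; simp
    rw [← this, hq, hQr]; simp

lemma psd_res {h : (PowerSeries ℝ)[X]} (hp : Apsd u0 h) {x : ℝ} (h0 : 0 < x) (h1 : x < 1/4) : 0 ≤ (res h).eval x := by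
  by_contra hneg
  refine hp 1 one_ne_zero 1 (Or.inl rfl) (PowerSeries.C x) (Adm_int (by simpa using h0) (by simpa using h1)) ?_
  apply PPos_const
  rw [map_neg, cc_eval, PowerSeries.constantCoeff_C]
  linarith

lemma poly_lim {q : ℝ[X]} {δ : ℝ} (hδ : 0 < δ) (h : ∀ y, 0 < y → y < δ → 0 ≤ q.eval y) : 0 ≤ q.eval 0 := by
  have hc : Continuous fun y => q.eval y := q.continuous
  have : (0:ℝ) ∈ closure (Set.Ioo 0 δ) := by rw [closure_Ioo hδ.ne]; exact ⟨le_rfl, hδ.le⟩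
  exact closure_minimal (s := Set.Ioo 0 δ) (t := {y | 0 ≤ q.eval y}) (fun y hy => h y hy.1 hy.2)
    (isClosed_le continuous_const hc) this

lemma prod_neg {a b : PowerSeries ℝ} (ha : PPos a) (hab : ¬ PPos (-(a * b))) : ¬ PPos (-b) := by
  intro hb
  apply hab
  have := ha.mul hb
  rwa [mul_neg] at this

theorem mainloc (hu0 : 0 ≤ u0) : ∀ (N : ℕ) (h : (PowerSeries ℝ)[X]) (m : ℕ), (res h).natDegree ≤ N → res h ≠ 0 →
    (∃ g, PH u0 g = C (UU u0 ^ m) * h) → 2 * (res h).natDegree ≤ m → Apsd u0 h → Tm u0 m h := by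
  intro N
  induction N with
  | zero =>
    intro h m hN h0 hg hm hp
    refine base_lemma hu0 h hg hm ?_
    rw [eq_C_of_natDegree_le_zero hN] at h0 ⊢
    intro x _ _
    have := psd_res hp (x := 1/8) (by norm_num) (by norm_num)
    rw [eq_C_of_natDegree_le_zero hN, eval_C] at this
    rw [eval_C]
    exact lt_of_le_of_ne this (fun h => h0 (by rw [← h, C_0]))
  | succ N ih =>
    intro h m hN h0 hg hm hp
    by_cases hroot : ∃ c, 0 ≤ c ∧ c ≤ 1/4 ∧ (res h).eval c = 0
    swap
    · refine base_lemma hu0 h hg hm ?_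
      push Not at hroot
      have hpos : ∀ x, 0 ≤ x → x ≤ 1/4 → 0 ≤ (res h).eval x := by
        intro x hx0 hx1
        have hc : Continuous fun y => (res h).eval y := (res h).continuous
        have : x ∈ closure (Set.Ioo 0 (1/4 : ℝ)) := by rw [closure_Ioo (by norm_num)]; exact ⟨hx0, hx1⟩
        exact closure_minimal (s := Set.Ioo 0 (1/4 : ℝ)) (t := {y | 0 ≤ (res h).eval y}) (fun y hy => psd_res hp hy.1 hy.2)
          (isClosed_le continuous_const hc) this
      intro x hx0 hx1
      exact lt_of_le_of_ne (hpos x hx0 hx1) (hroot x hx0 hx1).symm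
    obtain ⟨c, hc0, hc1, hc⟩ := hroot
    -- choose the inward sign
    obtain ⟨s, hs, hsd, hs1⟩ : ∃ s : ℝ, s * s = 1 ∧ (∃ δ > 0, ∀ y, 0 < y → y < δ → 0 < c + s * y ∧ c + s * y < 1/4) ∧
        ((c < 1/4 ∧ s = 1) ∨ (c = 1/4 ∧ s = -1)) := by
      rcases lt_or_eq_of_le hc1 with hlt | rfl
      · exact ⟨1, by norm_num, ⟨1/4 - c, by linarith, fun y h1 h2 => ⟨by linarith, by linarith⟩⟩, Or.inl ⟨hlt, rfl⟩⟩
      · exact ⟨-1, by norm_num, ⟨1/4, by norm_num, fun y h1 h2 => ⟨by linarith, by linarith⟩⟩, Or.inr ⟨rfl, rfl⟩⟩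
    obtain ⟨n, P, Q, hn1, hPm, hPn, hPr, hh, hQ0, hdeg, hQne, hy⟩ := split h0 hs hc
    obtain ⟨δ, hδ, hδy⟩ := hsd
    have hq0 : 0 < (res Q).eval 0 := by
      refine lt_of_le_of_ne (poly_lim hδ fun y h1 h2 => ?_) hQ0.symm
      have a1 := psd_res hp (hδy y h1 h2).1 (hδy y h1 h2).2
      rw [hy] at a1
      exact nonneg_of_mul_nonneg_right a1 (pow_pos h1 n)
    have heven : 0 < c → c < 1/4 → Even n := by
      intro h1 h2
      by_contra hodd
      rw [Nat.not_even_iff_odd] at hodd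
      obtain ⟨_, rfl⟩ : c < 1/4 ∧ s = 1 := by
        rcases hs1 with h | h
        · exact h
        · linarith [h.1]
      have : 0 ≤ ((-(res Q)).comp (-X)).eval 0 := by
        refine poly_lim h1 fun y h3 h4 => ?_
        have a1 := psd_res hp (x := c + 1 * (-y)) (by linarith) (by linarith)
        rw [hy, hodd.neg_pow] at a1
        simp only [eval_comp, eval_neg, eval_X]
        have := pow_pos h3 n
        nlinarith
      simp only [eval_comp, eval_neg, eval_X, neg_zero] at this
      linarith
    -- sign of powers of the constant term
    have hsgn : ∀ θ, PPos θ → PPos (PowerSeries.C (1/4) - θ) → PowerSeries.constantCoeff (PowerSeries.C s * (θ - PowerSeries.C c)) ≠ 0 →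
        0 < (PowerSeries.constantCoeff (PowerSeries.C s * (θ - PowerSeries.C c))) ^ n := by
      intro θ h1 h2 h3
      have b1 := h1.cc
      have b2 := h2.cc
      rw [map_sub, PowerSeries.constantCoeff_C] at b2
      rw [map_mul, map_sub, PowerSeries.constantCoeff_C, PowerSeries.constantCoeff_C] at h3 ⊢
      by_cases hinner : 0 < c ∧ c < 1/4
      · exact (heven hinner.1 hinner.2).pow_pos h3
      · apply pow_pos
        apply lt_of_le_of_ne _ h3.symm
        rcases hs1 with ⟨h4, rfl⟩ | ⟨rfl, rfl⟩
        · have : c = 0 := by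
            by_contra hne
            exact hinner ⟨lt_of_le_of_ne hc0 (Ne.symm hne), h4⟩
          subst this; linarith
        · linarith
    have hev : ∀ (e : ℕ) (he : e ≠ 0) (σ : ℝ) θ, eval₂ (arcHom σ e he) θ h =
        eval₂ (arcHom σ e he) (PowerSeries.C s * (θ - PowerSeries.C c)) P * eval₂ (arcHom σ e he) (PowerSeries.C s * (θ - PowerSeries.C c)) Q := by
      intro e he σ θ
      conv_lhs => rw [hh]
      rw [eval₂_mul, kk_eval, kk_eval]
    -- psd of Q
    have hQpsd : Apsd u0 (Q.comp (kk c s)) := by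
      intro e he σ hσ θ hθ
      rw [kk_eval]
      by_cases hcc : PowerSeries.constantCoeff (PowerSeries.C s * (θ - PowerSeries.C c)) = 0
      · apply PPos.not_neg
        apply PPos_const
        rw [cc_eval, hcc]; exact hq0
      · refine prod_neg (a := eval₂ (arcHom σ e he) (PowerSeries.C s * (θ - PowerSeries.C c)) P) ?_ ?_
        · apply PPos_const
          rw [cc_eval, hPr, eval_pow, eval_X]
          exact hsgn θ hθ.1 hθ.2.1 hcc
        · rw [← hev]; exact hp e he σ hσ θ hθ
    -- P nonnegative at zero arcs
    have hPnn : ∀ (e : ℕ) (he : e ≠ 0) (σ : ℝ), (σ = 1 ∨ (σ = -1 ∧ u0 ≠ 0)) → ∀ y, PowerSeries.constantCoeff y = 0 →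
        Adm u0 e he σ (PowerSeries.C c + PowerSeries.C s * y) → ¬ PPos (-(eval₂ (arcHom σ e he) y P)) := by
      intro e he σ hσ y hy0 hadm
      have h1 := hp e he σ hσ _ hadm
      rw [hev] at h1
      have h2 : PowerSeries.C s * (PowerSeries.C c + PowerSeries.C s * y - PowerSeries.C c) = y := by
        rw [add_sub_cancel_left, ← mul_assoc, ← map_mul PowerSeries.C, hs]; simp
      rw [h2, mul_comm] at h1
      refine prod_neg (PPos_const ?_) h1
      rw [cc_eval, hy0]; exact hq0
    -- P is in the preordering
    have hPTm : Tm u0 (2 * n) (P.comp (kk c s)) := by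
      by_cases hinner : 0 < c ∧ c < 1/4
      · obtain ⟨d, hd⟩ := heven hinner.1 hinner.2
        have : Tm u0 (4 * d) (P.comp (kk c s)) := by
          refine P_int (kk_deg c hs).le hPm (by omega) ?_
          intro e he σ hσ
          convert Set.finite_empty
          rw [Set.eq_empty_iff_forall_notMem]
          intro θ
          by_cases hcc : PowerSeries.constantCoeff θ = 0
          · exact hPnn e he σ hσ θ hcc (Adm_int (by simpa [hcc] using hinner.1) (by simpa [hcc] using hinner.2))
          · apply PPos.not_neg
            apply PPos_const
            rw [cc_eval, hPr, eval_pow, eval_X]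
            exact (heven hinner.1 hinner.2).pow_pos hcc
        rwa [show 2 * n = 4 * d by omega]
      · have hexp : ∀ (e : ℕ) (he : e ≠ 0) (σ : ℝ) θ, eval₂ (arcHom σ e he) θ (expand _ 2 P) = eval₂ (arcHom σ e he) (θ * θ) P := by
          intro e he σ θ
          rw [expand_eq_comp_X_pow, eval₂_comp]; simp [sq]
        have hend : (∀ (e : ℕ) (he : e ≠ 0) (σ : ℝ) θ, θ ≠ 0 → PowerSeries.constantCoeff (θ * θ) = 0 →
            Adm u0 e he σ (PowerSeries.C c + PowerSeries.C s * (θ * θ))) → HLs u0 (expand _ 2 P) := by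
          intro H e he σ hσ
          refine (Set.finite_singleton (0 : PowerSeries ℝ)).subset ?_
          intro θ hθ
          by_contra hne
          rw [Set.mem_singleton_iff] at hne
          rw [Set.mem_ofPred_eq, hexp] at hθ
          revert hθ
          by_cases hcc : PowerSeries.constantCoeff (θ * θ) = 0
          · exact hPnn e he σ hσ _ hcc (H e he σ θ hne hcc)
          · apply PPos.not_neg
            apply PPos_const
            rw [cc_eval, hPr, eval_pow, eval_X]
            apply pow_pos
            rw [map_mul] at hcc ⊢
            exact mul_self_pos.2 (fun h => hcc (by rw [h, mul_zero]))
        rcases hs1 with ⟨h4, rfl⟩ | ⟨rfl, rfl⟩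
        · have : c = 0 := by
            by_contra hne
            exact hinner ⟨lt_of_le_of_ne hc0 (Ne.symm hne), h4⟩
          subst this
          have hk : kk 0 1 = X := by simp [kk]
          rw [hk]
          by_cases hu1 : u0 = 1
          · subst hu1
            rw [comp_X]
            refine corner hPm hPn hn1 hPr ?_ _
            intro e he σ hσ θ hcc h1 h2
            refine hPnn e he σ (by rcases hσ with h | h <;> [left; right] <;> simp [h]) θ hcc ?_
            refine ⟨by simpa using h1, PPos_const (by simp [hcc]), fun _ => by simpa using h2⟩
          · refine P_end natDegree_X_le Tm_X hPm hPn hn1 (hend ?_)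
            intro e he σ θ hne hcc
            refine ⟨by simpa using PPos_sq hne, PPos_const (by simp [hcc]), fun h => absurd h hu1⟩
        · have hk : kk (1/4) (-1) = C (PowerSeries.C (1/4)) - X := by simp [kk]; ring
          refine P_end (kk_deg _ (by norm_num)).le (hk ▸ Tm_up) hPm hPn hn1 (hend ?_)
          intro e he σ θ hne hcc
          have e1 : PowerSeries.C (1/4) + PowerSeries.C (-1) * (θ * θ) = PowerSeries.C (1/4) - θ * θ := by simp [sub_eq_add_neg]
          rw [e1]
          refine ⟨PPos_const ?_, by simpa using PPos_sq hne, fun _ => PPos_const ?_⟩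
          · rw [map_sub, hcc]; norm_num
          · rw [map_sub, map_sub, hcc, constantCoeff_arcHom, res_rho]; norm_num
    have hmn : 2 * n ≤ m := by omega
    -- lift for Q
    have hQlift : ∃ g', PH u0 g' = C (UU u0 ^ (m - 2 * n)) * Q.comp (kk c s) := by
      have hss : (PowerSeries.C s) ^ n * (PowerSeries.C s) ^ n = 1 := by
        rw [← mul_pow, ← map_mul, hs]; simp
      set w : (PowerSeries ℝ)[X] := C (PowerSeries.C s ^ n) with hw
      have hww : w * w = 1 := by rw [hw, ← C_mul, hss, C_1]
      have hs0 : s ≠ 0 := by rintro rfl; norm_num at hs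
      have hPk : (P.comp (kk c s)).leadingCoeff = PowerSeries.C s ^ n := by
        rw [leadingCoeff_comp (by rw [kk_deg c hs]; norm_num), hPm.leadingCoeff, hPn, one_mul, kk, leadingCoeff_mul, leadingCoeff_X_sub_C,
          leadingCoeff_C, mul_one]
      have hPd : (P.comp (kk c s)).natDegree = n := by rw [natDegree_comp, kk_deg c hs, hPn, mul_one]
      have hmon : (w * P.comp (kk c s)).Monic := by
        rw [Monic, leadingCoeff_mul, hPk, hw, leadingCoeff_C, hss]
      obtain ⟨g', hg'⟩ := lift_div (u0 := u0) (Q := w * Q.comp (kk c s)) (m := m) hmon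
        (by rw [natDegree_C_mul (pow_ne_zero _ (by simpa using hs0)), hPd]) hmn (by
          obtain ⟨g, hg⟩ := hg
          refine ⟨g, ?_⟩
          rw [hg]; conv_lhs => rw [hh]
          linear_combination (-(C (UU u0 ^ m) * (P.comp (kk c s)) * (Q.comp (kk c s)))) * hww)
      refine ⟨w * g', ?_⟩
      rw [map_mul, hg', hw, PH_C, ← hw]
      linear_combination (C (UU u0 ^ (m - 2 * n)) * Q.comp (kk c s)) * hww
    have hQTm : Tm u0 (m - 2 * n) (Q.comp (kk c s)) := by
      refine ih _ _ (by omega) hQne hQlift (by omega) hQpsd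
    have := hPTm.mul hQTm
    rw [← hh, Nat.add_sub_cancel' hmn] at this
    exact this

end Loc5


section Loc6
open Polynomial

variable {u0 : ℝ}

/-- point evaluation -/
def pe (u v : ℝ) : ℝ[X][X] →+* ℝ := eval₂RingHom (evalRingHom u) v

lemma pe_u (u v : ℝ) : pe u v bu = u := by simp [pe, bu]
lemma pe_v (u v : ℝ) : pe u v bv = v := by simp [pe, bv]

/-- the region -/
def Rg (u v : ℝ) : Prop := 0 ≤ u ∧ 0 ≤ 2 - u ∧ 0 ≤ v ∧ 0 ≤ 1 - u + v ∧ 0 ≤ u * u - 4 * v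

/-- nonnegative on the region -/
def Psd (f : ℝ[X][X]) : Prop := ∀ u v, Rg u v → 0 ≤ pe u v f

lemma PPos_poly {p : ℝ[X]} (h : PPos (p : PowerSeries ℝ)) : ∀ᶠ x in nhdsWithin (0 : ℝ) (Set.Ioi 0), 0 < p.eval x := by
  obtain ⟨n, g, hg, hg0⟩ := h
  have hd : X ^ n ∣ p := by
    rw [X_pow_dvd_iff]
    intro d hd
    have := congrArg (PowerSeries.coeff d) hg
    rw [coeff_coe] at this
    rw [this]
    exact (PowerSeries.X_pow_dvd_iff.1 (dvd_mul_right _ _)) d hd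
  obtain ⟨G, rfl⟩ := hd
  have hG : (G : PowerSeries ℝ) = g := by
    rw [coe_mul, coe_pow, coe_X] at hg
    exact mul_left_cancel₀ (pow_ne_zero _ PowerSeries.X_ne_zero) hg
  have h0 : 0 < G.eval 0 := by
    rw [← coeff_zero_eq_eval_zero, ← coeff_coe, hG]; simpa using hg0
  have h1 : ∀ᶠ x in nhdsWithin (0 : ℝ) (Set.Ioi 0), 0 < G.eval x :=
    (G.continuous.continuousAt.eventually (lt_mem_nhds h0)).filter_mono nhdsWithin_le_nhds
  filter_upwards [h1, self_mem_nhdsWithin] with x hx hx0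
  rw [eval_mul, eval_pow, eval_X]
  exact mul_pos (pow_pos hx0 n) hx

lemma PPos_stab {f : PowerSeries ℝ} (h : PPos f) : ∃ N, ∀ M, N ≤ M → ∀ k, PPos (f + PowerSeries.X ^ M * k) := by
  obtain ⟨n, g, rfl, hg⟩ := h
  refine ⟨n + 1, fun M hM k => ⟨n, g + PowerSeries.X ^ (M - n) * k, ?_, ?_⟩⟩
  · rw [mul_add, ← mul_assoc, ← pow_add, Nat.add_sub_cancel' (by omega)]
  · have : M - n ≠ 0 := by omega
    simpa [this] using hg

/-- value of `f` along an arc -/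
lemma arc_val (σ : ℝ) (e : ℕ) (he : e ≠ 0) (θ : PowerSeries ℝ) (f : ℝ[X][X]) :
    eval₂ (arcHom σ e he) θ (PH u0 (io u0 f)) =
      eval₂ ((arcHom σ e he).comp (jj u0)) ((arcHom σ e he (UU u0)) ^ 2 * θ) f := by
  change eval₂ (arcHom σ e he) θ (Polynomial.comp (map (jj u0) f) _) = _
  rw [eval₂_comp, eval₂_map, eval₂_mul, eval₂_C, eval₂_X, map_pow]

lemma arc_jj (σ : ℝ) (e : ℕ) (he : e ≠ 0) (p : ℝ[X]) :
    (arcHom σ e he) (jj u0 p) = ((p.comp (C u0 + C σ * X ^ e) : ℝ[X]) : PowerSeries ℝ) := by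
  induction p using Polynomial.induction_on' with
  | add p q hp hq => rw [map_add, map_add, hp, hq, add_comp, coe_add]
  | monomial n a =>
    rw [← C_mul_X_pow_eq_monomial]
    simp [jj, UU, arcHom_C, arcHom_X]

lemma arc_real {f : ℝ[X][X]} (σ : ℝ) (e : ℕ) (he : e ≠ 0) (p : ℝ[X]) :
    eval₂ ((arcHom σ e he).comp (jj u0)) ((arcHom σ e he (UU u0)) ^ 2 * (p : PowerSeries ℝ)) f =
    ((eval₂ (compRingHom (C u0 + C σ * X ^ e)) ((C u0 + C σ * X ^ e) ^ 2 * p) f : ℝ[X]) : PowerSeries ℝ) := by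
  have h1 : (arcHom σ e he).comp (jj u0) = (coeToPowerSeries.ringHom).comp (compRingHom (C u0 + C σ * X ^ e)) := by
    ext1
    · ext1 x; simp [arc_jj]
    · simp [arc_jj]
  have h2 : (arcHom σ e he (UU u0)) ^ 2 * (p : PowerSeries ℝ) = coeToPowerSeries.ringHom ((C u0 + C σ * X ^ e) ^ 2 * p) := by
    simp [UU, arcHom_C, arcHom_X]
  rw [h1, h2, ← hom_eval₂]
  rfl

lemma eval_pe (x : ℝ) (a b : ℝ[X]) (f : ℝ[X][X]) : eval x (eval₂ (compRingHom a) b f) = pe (eval x a) (eval x b) f := by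
  have := hom_eval₂ f (compRingHom a) (evalRingHom x) b
  simp only [coe_evalRingHom] at this
  rw [this, pe, coe_eval₂RingHom]
  congr 1
  ext1
  · ext1 y; simp
  · simp

lemma eval₂_congr_mod {R : Type*} [CommRing R] (φ : R →+* PowerSeries ℝ) (a b : PowerSeries ℝ) (f : R[X]) :
    a - b ∣ eval₂ φ a f - eval₂ φ b f := by
  rw [← eval_map, ← eval_map]; exact sub_dvd_eval_sub a b _

lemma arc_psd {f : ℝ[X][X]} (hf : Psd f) (h0 : 0 ≤ u0) (h1 : u0 ≤ 1) : Apsd u0 (PH u0 (io u0 f)) := by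
  intro e he σ hσ θ hθ hneg
  set φ := (arcHom σ e he).comp (jj u0) with hφ
  set A := arcHom σ e he (UU u0) with hA
  have hAv : A = PowerSeries.C u0 + PowerSeries.C σ * PowerSeries.X ^ e := by
    rw [hA, UU, map_add, arcHom_C, arcHom_X]
  have hAp : PPos A := by
    rcases eq_or_lt_of_le h0 with h | h
    · rw [hAv, ← h]
      rcases hσ with rfl | ⟨_, h3⟩
      · simpa using PPos_X_pow e
      · exact absurd h.symm h3
    · apply PPos_const; rw [hAv]; simpa [he] using h
  obtain ⟨hθ1, hθ2, hθ3⟩ := hθ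
  have hw : PPos (2 - A) := by
    apply PPos_const; rw [hAv, map_sub]
    have : PowerSeries.constantCoeff (2 : PowerSeries ℝ) = 2 := map_ofNat _ 2
    rw [this]
    simp [he]; linarith
  have hv : PPos (A ^ 2 * θ) := by rw [sq]; exact (hAp.mul hAp).mul hθ1
  have h4 : (4 : PowerSeries ℝ) * PowerSeries.C (1/4) = 1 := by
    rw [← map_ofNat PowerSeries.C 4, ← map_mul]; norm_num
  have hD : PPos (A * A - 4 * (A ^ 2 * θ)) := by
    have e1 : A * A - 4 * (A ^ 2 * θ) = (A * A) * 4 * (PowerSeries.C (1/4) - θ) := by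
      linear_combination -(A*A) * h4
    rw [e1]
    refine ((hAp.mul hAp).mul (PPos_const ?_)).mul hθ2
    have : PowerSeries.constantCoeff (4 : PowerSeries ℝ) = 4 := map_ofNat _ 4
    rw [this]; norm_num
  have hq : PPos (1 - A + A ^ 2 * θ) := by
    rcases eq_or_lt_of_le h1 with h | h
    · have h5 := hθ3 h
      have e1 : 1 - A + A ^ 2 * θ = (A * A) * (θ - arcHom σ e he rho) := by
        have e2 : A ^ 2 * arcHom σ e he rho = A - 1 := by
          rw [hA, ← map_pow, ← map_mul, h]
          have : UU 1 ^ 2 * rho = UU 1 - 1 := by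
            have e3 : UU 1 - 1 = PowerSeries.X := by simp [UU]
            rw [e3, rho]
            linear_combination (PowerSeries.X * ((UU 1) * (UU 1)⁻¹ + 1)) * U1_inv
          rw [this, map_sub, map_one]
        linear_combination e2
      rw [e1]
      exact (hAp.mul hAp).mul h5
    · apply PPos_const
      have := hθ1.cc
      rw [hAv]; simp [he]
      have : 0 ≤ u0 ^ 2 * PowerSeries.constantCoeff θ := by positivity
      linarith
  rw [arc_val, ← hφ, ← hA] at hneg
  obtain ⟨N1, s1⟩ := PPos_stab hw
  obtain ⟨N2, s2⟩ := PPos_stab hv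
  obtain ⟨N3, s3⟩ := PPos_stab hD
  obtain ⟨N4, s4⟩ := PPos_stab hq
  obtain ⟨N5, s5⟩ := PPos_stab hneg
  set N := N1 + N2 + N3 + N4 + N5 with hN
  obtain ⟨k, hk⟩ := ps_trunc N θ
  set p := PowerSeries.trunc N θ with hp
  have hpθ : (p : PowerSeries ℝ) = θ - PowerSeries.X ^ N * k := by linear_combination -hk
  have t2 : PPos (A ^ 2 * (p : PowerSeries ℝ)) := by
    have := s2 N (by omega) (- A ^ 2 * k)
    convert this using 1; rw [hpθ]; ring
  have t3 : PPos (A * A - 4 * (A ^ 2 * (p : PowerSeries ℝ))) := by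
    have := s3 N (by omega) (4 * A ^ 2 * k)
    convert this using 1; rw [hpθ]; ring
  have t4 : PPos (1 - A + (A ^ 2 * (p : PowerSeries ℝ))) := by
    have := s4 N (by omega) (- A ^ 2 * k)
    convert this using 1; rw [hpθ]; ring
  have t5 : PPos (-(eval₂ φ (A ^ 2 * (p : PowerSeries ℝ)) f)) := by
    obtain ⟨r, hr⟩ := eval₂_congr_mod φ (A ^ 2 * (p : PowerSeries ℝ)) (A ^ 2 * θ) f
    have := s5 N (by omega) (A ^ 2 * k * r)
    convert this using 1
    rw [hpθ] at hr ⊢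
    linear_combination -hr
  set a : ℝ[X] := C u0 + C σ * X ^ e with ha
  have hAa : A = (a : PowerSeries ℝ) := by rw [hAv, ha]; simp
  rw [hφ, hA, arc_real, ← ha] at t5
  rw [hAa] at t2 t3 t4 hAp hw
  have c1 := PPos_poly hAp
  have c2 := PPos_poly (p := 2 - a) (by convert hw using 1; rw [coe_sub]; congr 1; rw [← C_ofNat, coe_C]; rfl)
  have c3 := PPos_poly (p := a ^ 2 * p) (by simpa using t2)
  have c4 := PPos_poly (p := 1 - a + a ^ 2 * p) (by convert t4 using 1; rw [coe_add, coe_sub, coe_mul, coe_pow, coe_one])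
  have c5 := PPos_poly (p := a * a - 4 * (a ^ 2 * p)) (by
    convert t3 using 1; rw [coe_sub, coe_mul, coe_mul, coe_mul, coe_pow]; congr 2; rw [← C_ofNat, coe_C]; rfl)
  have c6 := PPos_poly (p := -(eval₂ (compRingHom a) (a ^ 2 * p) f)) (by rw [coe_neg]; exact t5)
  obtain ⟨x, d1, d2, d3, d4, d5, d6⟩ := (c1.and (c2.and (c3.and (c4.and (c5.and c6))))).exists
  rw [eval_neg, eval_pe] at d6
  have : Rg (eval x a) (eval x (a ^ 2 * p)) := by
    refine ⟨d1.le, ?_, d3.le, ?_, ?_⟩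
    · simpa using d2.le
    · simpa using d4.le
    · simpa using d5.le
  have := hf _ _ this
  linarith

lemma extract {a : (PowerSeries ℝ)[X]} (ha : a ≠ 0) : ∃ (m : ℕ) (b : (PowerSeries ℝ)[X]), a = C (PowerSeries.X ^ m) * b ∧ res b ≠ 0 := by
  by_contra hcon
  push Not at hcon
  have h : ∀ n : ℕ, ∃ b, a = C (PowerSeries.X ^ n) * b := by
    intro n
    induction n with
    | zero => exact ⟨a, by simp⟩
    | succ n ih =>
      obtain ⟨b, hb⟩ := ih
      obtain ⟨b', rfl⟩ := dvd_of_res (hcon n b hb)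
      exact ⟨b', by rw [hb, pow_succ, C_mul]; ring⟩
  apply ha
  ext i d
  obtain ⟨b, rfl⟩ := h (d + 1)
  rw [coeff_C_mul]
  have : PowerSeries.X ^ (d + 1) ∣ PowerSeries.X ^ (d + 1) * b.coeff i := dvd_mul_right _ _
  simpa using PowerSeries.X_pow_dvd_iff.1 this d (Nat.lt_succ_self d)

lemma jj_taylor (p : ℝ[X]) : jj u0 p = ((p.comp (X + C u0) : ℝ[X]) : PowerSeries ℝ) := by
  induction p using Polynomial.induction_on' with
  | add p q hp hq => rw [map_add, hp, hq, add_comp, coe_add]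
  | monomial n a =>
    rw [← C_mul_X_pow_eq_monomial]
    simp [jj, UU, add_comm]

lemma jj_dvd {N : ℕ} {p : ℝ[X]} (h : PowerSeries.X ^ N ∣ jj u0 p) : (X - C u0) ^ N ∣ p := by
  rw [X_sub_C_pow_dvd_iff, X_pow_dvd_iff]
  rw [jj_taylor, PowerSeries.X_pow_dvd_iff] at h
  intro d hd
  have := h d hd
  rwa [coeff_coe] at this

lemma io_inj : Function.Injective (io u0) := by
  apply Polynomial.map_injective
  rw [injective_iff_map_eq_zero]
  intro p hp
  by_contra hne
  have : (X - C u0) ^ (p.natDegree + 1) ∣ p := jj_dvd (by rw [hp]; exact dvd_zero _)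
  have h2 := natDegree_le_of_dvd this hne
  rw [natDegree_pow, natDegree_X_sub_C] at h2
  omega

lemma io_dvd {N : ℕ} {f : ℝ[X][X]} {k} (h : io u0 f = C (PowerSeries.X ^ N) * k) : ∃ r, f = C ((X - C u0) ^ N) * r := by
  have : C ((X - C u0) ^ N) ∣ f := by
    rw [C_dvd_iff_dvd_coeff]
    intro i
    apply jj_dvd (u0 := u0)
    have := congrArg (fun p => p.coeff i) h
    simp only [io, coe_mapRingHom, coeff_map, coeff_C_mul] at this
    rw [this]; exact dvd_mul_right _ _
  exact this

lemma loc_zero {f : ℝ[X][X]} (hf : Psd f) (hne : f ≠ 0) : io 0 f ∈ TH 0 := by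
  have hU : UU 0 = PowerSeries.X := by simp [UU]
  have hne' : PH 0 (io 0 f) ≠ 0 := by
    intro h
    apply hne
    apply io_inj (u0 := 0)
    apply PH_inj 0
    rw [h, map_zero, map_zero]
  obtain ⟨m, h, hh, hres⟩ := extract hne'
  have hp : Apsd 0 h := by
    intro e he σ hσ θ hθ
    have h1 := arc_psd hf le_rfl zero_le_one e he σ hσ θ hθ
    rw [hh, eval₂_mul, eval₂_C, map_pow, arcHom_X] at h1
    refine prod_neg ?_ h1
    rcases hσ with rfl | ⟨_, h3⟩
    · rw [map_one, one_mul, ← pow_mul]; exact PPos_X_pow _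
    · exact absurd rfl h3
  have hdeg : 2 * (res h).natDegree ≤ m := by
    by_contra hlt
    push Not at hlt
    have hl : (res h).coeff (res h).natDegree ≠ 0 := leadingCoeff_ne_zero.2 hres
    set j := (res h).natDegree
    have h1 := congrArg (fun p => p.coeff j) hh
    simp only [PH_coeff, coeff_C_mul, hU] at h1
    rw [show 2 * j = m + (2 * j - m) by omega, pow_add, mul_assoc] at h1
    have h2 := mul_left_cancel₀ (pow_ne_zero _ PowerSeries.X_ne_zero) h1
    apply hl
    rw [res, coeff_map, ← h2]
    have : 2 * j - m ≠ 0 := by omega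
    simp [this]
  obtain ⟨g, hg, hg2⟩ := mainloc le_rfl _ h m le_rfl hres ⟨io 0 f, by rw [hU]; exact hh⟩ hdeg hp
  have : g = io 0 f := PH_inj 0 (by rw [hg2, hh, hU])
  rwa [← this]

lemma loc_pos {f : ℝ[X][X]} (hf : Psd f) (hne : f ≠ 0) (h0 : 0 < u0) (h1 : u0 ≤ 1) : io u0 f ∈ TH u0 := by
  have hne' : io u0 f ≠ 0 := by
    intro h
    apply hne
    apply io_inj (u0 := u0)
    rw [h, map_zero]
  obtain ⟨m, g, hg, hres⟩ := extract hne'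
  set h := PH u0 g with hh
  have hresh : res h ≠ 0 := by
    intro hz
    apply hres
    ext j
    have := congrArg (fun p => p.coeff j) hz
    simp only [res, coeff_map, hh, PH_coeff, map_mul, map_pow, coeff_zero] at this ⊢
    refine (mul_eq_zero.1 this).resolve_left (pow_ne_zero _ ?_)
    simpa [UU] using h0.ne'
  have hv : ∀ (e : ℕ) (he : e ≠ 0) (σ : ℝ) θ, eval₂ (arcHom σ e he) θ (PH u0 (io u0 f)) =
      (PowerSeries.C σ * PowerSeries.X ^ e) ^ m * eval₂ (arcHom σ e he) θ h := by
    intro e he σ θ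
    rw [hg, map_mul, PH_C, eval₂_mul, eval₂_C, map_pow, arcHom_X]
  have hA := arc_psd hf h0.le h1
  have hme : Even m := by
    by_contra hodd
    rw [Nat.not_even_iff_odd] at hodd
    have key : ∀ x, 0 < x → x < 1/4 → (res h).eval x = 0 := by
      intro x hx0 hx1
      have ad : ∀ σ, Adm u0 1 one_ne_zero σ (PowerSeries.C x) := fun σ => Adm_int (by simpa using hx0) (by simpa using hx1)
      have a1 := hA 1 one_ne_zero 1 (Or.inl rfl) _ (ad 1)
      have a2 := hA 1 one_ne_zero (-1) (Or.inr ⟨rfl, h0.ne'⟩) _ (ad (-1))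
      rw [hv] at a1 a2
      apply le_antisymm
      · by_contra hcon
        push Not at hcon
        apply a2
        have e1 : (PowerSeries.C (-1 : ℝ) * PowerSeries.X ^ 1) ^ m = - PowerSeries.X ^ m := by
          rw [mul_pow, ← map_pow, hodd.neg_one_pow]; simp
        rw [e1, neg_mul, neg_neg]
        refine (PPos_X_pow m).mul (PPos_const ?_)
        rw [cc_eval]; simpa using hcon
      · by_contra hcon
        push Not at hcon
        refine prod_neg (by simpa using PPos_X_pow m) a1 (PPos_const ?_)
        rw [map_neg, cc_eval]; simpa using hcon
    apply hresh
    exact Polynomial.eq_zero_of_infinite_isRoot _ ((Set.Ioo_infinite (show (0:ℝ) < 1/4 by norm_num)).mono fun x hx => key x hx.1 hx.2)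
  obtain ⟨k, hk⟩ := hme
  have hp : Apsd u0 h := by
    intro e he σ hσ θ hθ
    have a1 := hA e he σ hσ θ hθ
    rw [hv] at a1
    refine prod_neg ?_ a1
    rw [hk, pow_add]
    apply PPos_sq
    apply pow_ne_zero
    refine mul_ne_zero ?_ (pow_ne_zero _ PowerSeries.X_ne_zero)
    have : σ ≠ 0 := by rcases hσ with rfl | ⟨rfl, _⟩ <;> norm_num
    simpa using this
  have hT : Tm u0 (2 * (res h).natDegree) h := by
    refine mainloc h0.le _ h _ le_rfl hresh ⟨C (UU u0 ^ (2 * (res h).natDegree)) * g, ?_⟩ le_rfl hp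
    rw [map_mul, PH_C]
  obtain ⟨g', hg', hg2⟩ := Tm_lower (m' := 0) h0 hT
  have : g' = g := PH_inj u0 (by rw [hg2]; simp [hh])
  rw [hg, hk, pow_add, C_mul]
  exact mul_mem (TH_sq u0 _) (this ▸ hg')

/-- the involution -/
def invB : ℝ[X][X] →+* ℝ[X][X] := eval₂RingHom (eval₂RingHom (C.comp C) (2 - bu)) (1 - bu + bv)

lemma invB_u : invB bu = 2 - bu := by simp [invB, bu]
lemma invB_v : invB bv = 1 - bu + bv := by simp [invB, bv]

lemma invB_C (a : ℝ) : invB (C (C a)) = C (C a) := by simp [invB]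

lemma io_invol (f : ℝ[X][X]) : invB (invB f) = f := by
  have : invB.comp invB = RingHom.id _ := by
    apply Polynomial.ringHom_ext'
    · apply Polynomial.ringHom_ext'
      · ext a; simp [invB_C]
      · change invB (invB bu) = bu
        rw [invB_u, map_sub, invB_u, map_ofNat]; ring
    · change invB (invB bv) = bv
      rw [invB_v, map_add, map_sub, invB_u, invB_v, map_one]; ring
  exact congrArg (fun φ => φ f) this

lemma invB_T0 {t : ℝ[X][X]} (ht : t ∈ T0) : invB t ∈ T0 := by
  have : T0 ≤ T0.comap invB := by
    apply Subsemiring.closure_le.2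
    rintro a (ha | ⟨b, rfl⟩)
    · simp only [SetLike.mem_coe, Subsemiring.mem_comap]
      simp only [Set.mem_insert_iff, Set.mem_singleton_iff] at ha
      rcases ha with rfl | rfl | rfl | rfl | rfl
      · rw [invB_u]; exact T0_w
      · rw [map_sub, invB_u, map_ofNat]; convert T0_u using 1; ring
      · rw [invB_v]; exact T0_q
      · rw [map_add, map_sub, invB_u, invB_v, map_one]; convert T0_v using 1; ring
      · rw [map_sub, map_mul, map_mul, invB_u, invB_v, map_ofNat]; convert T0_D using 1; ring
    · simp only [SetLike.mem_coe, Subsemiring.mem_comap, map_mul]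
      exact T0_sq _
  exact this ht

lemma invB_pe (u v : ℝ) (f : ℝ[X][X]) : pe u v (invB f) = pe (2 - u) (1 - u + v) f := by
  have : (pe u v).comp invB = pe (2 - u) (1 - u + v) := by
    apply Polynomial.ringHom_ext'
    · apply Polynomial.ringHom_ext'
      · ext a; simp [invB, pe]
      · change pe u v (invB bu) = pe _ _ bu
        rw [invB_u, map_sub, pe_u, pe_u, map_ofNat]
    · change pe u v (invB bv) = pe _ _ bv
      rw [invB_v, map_add, map_sub, pe_u, pe_v, pe_v, map_one]
  exact congrArg (fun φ => φ f) this

theorem LOC {f : ℝ[X][X]} (hf : Psd f) (h0 : 0 ≤ u0) (h2 : u0 ≤ 2) (N : ℕ) :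
    ∃ t ∈ T0, ∃ r, f = t + C ((X - C u0) ^ N) * r := by
  have main : ∀ (f : ℝ[X][X]) (u0 : ℝ), Psd f → 0 ≤ u0 → u0 ≤ 1 → ∃ t ∈ T0, ∃ r, f = t + C ((X - C u0) ^ N) * r := by
    intro f u0 hf h0 h1
    by_cases hne : f = 0
    · exact ⟨0, zero_mem _, 0, by simp [hne]⟩
    have : io u0 f ∈ TH u0 := by
      rcases eq_or_lt_of_le h0 with rfl | h
      · exact loc_zero hf hne
      · exact loc_pos hf hne h h1
    obtain ⟨t, ht, k, hk⟩ := this N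
    obtain ⟨r, hr⟩ := io_dvd (u0 := u0) (f := f - t) (N := N) (k := k) (by rw [map_sub, hk]; ring)
    exact ⟨t, ht, r, by rw [← hr]; ring⟩
  rcases le_or_gt u0 1 with h1 | h1
  · exact main f u0 hf h0 h1
  · obtain ⟨t, ht, r, hr⟩ := main (invB f) (2 - u0) (by
      intro u v ⟨a1, a2, a3, a4, a5⟩
      rw [invB_pe]
      exact hf _ _ ⟨by linarith, by linarith, by linarith, by linarith, by nlinarith⟩) (by linarith) (by linarith)
    refine ⟨invB t, invB_T0 ht, (-1) ^ N * invB r, ?_⟩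
    rw [← io_invol f, hr, map_add, map_mul]
    congr 1
    have : invB (C ((X - C (2 - u0)) ^ N)) = C ((X - C u0) ^ N) * (-1) ^ N := by
      rw [C_pow, map_pow, C_pow, ← mul_pow]
      congr 1
      rw [C_sub, map_sub]
      change invB bu - _ = _
      rw [invB_u, invB_C]
      simp only [C_sub, map_sub, C_ofNat, bu]; ring
    rw [this]; ring

end Loc6


section Glob7
open Polynomial

lemma pe_C (u v : ℝ) (p : ℝ[X]) : pe u v (C p) = p.eval u := by simp [pe]

lemma algMap_B (r : ℝ) : algebraMap ℝ ℝ[X][X] r = C (C r) := rfl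

lemma T0_const {r : ℝ} (hr : 0 ≤ r) : (C (C r) : ℝ[X][X]) ∈ T0 := pre_smul_mem T0 T0_sq hr

lemma T0_pe {t : ℝ[X][X]} (ht : t ∈ T0) : Psd t := by
  intro u v ⟨h1, h2, h3, h4, h5⟩
  have : T0 ≤ (Subsemiring.nonneg ℝ).comap (pe u v) := by
    apply Subsemiring.closure_le.2
    rintro a (ha | ⟨b, rfl⟩)
    · simp only [SetLike.mem_coe, Subsemiring.mem_comap, Subsemiring.mem_nonneg]
      simp only [Set.mem_insert_iff, Set.mem_singleton_iff] at ha
      rcases ha with rfl | rfl | rfl | rfl | rfl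
      · simpa [pe_u]
      · rw [map_sub, pe_u, map_ofNat]; exact h2
      · simpa [pe_v]
      · simpa [pe_u, pe_v]
      · rw [map_sub, map_mul, map_mul, pe_u, pe_v, map_ofNat]; exact h5
    · simp only [SetLike.mem_coe, Subsemiring.mem_comap, map_mul, Subsemiring.mem_nonneg]
      exact mul_self_nonneg _
  exact this ht

/-- bounded elements -/
def Bd (a : ℝ[X][X]) : Prop := ∃ n : ℝ, 0 ≤ n ∧ C (C n) - a ∈ T0 ∧ C (C n) + a ∈ T0

lemma Bd.add {a b : ℝ[X][X]} (ha : Bd a) (hb : Bd b) : Bd (a + b) := by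
  obtain ⟨n, h0, h1, h2⟩ := ha
  obtain ⟨m, k0, k1, k2⟩ := hb
  refine ⟨n + m, by positivity, ?_, ?_⟩
  · convert add_mem h1 k1 using 1; simp only [C_add]; ring
  · convert add_mem h2 k2 using 1; simp only [C_add]; ring

lemma C_half : (C (C (1/2)) : ℝ[X][X]) * 2 = 1 := by
  rw [← C_ofNat, ← C_ofNat, ← C_mul, ← C_mul]; norm_num

lemma Bd.mul {a b : ℝ[X][X]} (ha : Bd a) (hb : Bd b) : Bd (a * b) := by
  obtain ⟨n, h0, h1, h2⟩ := ha
  obtain ⟨m, k0, k1, k2⟩ := hb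
  have hh : (C (C (1/2)) : ℝ[X][X]) ∈ T0 := T0_const (by norm_num)
  refine ⟨n * m, by positivity, ?_, ?_⟩
  · convert mul_mem hh (add_mem (mul_mem h1 k2) (mul_mem h2 k1)) using 1
    simp only [C_mul]; linear_combination (-(C (C n) * C (C m) - a * b)) * C_half
  · convert mul_mem hh (add_mem (mul_mem h1 k1) (mul_mem h2 k2)) using 1
    simp only [C_mul]; linear_combination (-(C (C n) * C (C m) + a * b)) * C_half

lemma Bd_const (r : ℝ) : Bd (C (C r)) := by
  refine ⟨|r|, abs_nonneg r, ?_, ?_⟩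
  · rw [← C_sub, ← C_sub]; exact T0_const (by linarith [le_abs_self r])
  · rw [← C_add, ← C_add]; exact T0_const (by linarith [neg_abs_le r])

lemma C_C_ofNat (n : ℕ) [n.AtLeastTwo] : (C (C (OfNat.ofNat n)) : ℝ[X][X]) = OfNat.ofNat n := by
  rw [C_ofNat, C_ofNat]

lemma Bd_u : Bd bu := by
  refine ⟨2, by norm_num, ?_, ?_⟩
  · rw [C_C_ofNat]; exact T0_w
  · exact add_mem (T0_const (by norm_num)) T0_u

lemma Bd_v : Bd bv := by
  refine ⟨1, by norm_num, ?_, ?_⟩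
  · have hh : (C (C (1/2)) : ℝ[X][X]) ∈ T0 := T0_const (by norm_num)
    have h2 : (2 : ℝ[X][X]) ∈ T0 := by rw [← C_C_ofNat]; exact T0_const (by norm_num)
    convert mul_mem (mul_mem hh hh) (add_mem T0_D (mul_mem T0_w (add_mem h2 T0_u))) using 1
    simp only [C_1]
    have := C_half
    set z : ℝ[X][X] := C (C (1/2))
    linear_combination (-(1 - bv) * (z * 2 + 1)) * C_half
  · exact add_mem (T0_const (by norm_num)) T0_v

lemma Bd_all (a : ℝ[X][X]) : Bd a := by
  have hC : ∀ p : ℝ[X], Bd (C p) := by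
    intro p
    induction p using Polynomial.induction_on with
    | C r => exact Bd_const r
    | add p q hp hq => rw [C_add]; exact hp.add hq
    | monomial n r h => rw [pow_succ, ← mul_assoc, C_mul]; exact h.mul Bd_u
  induction a using Polynomial.induction_on with
  | C p => exact hC p
  | add p q hp hq => exact hp.add hq
  | monomial n r h => rw [pow_succ, ← mul_assoc]; exact h.mul Bd_v

lemma pst {f : ℝ[X][X]} (hf : ∀ u v, Rg u v → 0 < pe u v f) : f ∈ T0 := by
  apply positivst T0 T0_sq
  · intro a
    obtain ⟨n, _, h, _⟩ := Bd_all a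
    exact ⟨n, h⟩
  · intro φ hφ
    have e : (φ : ℝ[X][X] →+* ℝ) = pe (φ bu) (φ bv) := by
      apply Polynomial.ringHom_ext'
      · apply Polynomial.ringHom_ext'
        · ext a
          simp [pe]
        · change φ bu = pe _ _ bu
          rw [pe_u]
      · change φ bv = pe _ _ bv
        rw [pe_v]
    have e' : φ f = pe (φ bu) (φ bv) f := congrArg (fun ψ => ψ f) e
    rw [e']
    apply hf
    refine ⟨hφ _ T0_u, ?_, hφ _ T0_v, ?_, ?_⟩
    · have := hφ _ T0_w
      rwa [map_sub, map_ofNat] at this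
    · simpa using hφ _ T0_q
    · have := hφ _ T0_D
      rwa [map_sub, map_mul, map_mul, map_ofNat] at this

lemma pe_bound (a : ℝ[X][X]) : ∃ R : ℝ, 0 < R ∧ ∀ u v, Rg u v → |pe u v a| ≤ R := by
  obtain ⟨n, h0, h1, h2⟩ := Bd_all a
  refine ⟨n + 1, by positivity, fun u v h => ?_⟩
  have := T0_pe h1 u v h
  have := T0_pe h2 u v h
  simp only [map_sub, map_add, pe_C, eval_C] at *
  rw [abs_le]; constructor <;> linarith

lemma glue {f t r : ℝ[X][X]} {p : ℝ[X]} {ε : ℝ} (hε : 0 < ε)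
    (hf : ∀ u v, Rg u v → 2 * ε * (p.eval u) ^ 2 ≤ pe u v f) (ht : t ∈ T0)
    (he : f - C (C ε * p ^ 2) = t + C (p ^ 3) * r) : f ∈ T0 := by
  obtain ⟨R, hR, hRb⟩ := pe_bound r
  obtain ⟨Q, hQ, hQb⟩ := pe_bound (C (p ^ 2))
  simp only [pe_C, eval_pow] at hQb
  set η := ε / R with hη
  have hη0 : 0 < η := by positivity
  set lam := 1 / Q with hl
  have hl0 : 0 < lam := by positivity
  have hle : ∀ u v, Rg u v → 0 ≤ lam * (p.eval u) ^ 2 ∧ lam * (p.eval u) ^ 2 ≤ 1 := by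
    intro u v h
    refine ⟨by positivity, ?_⟩
    have := (le_abs_self _).trans (hQb u v h)
    rw [hl, one_div, inv_mul_le_iff₀ hQ]; linarith
  -- choose M
  obtain ⟨M, hM⟩ : ∃ M : ℕ, ∀ u v, Rg u v → η ≤ |p.eval u| →
      (1 - lam * (p.eval u) ^ 2) ^ (2 * M) * (Q + 1) * R < ε := by
    rcases le_or_gt (lam * η ^ 2) 1 with h1 | h1
    · have hx : 0 ≤ 1 - lam * η ^ 2 := by linarith
      have hx1 : 1 - lam * η ^ 2 < 1 := by have : 0 < lam * η ^ 2 := by positivity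
                                           linarith
      have hlim := (tendsto_pow_atTop_nhds_zero_of_lt_one hx hx1).mul_const ((Q + 1) * R)
      rw [zero_mul] at hlim
      obtain ⟨M, hM⟩ := (hlim.eventually (gt_mem_nhds hε)).exists_forall_of_atTop
      refine ⟨M, fun u v h hu => ?_⟩
      refine lt_of_le_of_lt ?_ (hM (2 * M) (by omega))
      rw [mul_assoc]
      apply mul_le_mul_of_nonneg_right _ (by positivity)
      apply pow_le_pow_left₀ (by linarith [(hle u v h).2])
      have : η ^ 2 ≤ (p.eval u) ^ 2 := by rw [← sq_abs (p.eval u)]; exact pow_le_pow_left₀ hη0.le hu 2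
      have := mul_le_mul_of_nonneg_left this hl0.le
      linarith
    · refine ⟨0, fun u v h hu => ?_⟩
      exfalso
      have : η ^ 2 ≤ (p.eval u) ^ 2 := by rw [← sq_abs (p.eval u)]; exact pow_le_pow_left₀ hη0.le hu 2
      have := mul_le_mul_of_nonneg_left this hl0.le
      linarith [(hle u v h).2]
  set x : ℝ[X] := 1 - C lam * p ^ 2 with hx
  set S : ℝ[X] := ∑ i ∈ Finset.range (2 * M), x ^ i with hS
  have hgs : C lam * p ^ 2 * S = 1 - x ^ (2 * M) := by
    have := mul_neg_geom_sum x (2 * M)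
    rw [← this]; congr 1; rw [hx]; ring
  set br : ℝ[X][X] := C (C lam * S) * f + C (x ^ (2 * M)) * (C (C ε) + C p * r) with hbr
  have hbrT : br ∈ T0 := by
    apply pst
    intro u v h
    rw [hbr]
    simp only [map_add, map_mul, pe_C, eval_mul, eval_C, eval_pow]
    set y := eval u p with hy
    have hxe : eval u x = 1 - lam * y ^ 2 := by simp [hx, hy]
    have hSe : lam * y ^ 2 * eval u S = 1 - (1 - lam * y ^ 2) ^ (2 * M) := by
      have := congrArg (eval u) hgs
      simpa [hxe, ← hy] using this
    have hx0 : 0 ≤ 1 - lam * y ^ 2 := by linarith [(hle u v h).2]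
    have hx1 : 1 - lam * y ^ 2 ≤ 1 := by linarith [(hle u v h).1]
    have hS0 : 0 ≤ eval u S := by
      rw [hS, eval_finsetSum]
      apply Finset.sum_nonneg
      intro i _
      rw [eval_pow, hxe]; exact pow_nonneg hx0 i
    rw [hxe]
    set χ := (1 - lam * y ^ 2) ^ (2 * M) with hχ
    have hχ0 : 0 ≤ χ := pow_nonneg hx0 _
    have hχ1 : χ ≤ 1 := pow_le_one₀ hx0 hx1
    have b1 : lam * eval u S * (2 * ε * y ^ 2) ≤ lam * eval u S * pe u v f :=
      mul_le_mul_of_nonneg_left (hf u v h) (by positivity)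
    have b2 : lam * eval u S * (2 * ε * y ^ 2) = 2 * ε * (1 - χ) := by rw [← hSe]; ring
    have b3 : χ * (|y| * R) < ε ∨ |y| * R < ε := by
      rcases le_or_gt η |y| with h1 | h1
      · left
        have h2 := hM u v h h1
        refine lt_of_le_of_lt ?_ h2
        rw [mul_assoc]
        apply mul_le_mul_of_nonneg_left _ hχ0
        apply mul_le_mul_of_nonneg_right _ hR.le
        have : |y| ^ 2 ≤ Q := by rw [sq_abs]; exact (le_abs_self _).trans (hQb u v h)
        nlinarith [abs_nonneg y]
      · right
        rw [hη, lt_div_iff₀ hR] at h1; exact h1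
    have b3' : χ * (|y| * R) < ε := by
      rcases b3 with h1 | h1
      · exact h1
      · refine lt_of_le_of_lt ?_ h1
        exact mul_le_of_le_one_left (by positivity) hχ1
    have b4 : -(|y| * R) ≤ y * pe u v r := by
      have : |y * pe u v r| ≤ |y| * R := by
        rw [abs_mul]; exact mul_le_mul_of_nonneg_left (hRb u v h) (abs_nonneg _)
      linarith [neg_abs_le (y * pe u v r)]
    have b5 := mul_le_mul_of_nonneg_left b4 hχ0
    nlinarith
  have hfin : f = C p * C p * br + C (x ^ M) * C (x ^ M) * t := by
    have h1 : (C lam * p ^ 2 * S) = 1 - x ^ M * x ^ M := by rw [hgs]; ring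
    have h2 := congrArg (C : ℝ[X] → ℝ[X][X]) h1
    have h3 : t = f - C (C ε * p ^ 2) - C (p ^ 3) * r := by rw [he]; ring
    rw [hbr, h3, show x ^ (2 * M) = x ^ M * x ^ M by ring]
    simp only [C_mul, C_sub, C_pow, C_1] at h2 ⊢
    linear_combination (-f) * h2
  rw [hfin]
  exact add_mem (mul_mem (T0_sq _) hbrT) (mul_mem (T0_sq _) ht)

lemma LOC_prod {f : ℝ[X][X]} (hf : Psd f) (s : Finset ℝ) (hs : ∀ a ∈ s, 0 ≤ a ∧ a ≤ 2) (m : ℝ → ℕ) :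
    ∃ t ∈ T0, ∃ r, f = t + C (∏ a ∈ s, (X - C a) ^ m a) * r := by
  classical
  induction s using Finset.induction_on with
  | empty => exact ⟨0, zero_mem _, f, by simp⟩
  | insert a s ha ih =>
    obtain ⟨t, ht, r, hr⟩ := ih fun b hb => hs b (Finset.mem_insert_of_mem hb)
    obtain ⟨h0, h2⟩ := hs a (Finset.mem_insert_self a s)
    obtain ⟨t', ht', r', hr'⟩ := LOC hf h0 h2 (m a)
    rw [Finset.prod_insert ha]
    set P := ∏ a ∈ s, (X - C a) ^ m a
    set A := (X - C a) ^ m a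
    have hco : IsCoprime A P := by
      apply IsCoprime.prod_right
      intro b hb
      apply IsCoprime.pow
      apply isCoprime_X_sub_C_of_isUnit_sub
      exact (sub_ne_zero.2 (fun h : a = b => ha (by rw [h]; exact hb))).isUnit
    obtain ⟨x, y, hxy⟩ := hco
    have hxy' := congrArg (C : ℝ[X] → ℝ[X][X]) hxy
    simp only [C_add, C_mul, C_1] at hxy'
    refine ⟨C (x * A) * C (x * A) * t + C (y * P) * C (y * P) * t',
      add_mem (mul_mem (T0_sq _) ht) (mul_mem (T0_sq _) ht'), 
      C x * C x * C A * r + C y * C y * C P * r' + 2 * C x * C y * f, ?_⟩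
    have e1 : t = f - C P * r := by rw [hr]; ring
    have e2 : t' = f - C A * r' := by rw [hr']; ring
    rw [e1, e2]
    simp only [C_mul]
    linear_combination (-f * (C x * C A + C y * C P + 1)) * hxy'

lemma split_roots {p : ℝ[X]} (hp : p ≠ 0) : ∃ (s : Finset ℝ) (m : ℝ → ℕ) (p2 : ℝ[X]), (∀ a ∈ s, 0 ≤ a ∧ a ≤ 2) ∧
    p = (∏ a ∈ s, (X - C a) ^ m a) * p2 ∧ ∀ u, 0 ≤ u → u ≤ 2 → p2.eval u ≠ 0 := by
  classical
  obtain ⟨q, h1, h2, h3⟩ := exists_prod_multiset_X_sub_C_mul p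
  set r1 := p.roots.filter (fun a => 0 ≤ a ∧ a ≤ 2)
  set r2 := p.roots.filter (fun a => ¬ (0 ≤ a ∧ a ≤ 2))
  have hq : q ≠ 0 := by rintro rfl; simp at h1; exact hp h1.symm
  refine ⟨r1.toFinset, fun a => r1.count a, (r2.map fun a => X - C a).prod * q, ?_, ?_, ?_⟩
  · intro a ha
    rw [Multiset.mem_toFinset, Multiset.mem_filter] at ha
    exact ha.2
  · rw [← Finset.prod_multiset_map_count, ← mul_assoc, ← Multiset.prod_add, ← Multiset.map_add,
      Multiset.filter_add_not, h1]
  · intro u h0 h2' hz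
    rw [eval_mul] at hz
    rcases mul_eq_zero.1 hz with h | h
    · rw [eval_multiset_prod, Multiset.map_map, Multiset.prod_eq_zero_iff, Multiset.mem_map] at h
      obtain ⟨a, ha, he⟩ := h
      rw [Multiset.mem_filter] at ha
      simp only [Function.comp, eval_sub, eval_X, eval_C, sub_eq_zero] at he
      exact ha.2 (he ▸ ⟨h0, h2'⟩)
    · have : u ∈ q.roots := (mem_roots hq).2 h
      rw [h3] at this; simp at this

theorem bounded_case {f : ℝ[X][X]} {p : ℝ[X]} (hp : p ≠ 0) {K : ℝ} (hK : 0 < K)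
    (hf : ∀ u v, Rg u v → |p.eval u| ≤ K * pe u v f) : f ∈ T0 := by
  obtain ⟨s, m, p2, hs, hpe, hp2⟩ := split_roots hp
  set P := ∏ a ∈ s, (X - C a) ^ m a with hP
  obtain ⟨Q, hQ, hQb⟩ := pe_bound (C p)
  obtain ⟨δ, hδ, hδb⟩ : ∃ δ : ℝ, 0 < δ ∧ ∀ u, 0 ≤ u → u ≤ 2 → δ ≤ (p2.eval u) ^ 2 := by
    obtain ⟨u, hu, hmin⟩ := isCompact_Icc.exists_isMinOn (s := Set.Icc (0 : ℝ) 2) ⟨0, by norm_num⟩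
      (f := fun u => (p2.eval u) ^ 2) (p2.continuous.pow 2).continuousOn
    refine ⟨(p2.eval u) ^ 2, ?_, fun x h0 h2 => hmin ⟨h0, h2⟩⟩
    have := hp2 u hu.1 hu.2
    positivity
  set ε := δ / (2 * Q * K) with hε
  have hε0 : 0 < ε := by positivity
  have hb : ∀ u v, Rg u v → 2 * ε * (P.eval u) ^ 2 ≤ pe u v f := by
    intro u v h
    have h1 := hf u v h
    have h2 := hQb u v h
    rw [pe_C] at h2
    have h3 := hδb u h.1 (by linarith [h.2.1])
    have h4 : (p.eval u) ^ 2 = (P.eval u) ^ 2 * (p2.eval u) ^ 2 := by rw [hpe, eval_mul, mul_pow]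
    have h5 : (P.eval u) ^ 2 * δ ≤ Q * (K * pe u v f) := by
      calc (P.eval u) ^ 2 * δ ≤ (p.eval u) ^ 2 := by rw [h4]; gcongr
        _ = |p.eval u| * |p.eval u| := by rw [← sq, sq_abs]
        _ ≤ Q * (K * pe u v f) := by gcongr
    rw [hε, show 2 * (δ / (2 * Q * K)) * (P.eval u) ^ 2 = ((P.eval u) ^ 2 * δ) / (Q * K) by field_simp,
      div_le_iff₀ (by positivity)]
    linarith
  have hpsd : Psd (f - C (C ε * P ^ 2)) := by
    intro u v h
    have := hb u v h
    simp only [map_sub, pe_C, eval_mul, eval_C, eval_pow]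
    have : 0 ≤ ε * (P.eval u) ^ 2 := by positivity
    linarith
  obtain ⟨t, ht, r, hr⟩ := LOC_prod hpsd s hs (fun a => m a * 3)
  refine glue hε0 hb ht (r := r) ?_
  rw [hr, hP, ← Finset.prod_pow]
  simp only [pow_mul]

end Glob7


section Glob8
open Polynomial

lemma pe_map (u v : ℝ) (f : ℝ[X][X]) : pe u v f = (f.map (evalRingHom u)).eval v := by
  rw [pe, coe_eval₂RingHom, eval_map]

lemma Rg_param {u v : ℝ} (h : Rg u v) : ∃ s t : ℝ, 0 ≤ s ∧ s ≤ 1 ∧ 0 ≤ t ∧ t ≤ 1 ∧ u = s + t ∧ v = s * t := by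
  obtain ⟨h1, h2, h3, h4, h5⟩ := h
  set d := Real.sqrt (u * u - 4 * v) with hd
  have hd2 : d * d = u * u - 4 * v := Real.mul_self_sqrt h5
  have hd0 : 0 ≤ d := Real.sqrt_nonneg _
  have a1 : d ≤ u := by nlinarith
  have a2 : d ≤ 2 - u := by nlinarith
  refine ⟨(u + d) / 2, (u - d) / 2, by linarith, by linarith, by linarith, by linarith, by ring, by nlinarith⟩

lemma param_Rg {s t : ℝ} (hs : 0 ≤ s) (hs1 : s ≤ 1) (ht : 0 ≤ t) (ht1 : t ≤ 1) : Rg (s + t) (s * t) := by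
  refine ⟨by linarith, by linarith, by positivity, ?_, ?_⟩
  · nlinarith
  · nlinarith [sq_nonneg (s - t)]

lemma exists_pe_ne {g : ℝ[X][X]} (hg : g ≠ 0) : ∃ u v, Rg u v ∧ pe u v g ≠ 0 := by
  by_contra hcon
  push Not at hcon
  have h1 : ∀ u ∈ Set.Ioo (0 : ℝ) 1, g.map (evalRingHom u) = 0 := by
    intro u hu
    apply Polynomial.eq_zero_of_infinite_isRoot
    apply (Set.Ioo_infinite (show (0:ℝ) < u * u / 4 by nlinarith [hu.1])).mono
    intro v hv
    change eval v _ = 0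
    rw [← pe_map]
    refine hcon u v ⟨hu.1.le, by linarith [hu.2], hv.1.le, by linarith [hu.2, hv.1], by linarith [hv.2]⟩
  apply hg
  ext1 i
  rw [coeff_zero]
  apply Polynomial.eq_zero_of_infinite_isRoot
  apply (Set.Ioo_infinite (show (0:ℝ) < 1 by norm_num)).mono
  intro u hu
  have := congrArg (fun p => p.coeff i) (h1 u hu)
  simpa using this

lemma dens {g f : ℝ[X][X]} (hg : g ≠ 0) (hgp : Psd g) (hgf : Psd (g * f)) : Psd f := by
  intro u v h
  obtain ⟨s, t, hs, hs1, ht, ht1, rfl, rfl⟩ := Rg_param h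
  obtain ⟨u', v', h', hne⟩ := exists_pe_ne hg
  obtain ⟨s', t', ks, ks1, kt, kt1, rfl, rfl⟩ := Rg_param h'
  set S : ℝ[X] := C s + X * C (s' - s) with hS
  set T : ℝ[X] := C t + X * C (t' - t) with hT
  set G := eval₂ (compRingHom (S + T)) (S * T) g with hG
  set F := eval₂ (compRingHom (S + T)) (S * T) f with hF
  have ev : ∀ x k, eval x (eval₂ (compRingHom (S + T)) (S * T) k) =
      pe ((s + x * (s' - s)) + (t + x * (t' - t))) ((s + x * (s' - s)) * (t + x * (t' - t))) k := by
    intro x k; rw [eval_pe]; simp [hS, hT]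
  have hG0 : G ≠ 0 := by
    intro h0
    apply hne
    have := ev 1 g
    rw [← hG, h0, eval_zero] at this
    rw [this]; congr 2 <;> ring
  have hF0 : eval 0 F = pe (s + t) (s * t) f := by rw [hF, ev]; simp
  rw [← hF0]
  by_contra hlt
  push Not at hlt
  have h1 : ∀ᶠ x in nhdsWithin (0 : ℝ) (Set.Ioi 0), eval x F < 0 :=
    (F.continuous.continuousAt.eventually (gt_mem_nhds hlt)).filter_mono nhdsWithin_le_nhds
  have h2 : ∀ᶠ x in nhdsWithin (0 : ℝ) (Set.Ioi 0), x < 1 :=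
    (gt_mem_nhds (show (0 : ℝ) < 1 by norm_num)).filter_mono nhdsWithin_le_nhds
  obtain ⟨δ, hδ, hδ2⟩ := mem_nhdsGT_iff_exists_Ioo_subset.1 (h1.and h2)
  apply hG0
  apply Polynomial.eq_zero_of_infinite_isRoot
  apply (Set.Ioo_infinite hδ).mono
  intro x hx
  obtain ⟨c1, c2⟩ := hδ2 hx
  have hx0 := hx.1
  have r : Rg ((s + x * (s' - s)) + (t + x * (t' - t))) ((s + x * (s' - s)) * (t + x * (t' - t))) := by
    apply param_Rg <;> nlinarith
  have d1 := hgp _ _ r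
  have d2 := hgf _ _ r
  rw [map_mul, ← ev, ← ev, ← hG, ← hF] at d2
  rw [← ev, ← hG] at d1
  change eval x G = 0
  nlinarith

lemma exists_irr {p : ℝ[X][X]} (hp : p ≠ 0) (hd : 0 < p.natDegree) : ∃ q, Irreducible q ∧ q ∣ p ∧ 0 < q.natDegree := by
  induction p using WfDvdMonoid.induction_on_irreducible with
  | zero => exact absurd rfl hp
  | unit u hu => rw [natDegree_eq_zero_of_isUnit hu] at hd; exact absurd hd (lt_irrefl _)
  | mul a i ha hi ih =>
    rw [natDegree_mul hi.ne_zero ha] at hd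
    rcases Nat.eq_zero_or_pos i.natDegree with h | h
    · obtain ⟨q, h1, h2, h3⟩ := ih ha (by omega)
      exact ⟨q, h1, h2.mul_left _, h3⟩
    · exact ⟨i, hi, dvd_mul_right _ _, h⟩

lemma clear_den (p : (FractionRing ℝ[X])[X]) : ∃ (P : ℝ[X][X]) (c : ℝ[X]), c ≠ 0 ∧
    P.map (algebraMap ℝ[X] (FractionRing ℝ[X])) = C (algebraMap ℝ[X] (FractionRing ℝ[X]) c) * p := by
  obtain ⟨b, hb, h⟩ := IsLocalization.integerNormalization_spec (nonZeroDivisors ℝ[X]) p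
  refine ⟨_, b, nonZeroDivisors.ne_zero hb, h.trans ?_⟩
  rw [← smul_eq_C_mul, algebraMap_smul]

lemma sep_exists {f : ℝ[X][X]} (hf0 : f ≠ 0) (hf : Squarefree f) : ∃ (a b : ℝ[X][X]) (c : ℝ[X]), c ≠ 0 ∧ a * f + b * derivative f = C c := by
  let ι : ℝ[X] →+* FractionRing ℝ[X] := algebraMap ℝ[X] (FractionRing ℝ[X])
  have hι : Function.Injective ι := IsFractionRing.injective _ _
  have hsq : Squarefree (f.map ι) := by
    rw [squarefree_iff_irreducible_sq_not_dvd_of_ne_zero (by rwa [Ne, Polynomial.map_eq_zero_iff hι])]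
    rintro p hp ⟨k, hk⟩
    obtain ⟨P, c, hc, hP⟩ := clear_den p
    obtain ⟨Q, d, hd, hQ⟩ := clear_den k
    have e1 : P * P * Q = C (c * c * d) * f := by
      apply Polynomial.map_injective ι hι
      simp only [Polynomial.map_mul, hk, map_C, map_mul]
      rw [hP, hQ]; ring
    have hιc : ι c ≠ 0 := by rwa [Ne, map_eq_zero_iff ι hι]
    have hdeg : P.natDegree = p.natDegree := by
      rw [← natDegree_map_eq_of_injective hι P, hP, natDegree_C_mul hιc]
    have hP0 : P ≠ 0 := by
      rintro rfl
      rw [Polynomial.map_zero] at hP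
      exact (mul_ne_zero (C_ne_zero.2 hιc) hp.ne_zero) hP.symm
    obtain ⟨q, hq, hqP, hqd⟩ := exists_irr hP0 (by rw [hdeg]; exact hp.natDegree_pos)
    have hqp : Prime q := hq.prime
    have hcd : c * c * d ≠ 0 := mul_ne_zero (mul_ne_zero hc hc) hd
    have hnd : ¬ q ∣ C (c * c * d) := by
      intro h
      have := natDegree_le_of_dvd h (C_ne_zero.2 hcd)
      rw [natDegree_C] at this; omega
    have hdv : q ^ 2 ∣ C (c * c * d) * f := by
      rw [← e1, sq]; exact (mul_dvd_mul hqP hqP).mul_right _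
    have := hqp.pow_dvd_of_dvd_mul_left 2 hnd hdv
    rw [sq] at this
    exact hqp.not_isUnit (hf q this)
  have hsep : (f.map ι).Separable := PerfectField.separable_iff_squarefree.2 hsq
  obtain ⟨a, b, hab⟩ := hsep
  obtain ⟨A, c, hc, hA⟩ := clear_den a
  obtain ⟨B, d, hd, hB⟩ := clear_den b
  refine ⟨C d * A, C c * B, c * d, mul_ne_zero hc hd, ?_⟩
  apply Polynomial.map_injective ι hι
  simp only [Polynomial.map_mul, Polynomial.map_add, map_C, ← derivative_map, map_mul]
  rw [hA, hB]
  linear_combination (C (ι c) * C (ι d)) * hab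

lemma fiber_min {f : ℝ[X][X]} {u v : ℝ} (h : Rg u v) : ∃ w, Rg u w ∧ pe u w f ≤ pe u v f ∧
    (w = 0 ∨ w = u - 1 ∨ w = u * u / 4 ∨ pe u w (derivative f) = 0) := by
  obtain ⟨h1, h2, h3, h4, h5⟩ := h
  obtain ⟨w, hw, hmin⟩ := isCompact_Icc.exists_isMinOn (s := Set.Icc (max 0 (u - 1)) (u * u / 4))
    ⟨v, max_le h3 (by linarith), by linarith⟩ (f := fun v => (f.map (evalRingHom u)).eval v)
    (f.map (evalRingHom u)).continuous.continuousOn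
  have hw0 := (le_max_left _ _).trans hw.1
  have hw1 := (le_max_right _ _).trans hw.1
  refine ⟨w, ⟨h1, h2, hw0, by linarith, by linarith [hw.2]⟩, ?_, ?_⟩
  · rw [pe_map, pe_map]
    exact hmin ⟨max_le h3 (by linarith), by linarith⟩
  · by_contra hcon
    push Not at hcon
    obtain ⟨c1, c2, c3, c4⟩ := hcon
    apply c4
    have hloc : IsLocalMin (fun v => (f.map (evalRingHom u)).eval v) w := by
      apply hmin.isLocalMin
      apply Icc_mem_nhds
      · exact max_lt (lt_of_le_of_ne hw0 c1.symm) (lt_of_le_of_ne hw1 c2.symm)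
      · exact lt_of_le_of_ne hw.2 c3
    rw [pe_map, ← derivative_map]
    exact hloc.hasDerivAt_eq_zero (Polynomial.hasDerivAt _ _)

lemma pe_eval (u : ℝ) (a : ℝ[X]) (f : ℝ[X][X]) : (f.eval a).eval u = pe u (a.eval u) f := by
  have : (evalRingHom u).comp (evalRingHom a) = pe u (a.eval u) := by
    apply Polynomial.ringHom_ext'
    · apply Polynomial.ringHom_ext'
      · ext r; simp [pe]
      · simp [pe]
    · simp [pe]
  exact congrArg (fun φ => φ f) this

lemma reduced_case {f : ℝ[X][X]} (hf0 : f ≠ 0) (hf : Squarefree f) (hp : Psd f) (hv : ¬ bv ∣ f) (hq : ¬ (1 - bu + bv) ∣ f)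
    (hD : ¬ (bu * bu - 4 * bv) ∣ f) : f ∈ T0 := by
  obtain ⟨a, b, c, hc, habc⟩ := sep_exists hf0 hf
  set e1 := f.eval 0 with he1
  set e2 := f.eval (X - 1) with he2
  set e3 := f.eval (C (1/4) * (X * X)) with he3
  have n1 : e1 ≠ 0 := by
    intro h
    apply hv
    have := dvd_iff_isRoot.2 (show IsRoot f 0 from h)
    simpa [bv] using this
  have n2 : e2 ≠ 0 := by
    intro h
    apply hq
    have := dvd_iff_isRoot.2 (show IsRoot f (X - 1) from h)
    convert this using 1
    simp only [bu, bv, C_sub, C_1]; ring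
  have n3 : e3 ≠ 0 := by
    intro h
    apply hD
    have := dvd_iff_isRoot.2 (show IsRoot f (C (1/4) * (X * X)) from h)
    have e : bu * bu - 4 * bv = (X - C (C (1/4) * (X * X))) * C (C (-4)) := by
      have h4 : (C (C (1/4)) : ℝ[X][X]) * C (C (-4)) = -1 := by
        rw [← C_mul, ← C_mul]; norm_num
      have h5 : (C (C (-4)) : ℝ[X][X]) = -4 := by
        rw [C_neg, C_neg, C_C_ofNat]
      simp only [bu, bv, C_mul]
      linear_combination (C X * C X) * h4 - X * h5
    rw [e]
    refine (IsUnit.mul_right_dvd ?_).2 this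
    apply isUnit_C.2; apply isUnit_C.2; norm_num
  obtain ⟨A, hA, hAb⟩ := pe_bound a
  obtain ⟨K1, hK1, b1⟩ := pe_bound (C e1)
  obtain ⟨K2, hK2, b2⟩ := pe_bound (C e2)
  obtain ⟨K3, hK3, b3⟩ := pe_bound (C e3)
  obtain ⟨K4, hK4, b4⟩ := pe_bound (C c)
  refine bounded_case (p := c * (e1 * (e2 * e3)))
    (mul_ne_zero hc (mul_ne_zero n1 (mul_ne_zero n2 n3)))
    (K := A * K1 * K2 * K3 + K4 * K2 * K3 + K4 * K1 * K3 + K4 * K1 * K2) (by positivity) ?_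
  intro u v h
  obtain ⟨w, hw, hwv, hcase⟩ := fiber_min (f := f) h
  have hf1 := hp _ _ hw
  have b1 := b1 u w hw
  have b2 := b2 u w hw
  have b3 := b3 u w hw
  have b4 := b4 u w hw
  rw [pe_C] at b1 b2 b3 b4
  have hA := hAb u w hw
  set F := pe u w f with hF
  have key : ∀ x y z t Y Z T : ℝ, |x| ≤ Y * F → |y| ≤ Z → |z| ≤ T → ∀ W, |t| ≤ W → 0 ≤ Y → 0 ≤ Z → 0 ≤ T → 0 ≤ W →
      |x * y * z * t| ≤ Y * Z * T * W * F := by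
    intro x y z t Y Z T hx hy hz W ht hY hZ hT hW
    rw [abs_mul, abs_mul, abs_mul]
    calc |x| * |y| * |z| * |t| ≤ (Y * F) * Z * T * W := by gcongr
      _ = _ := by ring
  have fin : |eval u (c * (e1 * (e2 * e3)))| ≤ (A * K1 * K2 * K3 + K4 * K2 * K3 + K4 * K1 * K3 + K4 * K1 * K2) * F := by
    simp only [eval_mul]
    have p1 : 0 ≤ A * K1 * K2 * K3 * F := by positivity
    have p2 : 0 ≤ K4 * K2 * K3 * F := by positivity
    have p3 : 0 ≤ K4 * K1 * K3 * F := by positivity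
    have p4 : 0 ≤ K4 * K1 * K2 * F := by positivity
    rcases hcase with h0 | h0 | h0 | h0
    · have e : eval u e1 = F := by rw [he1, pe_eval, hF, h0]; simp
      have := key (eval u e1) (eval u c) (eval u e2) (eval u e3) 1 K4 K2 (by rw [e, abs_of_nonneg hf1, one_mul]) b4 b2 K3 b3
        zero_le_one hK4.le hK2.le hK3.le
      rw [show eval u c * (eval u e1 * (eval u e2 * eval u e3)) = eval u e1 * eval u c * eval u e2 * eval u e3 by ring]
      linarith
    · have e : eval u e2 = F := by rw [he2, pe_eval, hF, h0]; simp
      have := key (eval u e2) (eval u c) (eval u e1) (eval u e3) 1 K4 K1 (by rw [e, abs_of_nonneg hf1, one_mul]) b4 b1 K3 b3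
        zero_le_one hK4.le hK1.le hK3.le
      rw [show eval u c * (eval u e1 * (eval u e2 * eval u e3)) = eval u e2 * eval u c * eval u e1 * eval u e3 by ring]
      linarith
    · have e : eval u e3 = F := by rw [he3, pe_eval, hF, h0]; congr 2; simp; ring
      have := key (eval u e3) (eval u c) (eval u e1) (eval u e2) 1 K4 K1 (by rw [e, abs_of_nonneg hf1, one_mul]) b4 b1 K2 b2
        zero_le_one hK4.le hK1.le hK2.le
      rw [show eval u c * (eval u e1 * (eval u e2 * eval u e3)) = eval u e3 * eval u c * eval u e1 * eval u e2 by ring]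
      linarith
    · have e : eval u c = pe u w a * F := by
        have := congrArg (pe u w) habc
        rw [map_add, map_mul, map_mul, h0, pe_C] at this
        rw [← this, hF]; ring
      have := key (eval u c) (eval u e1) (eval u e2) (eval u e3) A K1 K2 (by rw [e, abs_mul, abs_of_nonneg hf1]; gcongr) b1 b2 K3 b3
        (by positivity) hK1.le hK2.le hK3.le
      rw [show eval u c * (eval u e1 * (eval u e2 * eval u e3)) = eval u c * eval u e1 * eval u e2 * eval u e3 by ring]
      linarith
  refine fin.trans ?_
  gcongr

theorem psd_T0 {f : ℝ[X][X]} (hp : Psd f) : f ∈ T0 := by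
  induction f using WellFounded.induction (wellFounded_dvdNotUnit (α := ℝ[X][X])) with
  | _ f ih =>
  by_cases hf0 : f = 0
  · rw [hf0]; exact zero_mem _
  have red : ∀ g, g ∈ T0 → ¬ IsUnit g → g ∣ f → f ∈ T0 := by
    rintro g hg hu ⟨f1, rfl⟩
    have hf1 : f1 ≠ 0 := right_ne_zero_of_mul hf0
    have hg0 : g ≠ 0 := left_ne_zero_of_mul hf0
    exact mul_mem hg (ih f1 ⟨hf1, g, hu, mul_comm _ _⟩ (dens hg0 (T0_pe hg) hp))
  have nu : ∀ g : ℝ[X][X], (∃ u v, pe u v g = 0) → ¬ IsUnit g := by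
    rintro g ⟨u, v, h⟩ hu
    exact not_isUnit_zero (h ▸ hu.map (pe u v))
  by_cases hv : bv ∣ f
  · exact red _ T0_v (nu _ ⟨0, 0, pe_v 0 0⟩) hv
  by_cases hq : (1 - bu + bv) ∣ f
  · exact red _ T0_q (nu _ ⟨1, 0, by simp [pe_u, pe_v]⟩) hq
  by_cases hD : (bu * bu - 4 * bv) ∣ f
  · exact red _ T0_D (nu _ ⟨0, 0, by simp [pe_u, pe_v]⟩) hD
  by_cases hs : Squarefree f
  · exact reduced_case hf0 hs hp hv hq hD
  · rw [Squarefree] at hs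
    push Not at hs
    obtain ⟨g, hg, hu⟩ := hs
    exact red _ (T0_sq g) (fun h => hu (isUnit_of_mul_isUnit_left h)) hg

end Glob8


open MvPolynomial

section Final9

/-- pullback to the plane -/
def Phi : Polynomial (Polynomial ℝ) →+* MvPolynomial (Fin 2) ℝ :=
  Polynomial.eval₂RingHom (Polynomial.eval₂RingHom MvPolynomial.C (MvPolynomial.X 0 ^ 2 + MvPolynomial.X 1 ^ 2))
    (MvPolynomial.X 0 ^ 2 * MvPolynomial.X 1 ^ 2)

lemma Phi_u : Phi bu = MvPolynomial.X 0 ^ 2 + MvPolynomial.X 1 ^ 2 := by simp [Phi, bu]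
lemma Phi_v : Phi bv = MvPolynomial.X 0 ^ 2 * MvPolynomial.X 1 ^ 2 := by simp [Phi, bv]
lemma Phi_C (r : ℝ) : Phi (Polynomial.C (Polynomial.C r)) = MvPolynomial.C r := by simp [Phi]

lemma Phi_pow_sum (n : ℕ) : (MvPolynomial.X 0 ^ (2 * n) + MvPolynomial.X 1 ^ (2 * n) : MvPolynomial (Fin 2) ℝ) ∈ Phi.range := by
  induction n using Nat.strong_induction_on with
  | _ n ih =>
  match n, ih with
  | 0, _ => exact ⟨2, by rw [map_ofNat]; norm_num⟩
  | 1, _ => exact ⟨bu, by rw [Phi_u]⟩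
  | n + 2, ih =>
    have h1 := ih (n + 1) (by omega)
    have h2 := ih n (by omega)
    have h3 : Phi bu ∈ Phi.range := ⟨bu, rfl⟩
    have h4 : Phi bv ∈ Phi.range := ⟨bv, rfl⟩
    rw [Phi_u] at h3
    rw [Phi_v] at h4
    convert sub_mem (mul_mem h3 h1) (mul_mem h4 h2) using 1
    ring

lemma Phi_sym (i j : ℕ) : (MvPolynomial.X 0 ^ (2 * i) * MvPolynomial.X 1 ^ (2 * j) +
    MvPolynomial.X 1 ^ (2 * i) * MvPolynomial.X 0 ^ (2 * j) : MvPolynomial (Fin 2) ℝ) ∈ Phi.range := by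
  have h4 : Phi bv ∈ Phi.range := ⟨bv, rfl⟩
  rw [Phi_v] at h4
  rcases le_total i j with h | h
  · obtain ⟨k, rfl⟩ := Nat.exists_eq_add_of_le h
    convert mul_mem (pow_mem h4 i) (Phi_pow_sum k) using 1
    ring
  · obtain ⟨k, rfl⟩ := Nat.exists_eq_add_of_le h
    convert mul_mem (pow_mem h4 j) (Phi_pow_sum k) using 1
    ring

/-- substitution -/
def subst2 (p q : MvPolynomial (Fin 2) ℝ) : MvPolynomial (Fin 2) ℝ →ₐ[ℝ] MvPolynomial (Fin 2) ℝ :=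
  MvPolynomial.aeval ![p, q]

lemma subst2_mon (p q : MvPolynomial (Fin 2) ℝ) (m : Fin 2 →₀ ℕ) (r : ℝ) :
    subst2 p q (MvPolynomial.monomial m r) = MvPolynomial.C r * (p ^ m 0 * q ^ m 1) := by
  rw [subst2, MvPolynomial.aeval_monomial, Finsupp.prod_fintype _ _ (by simp)]
  simp [Fin.prod_univ_two]

lemma subst2_comp (p q p' q' f : MvPolynomial (Fin 2) ℝ) :
    subst2 p q (subst2 p' q' f) = subst2 (subst2 p q p') (subst2 p q q') f := by
  have : (subst2 p q).comp (subst2 p' q') = subst2 (subst2 p q p') (subst2 p q q') := by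
    apply MvPolynomial.algHom_ext
    intro i
    fin_cases i <;> simp [subst2]
  exact congrArg (fun φ => φ f) this

lemma subst2_X0 (p q : MvPolynomial (Fin 2) ℝ) : subst2 p q (MvPolynomial.X 0) = p := by simp [subst2]
lemma subst2_X1 (p q : MvPolynomial (Fin 2) ℝ) : subst2 p q (MvPolynomial.X 1) = q := by simp [subst2]

lemma reynolds (f : MvPolynomial (Fin 2) ℝ) :
    subst2 (X 0) (X 1) f + subst2 (-X 0) (X 1) f + subst2 (X 0) (-X 1) f + subst2 (-X 0) (-X 1) f +
    (subst2 (X 1) (X 0) f + subst2 (-X 1) (X 0) f + subst2 (X 1) (-X 0) f + subst2 (-X 1) (-X 0) f) ∈ Phi.range := by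
  induction f using MvPolynomial.induction_on' with
  | add p q hp hq =>
    convert add_mem hp hq using 1
    simp only [map_add]; ring
  | monomial m r =>
    simp only [subst2_mon]
    have hC : ∀ r, MvPolynomial.C r ∈ Phi.range := fun r => ⟨_, Phi_C r⟩
    rcases Nat.even_or_odd (m 0) with h0 | h0 <;> rcases Nat.even_or_odd (m 1) with h1 | h1
    · simp only [h0.neg_pow, h1.neg_pow]
      obtain ⟨i, hi⟩ := h0
      obtain ⟨j, hj⟩ := h1
      convert mul_mem (hC (4 * r)) (Phi_sym i j) using 1
      rw [hi, hj, MvPolynomial.C_mul, map_ofNat MvPolynomial.C 4]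
      ring
    all_goals
      first
      | (simp only [h0.neg_pow, h1.neg_pow]
         convert zero_mem Phi.range using 1
         ring)

lemma inv_range {f : MvPolynomial (Fin 2) ℝ} (ha : subst2 (X 1) (-X 0) f = f) (hb : subst2 (X 1) (X 0) f = f) :
    ∃ F, Phi F = f := by
  have h1 : subst2 (-X 0) (X 1) f = f := by
    have := congrArg (subst2 (X 1) (-X 0)) hb
    rw [subst2_comp, subst2_X0, subst2_X1, ha] at this
    exact this
  have h2 : subst2 (X 0) (-X 1) f = f := by
    have := congrArg (subst2 (X 1) (X 0)) ha
    rw [subst2_comp, map_neg, subst2_X0, subst2_X1, hb] at this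
    exact this
  have h3 : subst2 (-X 0) (-X 1) f = f := by
    have := congrArg (subst2 (-X 0) (X 1)) h2
    rw [subst2_comp, map_neg, subst2_X0, subst2_X1, h1] at this
    exact this
  have h4 : subst2 (-X 1) (X 0) f = f := by
    have := congrArg (subst2 (X 1) (X 0)) h1
    rw [subst2_comp, map_neg, subst2_X0, subst2_X1, hb] at this
    exact this
  have h5 : subst2 (-X 1) (-X 0) f = f := by
    have := congrArg (subst2 (X 1) (X 0)) h3
    rw [subst2_comp, map_neg, map_neg, subst2_X0, subst2_X1, hb] at this
    exact this
  have h6 : subst2 (X 0) (X 1) f = f := by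
    have := congrArg (subst2 (X 1) (X 0)) hb
    rw [subst2_comp, subst2_X0, subst2_X1, hb] at this
    exact this
  obtain ⟨F, hF⟩ := reynolds f
  rw [h1, h2, h3, h4, h5, h6, ha, hb] at hF
  refine ⟨Polynomial.C (Polynomial.C (1/8)) * F, ?_⟩
  rw [map_mul, Phi_C, hF]
  have h8 : (MvPolynomial.C (1/8) : MvPolynomial (Fin 2) ℝ) * 8 = 1 := by
    rw [← map_ofNat MvPolynomial.C 8, ← map_mul]; norm_num
  linear_combination f * h8

lemma eval_Phi (p : Fin 2 → ℝ) (F : Polynomial (Polynomial ℝ)) :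
    MvPolynomial.eval p (Phi F) = pe (p 0 ^ 2 + p 1 ^ 2) (p 0 ^ 2 * p 1 ^ 2) F := by
  have : (MvPolynomial.eval p).comp Phi = pe (p 0 ^ 2 + p 1 ^ 2) (p 0 ^ 2 * p 1 ^ 2) := by
    apply Polynomial.ringHom_ext'
    · apply Polynomial.ringHom_ext'
      · ext r; simp [pe, Phi]
      · simp [pe, Phi]
    · simp [pe, Phi]
  exact congrArg (fun φ => φ F) this

lemma Phi_T0 {t : Polynomial (Polynomial ℝ)} (ht : t ∈ T0) :
    Phi t ∈ preorderingGen {(2 - X 0 ^ 2 - X 1 ^ 2 : MvPolynomial (Fin 2) ℝ), (1 - X 0 ^ 2) * (1 - X 1 ^ 2)} := by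
  set S : Set (MvPolynomial (Fin 2) ℝ) := {(2 - X 0 ^ 2 - X 1 ^ 2 : MvPolynomial (Fin 2) ℝ), (1 - X 0 ^ 2) * (1 - X 1 ^ 2)} with hS
  have hsq : ∀ a : MvPolynomial (Fin 2) ℝ, a ^ 2 ∈ Subsemiring.closure (S ∪ {a | ∃ b, a = b ^ 2}) :=
    fun a => Subsemiring.subset_closure (Or.inr ⟨a, rfl⟩)
  have : T0 ≤ (Subsemiring.closure (S ∪ {a | ∃ b, a = b ^ 2})).comap Phi := by
    apply Subsemiring.closure_le.2
    rintro a (ha | ⟨b, rfl⟩)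
    · simp only [SetLike.mem_coe, Subsemiring.mem_comap]
      simp only [Set.mem_insert_iff, Set.mem_singleton_iff] at ha
      rcases ha with rfl | rfl | rfl | rfl | rfl
      · rw [Phi_u]; exact add_mem (hsq _) (hsq _)
      · apply Subsemiring.subset_closure
        left; left
        rw [map_sub, Phi_u, map_ofNat]; ring
      · rw [Phi_v, ← mul_pow]; exact hsq _
      · apply Subsemiring.subset_closure
        left; right
        rw [Set.mem_singleton_iff, map_add, map_sub, Phi_u, Phi_v, map_one]; ring
      · convert hsq (X 0 ^ 2 - X 1 ^ 2) using 1
        rw [map_sub, map_mul, map_mul, Phi_u, Phi_v, map_ofNat]; ring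
    · simp only [SetLike.mem_coe, Subsemiring.mem_comap, map_mul]
      rw [← sq]; exact hsq _
  exact this ht

end Final9

/-- For the standard action of the dihedral group of order 8 on
`ℝ[x,y]` (generated by `a : x ↦ y, y ↦ −x` and `b : x ↦ y, y ↦ x`), the preordering of
`ℝ[x,y]` generated by `S' = {2 − x² − y², (1 − x²)(1 − y²)}` is `G`-saturated: every
`G`-invariant polynomial nonnegative on `K_{S'} = [−1,1]²` belongs to it. -/
theorem G_saturated_example (f : MvPolynomial (Fin 2) ℝ)
    (hinv_a : aeval ![(X 1 : MvPolynomial (Fin 2) ℝ), -X 0] f = f)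
    (hinv_b : aeval ![(X 1 : MvPolynomial (Fin 2) ℝ), X 0] f = f)
    (hf : ∀ p : Fin 2 → ℝ, 0 ≤ 2 - (p 0) ^ 2 - (p 1) ^ 2 →
      0 ≤ (1 - (p 0) ^ 2) * (1 - (p 1) ^ 2) → 0 ≤ eval p f) :
    f ∈ preorderingGen {(2 - X 0 ^ 2 - X 1 ^ 2 : MvPolynomial (Fin 2) ℝ),
      (1 - X 0 ^ 2) * (1 - X 1 ^ 2)} := by
  obtain ⟨F, rfl⟩ := inv_range hinv_a hinv_b
  apply Phi_T0
  apply psd_T0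
  intro u v h
  obtain ⟨s, t, hs, hs1, ht, ht1, rfl, rfl⟩ := Rg_param h
  have := hf ![Real.sqrt s, Real.sqrt t]
  rw [eval_Phi] at this
  simp only [Matrix.cons_val_zero, Matrix.cons_val_one, Real.sq_sqrt hs, Real.sq_sqrt ht] at this
  exact this (by linarith) (mul_nonneg (by linarith) (by linarith))
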